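/- For n ≥ 3, the natural homomorphism Aut(C(B_n)) → Aut(C(B_n)/Z) is a split surjection: it is surjective and admits a group-homomorphism section Aut(C(B_n)/Z) → Aut(C(B_n)). -/

import Mathlib

/-- The defining relations of the Artin group of type `B_n`, on generators `s_1, …, s_n`
(indexed by `Fin n`, so `s_{i+1}` corresponds to the index `i`):
`s_1 s_2 s_1 s_2 = s_2 s_1 s_2 s_1`, the braid relation `s_i s_{i+1} s_i = s_{i+1} s_i s_{i+1}`
for `2 ≤ i ≤ n-1`, and the commutation `s_i s_j = s_j s_i` for `|i - j| ≥ 2`. -/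
def typeBRels (n : ℕ) : Set (FreeGroup (Fin n)) :=
  {r | (∃ i j : Fin n, (i : ℕ) = 0 ∧ (j : ℕ) = 1 ∧
          r = (.of i * .of j) ^ 2 * ((.of j * .of i) ^ 2)⁻¹) ∨
       (∃ i j : Fin n, 1 ≤ (i : ℕ) ∧ (i : ℕ) + 1 = (j : ℕ) ∧
          r = .of i * .of j * .of i * (.of j * .of i * .of j)⁻¹) ∨
       (∃ i j : Fin n, (i : ℕ) + 2 ≤ (j : ℕ) ∧
          r = .of i * .of j * (.of j * .of i)⁻¹)}

/-- The Artin group of type `B_n`. -/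
abbrev ArtinB (n : ℕ) : Type := PresentedGroup (typeBRels n)

/-- The standard generator `s_{i+1}` of the Artin group of type `B_n`. -/
def artinBGen {n : ℕ} (i : Fin n) : ArtinB n := PresentedGroup.of i

/-- The element `z = (s_1 s_2 ⋯ s_n)^n`, which generates the center of the Artin group of
type `B_n`. -/
def artinBTwist (n : ℕ) : ArtinB n :=
  ((List.ofFn fun i : Fin n => artinBGen i).prod) ^ n

/-- The natural homomorphism `Aut(G) → Aut(G/Z(G))` induced by the fact that the center is a
characteristic subgroup. -/
def centerQuotAut (G : Type*) [Group G] :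
    MulAut G →* MulAut (G ⧸ Subgroup.center G) where
  toFun φ := QuotientGroup.congr (Subgroup.center G) (Subgroup.center G) φ
    (Subgroup.characteristic_iff_map_eq.mp inferInstance φ)
  map_one' := by
    ext x
    induction x using QuotientGroup.induction_on with
    | _ g => rfl
  map_mul' φ ψ := by
    ext x
    induction x using QuotientGroup.induction_on with
    | _ g => rfl

namespace ArtinB

/-! ### Generators indexed by natural numbers -/

variable {n : ℕ}

/-- The generator `s_{i+1}`, read as `1` when `i` is out of range. -/
def gen (n i : ℕ) : ArtinB n := if h : i < n then artinBGen ⟨i, h⟩ else 1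

theorem gen_of_lt {i : ℕ} (h : i < n) : gen n i = artinBGen ⟨i, h⟩ := dif_pos h

theorem gen_of_le {i : ℕ} (h : n ≤ i) : gen n i = 1 := dif_neg (by omega)

theorem gen_four (n : ℕ) : (gen n 0 * gen n 1) ^ 2 = (gen n 1 * gen n 0) ^ 2 := by
  by_cases h : 1 < n
  · rw [gen_of_lt h, gen_of_lt (by omega : 0 < n)]
    exact mul_inv_eq_one.mp (PresentedGroup.one_of_mem (rels := typeBRels n)
      (Or.inl ⟨⟨0, by omega⟩, ⟨1, h⟩, rfl, rfl, rfl⟩))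
  · rw [gen_of_le (by omega : n ≤ 1)]; simp

theorem gen_braid {i : ℕ} (hi : 1 ≤ i) (h : i + 1 < n) :
    gen n i * gen n (i + 1) * gen n i = gen n (i + 1) * gen n i * gen n (i + 1) := by
  rw [gen_of_lt h, gen_of_lt (by omega : i < n)]
  exact mul_inv_eq_one.mp (PresentedGroup.one_of_mem (rels := typeBRels n)
    (Or.inr (Or.inl ⟨⟨i, by omega⟩, ⟨i + 1, h⟩, hi, rfl, rfl⟩)))

theorem gen_comm {i j : ℕ} (h : i + 2 ≤ j) : Commute (gen n i) (gen n j) := by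
  by_cases hj : j < n
  · rw [gen_of_lt hj, gen_of_lt (by omega : i < n)]
    exact mul_inv_eq_one.mp (PresentedGroup.one_of_mem (rels := typeBRels n)
      (Or.inr (Or.inr ⟨⟨i, by omega⟩, ⟨j, hj⟩, h, rfl⟩)))
  · rw [gen_of_le (by omega : n ≤ j)]; exact Commute.one_right _

/-- A family of group elements satisfying the relations of the Artin group of type `B_n`
defines a homomorphism. -/
def lift {H : Type*} [Group H] (n : ℕ) (f : ℕ → H)
    (h4 : 1 < n → (f 0 * f 1) ^ 2 = (f 1 * f 0) ^ 2)
    (hb : ∀ i, 1 ≤ i → i + 1 < n → f i * f (i + 1) * f i = f (i + 1) * f i * f (i + 1))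
    (hc : ∀ i j, i + 2 ≤ j → j < n → Commute (f i) (f j)) : ArtinB n →* H :=
  PresentedGroup.toGroup (f := fun i : Fin n => f i) (by
    rintro r (⟨i, j, hi, hj, rfl⟩ | ⟨i, j, hi, hj, rfl⟩ | ⟨i, j, hij, rfl⟩)
    · have := h4 (by omega)
      simp [hi, hj, this]
    · have := hb i hi (by omega)
      rw [hj] at this
      simp [this]
    · have := (hc i j hij j.2).eq
      simp only [map_mul, FreeGroup.lift_apply_of, map_inv, this, mul_inv_cancel])

@[simp]
theorem lift_gen {H : Type*} [Group H] {f : ℕ → H} {h4 hb hc} {i : ℕ} (hi : i < n) :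
    lift n f h4 hb hc (gen n i) = f i := by
  rw [gen_of_lt hi]
  exact PresentedGroup.toGroup.of _

theorem mem_of_gen_mem (K : Subgroup (ArtinB n)) (h : ∀ i, i < n → gen n i ∈ K) (g : ArtinB n) :
    g ∈ K := by
  have : (⊤ : Subgroup (ArtinB n)) ≤ K := by
    rw [← PresentedGroup.closure_range_of (typeBRels n), Subgroup.closure_le]
    rintro _ ⟨i, rfl⟩
    have := h i i.2
    rwa [gen_of_lt i.2] at this
  exact this trivial

theorem hom_ext {H : Type*} [Group H] {f g : ArtinB n →* H}
    (h : ∀ i, i < n → f (gen n i) = g (gen n i)) : f = g :=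
  MonoidHom.ext fun x => mem_of_gen_mem (f.eqLocus g) h x

end ArtinB

namespace ArtinB

/-! ### Crossing data of braids -/

/-- Crossing data of a braid with strands labelled by `ℕ`: the numbers of crossings of ordered
pairs of strands, a quadratic count for triples of strands, and the underlying permutation. -/
@[ext]
structure Crossing where
  /-- signed numbers of crossings in which the second strand passes over the first -/
  v : ℕ → ℕ → ℤ
  /-- quadratic correction -/
  t : ℕ → ℕ → ℕ → ℤ
  /-- underlying permutation -/
  σ : Equiv.Perm ℕ

namespace Crossing

instance : Mul Crossing where
  mul g h :=
    { v := fun a b => g.v a b + h.v (g.σ⁻¹ a) (g.σ⁻¹ b)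
      t := fun a b c => g.t a b c + h.t (g.σ⁻¹ a) (g.σ⁻¹ b) (g.σ⁻¹ c) +
        (g.v a b * h.v (g.σ⁻¹ a) (g.σ⁻¹ c) + g.v b c * h.v (g.σ⁻¹ a) (g.σ⁻¹ b) +
          g.v a c * h.v (g.σ⁻¹ c) (g.σ⁻¹ b))
      σ := g.σ * h.σ }

instance : One Crossing where
  one := { v := fun _ _ => 0, t := fun _ _ _ => 0, σ := 1 }

instance : Inv Crossing where
  inv g :=
    { v := fun a b => -g.v (g.σ a) (g.σ b)
      t := fun a b c => -g.t (g.σ a) (g.σ b) (g.σ c) +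
        (g.v (g.σ a) (g.σ b) * g.v (g.σ a) (g.σ c) + g.v (g.σ b) (g.σ c) * g.v (g.σ a) (g.σ b) +
          g.v (g.σ a) (g.σ c) * g.v (g.σ c) (g.σ b))
      σ := g.σ⁻¹ }

theorem mul_v (g h : Crossing) (a b : ℕ) :
    (g * h).v a b = g.v a b + h.v (g.σ⁻¹ a) (g.σ⁻¹ b) := rfl

theorem mul_t (g h : Crossing) (a b c : ℕ) :
    (g * h).t a b c = g.t a b c + h.t (g.σ⁻¹ a) (g.σ⁻¹ b) (g.σ⁻¹ c) +
        (g.v a b * h.v (g.σ⁻¹ a) (g.σ⁻¹ c) + g.v b c * h.v (g.σ⁻¹ a) (g.σ⁻¹ b) +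
          g.v a c * h.v (g.σ⁻¹ c) (g.σ⁻¹ b)) := rfl

@[simp]
theorem mul_σ (g h : Crossing) : (g * h).σ = g.σ * h.σ := rfl

@[simp]
theorem one_v (a b : ℕ) : (1 : Crossing).v a b = 0 := rfl

@[simp]
theorem one_t (a b c : ℕ) : (1 : Crossing).t a b c = 0 := rfl

@[simp]
theorem one_σ : (1 : Crossing).σ = 1 := rfl

theorem inv_v (g : Crossing) (a b : ℕ) : g⁻¹.v a b = -g.v (g.σ a) (g.σ b) := rfl

theorem inv_t (g : Crossing) (a b c : ℕ) : g⁻¹.t a b c = -g.t (g.σ a) (g.σ b) (g.σ c) +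
        (g.v (g.σ a) (g.σ b) * g.v (g.σ a) (g.σ c) + g.v (g.σ b) (g.σ c) * g.v (g.σ a) (g.σ b) +
          g.v (g.σ a) (g.σ c) * g.v (g.σ c) (g.σ b)) := rfl

@[simp]
theorem inv_σ (g : Crossing) : g⁻¹.σ = g.σ⁻¹ := rfl

instance : Group Crossing :=
  Group.ofLeftAxioms
    (by
      intro g h k
      ext
      · simp only [mul_v, mul_σ, mul_inv_rev, Equiv.Perm.mul_apply]; ring
      · simp only [mul_v, mul_t, mul_σ, mul_inv_rev, Equiv.Perm.mul_apply]; ring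
      · simp)
    (by
      intro g
      ext
      · simp [mul_v]
      · simp [mul_t]
      · simp)
    (by
      intro g
      ext
      · simp [mul_v, inv_v]
      · simp only [mul_t, inv_v, inv_t, inv_σ, inv_inv, one_t]; ring
      · simp)

/-- The permutation underlying crossing data. -/
@[simps]
def perm : Crossing →* Equiv.Perm ℕ where
  toFun := σ
  map_one' := rfl
  map_mul' _ _ := rfl

/-- The elementary crossing of the strands `i` and `i + 1`. -/
def elem (i : ℕ) : Crossing where
  v a b := if a = i ∧ b = i + 1 then 1 else 0
  t _ _ _ := 0
  σ := Equiv.swap i (i + 1)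

theorem elem_braid (i : ℕ) : elem i * elem (i + 1) * elem i = elem (i + 1) * elem i * elem (i + 1) := by
  have h1 : ∀ a, (Equiv.swap i (i+1)) a = if a = i then i + 1 else if a = i + 1 then i else a :=
    fun a => Equiv.swap_apply_def _ _ _
  have h2 : ∀ a, (Equiv.swap (i+1) (i+1+1)) a =
      if a = i + 1 then i + 2 else if a = i + 2 then i + 1 else a :=
    fun a => Equiv.swap_apply_def _ _ _
  have k1 : ∀ a b, (elem i).v ((Equiv.swap (i+1) (i+1+1)) a) ((Equiv.swap (i+1) (i+1+1)) b) =
      if a = i ∧ b = i + 2 then 1 else 0 := by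
    intro a b; simp only [elem, h2]; congr 1; grind
  have k2 : ∀ a b, (elem (i+1)).v ((Equiv.swap i (i+1)) a) ((Equiv.swap i (i+1)) b) =
      if a = i ∧ b = i + 2 then 1 else 0 := by
    intro a b; simp only [elem, h1]; congr 1; grind
  have k3 : ∀ a b, (if (Equiv.swap i (i+1)) a = i ∧ (Equiv.swap i (i+1)) b = i + 2 then (1 : ℤ)
      else 0) = (elem (i+1)).v a b := by
    intro a b; simp only [elem, h1]; congr 1; grind
  have k4 : ∀ a b, (if (Equiv.swap (i+1) (i+1+1)) a = i ∧ (Equiv.swap (i+1) (i+1+1)) b = i + 2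
      then (1 : ℤ) else 0) = (elem i).v a b := by
    intro a b; simp only [elem, h2]; congr 1; grind
  have s1 : (elem i).σ = Equiv.swap i (i+1) := rfl
  have s2 : (elem (i+1)).σ = Equiv.swap (i+1) (i+1+1) := rfl
  have t0 : ∀ j a b c, (elem j).t a b c = 0 := fun _ _ _ _ => rfl
  ext a b
  · simp only [mul_v, mul_σ, s1, s2, mul_inv_rev, Equiv.swap_inv, Equiv.Perm.mul_apply, k1, k2, k3,
      k4]
    ring
  · rename_i c
    simp only [mul_v, mul_t, mul_σ, s1, s2, mul_inv_rev, Equiv.swap_inv, Equiv.Perm.mul_apply, k1, k2,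
      k3, k4, t0]
    simp only [elem]
    grind
  · simp only [mul_σ, s1, s2, Equiv.Perm.mul_apply, h1, h2]
    grind

theorem elem_comm {i j : ℕ} (h : i + 2 ≤ j) : Commute (elem i) (elem j) := by
  have h1 : ∀ i a, (Equiv.swap i (i+1)) a = if a = i then i + 1 else if a = i + 1 then i else a :=
    fun i a => Equiv.swap_apply_def _ _ _
  have k1 : ∀ a b, (elem i).v ((Equiv.swap j (j+1)) a) ((Equiv.swap j (j+1)) b) =
      (elem i).v a b := by
    intro a b; simp only [elem, h1]; congr 1; grind
  have k2 : ∀ a b, (elem j).v ((Equiv.swap i (i+1)) a) ((Equiv.swap i (i+1)) b) =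
      (elem j).v a b := by
    intro a b; simp only [elem, h1]; congr 1; grind
  have s1 : ∀ i, (elem i).σ = Equiv.swap i (i+1) := fun _ => rfl
  have t0 : ∀ j a b c, (elem j).t a b c = 0 := fun _ _ _ _ => rfl
  ext a b
  · simp only [mul_v, s1, Equiv.swap_inv, k1, k2]
    ring
  · rename_i c
    simp only [mul_t, s1, Equiv.swap_inv, k1, k2, t0]
    simp only [elem]
    grind
  · simp only [mul_σ, s1, Equiv.Perm.mul_apply, h1]
    grind

end Crossing

/-- If `a` and `b` satisfy the braid relation, then `a ^ 2` and `b` satisfy the relation of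
length four. -/
theorem four_of_braid {H : Type*} [Group H] {a b : H} (h : a * b * a = b * a * b) :
    (a ^ 2 * b) ^ 2 = (b * a ^ 2) ^ 2 := by
  have h1 : a * b * a * a = b * (a * b * a) :=
    calc a * b * a * a = b * a * b * a := by rw [h]
      _ = _ := by simp only [mul_assoc]
  have h2 : a * (a * b * a) = a * b * a * b :=
    calc a * (a * b * a) = a * (b * a * b) := by rw [h]
      _ = _ := by simp only [mul_assoc]
  calc (a ^ 2 * b) ^ 2 = a * (a * b * a) * (a * b) := by simp only [pow_two, mul_assoc]
    _ = (a * b * a) * (b * a * b) := by rw [h2]; simp only [mul_assoc]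
    _ = (a * b * a * a) * (b * a) := by rw [← h]; simp only [mul_assoc]
    _ = b * (a * b * a) * (b * a) := by rw [h1]
    _ = (b * a * b) * (a * b * a) := by simp only [mul_assoc]
    _ = (b * a) * (b * a * b) * a := by simp only [mul_assoc]
    _ = (b * a ^ 2) ^ 2 := by rw [← h]; simp only [pow_two, mul_assoc]

variable {n : ℕ}

/-- The crossing data of the elements of the Artin group of type `B_n`, seen as braids on the strands
`0, …, n` for which the strand `0` is pure. -/
def cr (n : ℕ) : ArtinB n →* Crossing :=
  lift n (fun i => if i = 0 then Crossing.elem 0 ^ 2 else Crossing.elem i)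
    (fun _ => four_of_braid (Crossing.elem_braid 0))
    (fun i hi _ => by
      simpa only [if_neg (by omega : i ≠ 0), if_neg (by omega : i + 1 ≠ 0)] using
        Crossing.elem_braid i)
    (fun i j hij _ => by
      rw [if_neg (by omega : j ≠ 0)]
      split_ifs with h
      · exact (Crossing.elem_comm (by omega)).pow_left 2
      · exact Crossing.elem_comm hij)

theorem cr_gen_zero (hn : 0 < n) : cr n (gen n 0) = Crossing.elem 0 ^ 2 := lift_gen hn

theorem cr_gen {i : ℕ} (h0 : 1 ≤ i) (hi : i < n) : cr n (gen n i) = Crossing.elem i :=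
  (lift_gen hi).trans (if_neg (by omega))

/-- The permutation of the strands. -/
def sg (n : ℕ) : ArtinB n →* Equiv.Perm ℕ := Crossing.perm.comp (cr n)

/-- The crossing numbers. -/
def cv (g : ArtinB n) (a b : ℕ) : ℤ := (cr n g).v a b

theorem cv_mul (g h : ArtinB n) (a b : ℕ) :
    cv (g * h) a b = cv g a b + cv h ((sg n g)⁻¹ a) ((sg n g)⁻¹ b) := by
  simp only [cv, map_mul, Crossing.mul_v]; rfl

@[simp]
theorem cv_one (a b : ℕ) : cv (1 : ArtinB n) a b = 0 := by simp [cv]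

theorem cv_inv (g : ArtinB n) (a b : ℕ) : cv g⁻¹ a b = -cv g (sg n g a) (sg n g b) := by
  simp only [cv, map_inv, Crossing.inv_v]; rfl

theorem sg_gen_zero : sg n (gen n 0) = 1 := by
  rcases Nat.eq_zero_or_pos n with h | h
  · rw [gen_of_le (by omega)]; simp
  · simp only [sg, MonoidHom.comp_apply, cr_gen_zero h]
    simp [Crossing.elem, pow_two]

theorem sg_gen {i : ℕ} (h0 : 1 ≤ i) (hi : i < n) : sg n (gen n i) = Equiv.swap i (i + 1) := by
  simp only [sg, MonoidHom.comp_apply, cr_gen h0 hi]; rfl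

theorem cv_gen_zero (hn : 0 < n) (a b : ℕ) :
    cv (gen n 0) a b = if (a = 0 ∧ b = 1) ∨ (a = 1 ∧ b = 0) then 1 else 0 := by
  simp only [cv, cr_gen_zero hn, pow_two, Crossing.mul_v, Crossing.elem, Equiv.swap_inv]
  simp only [Equiv.swap_apply_def]
  grind

theorem cv_gen {i : ℕ} (h0 : 1 ≤ i) (hi : i < n) (a b : ℕ) :
    cv (gen n i) a b = if a = i ∧ b = i + 1 then 1 else 0 := by
  simp only [cv, cr_gen h0 hi]; rfl

/-- Pure elements which commute satisfy a determinantal relation for each triple of strands. -/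
theorem det_of_commute {g h : ArtinB n} (hg : sg n g = 1) (hh : sg n h = 1) (hc : Commute g h)
    (a b c : ℕ) :
    cv g a b * cv h a c + cv g b c * cv h a b + cv g a c * cv h c b =
      cv h a b * cv g a c + cv h b c * cv g a b + cv h a c * cv g c b := by
  have h1 : (cr n g).σ = 1 := hg
  have h2 : (cr n h).σ = 1 := hh
  have := congrArg (fun x => (cr n x).t a b c) hc.eq
  simp only [map_mul, Crossing.mul_t, h1, h2, inv_one, Equiv.Perm.one_apply] at this
  simp only [cv]
  linarith

end ArtinB

namespace ArtinB

variable {n : ℕ}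

theorem perm_inv_apply_self {α : Type*} (f : Equiv.Perm α) (x : α) : f⁻¹ (f x) = x :=
  f.symm_apply_apply x

theorem perm_apply_inv_self {α : Type*} (f : Equiv.Perm α) (x : α) : f (f⁻¹ x) = x :=
  f.apply_symm_apply x

/-- Induction on the elements of the Artin group. -/
theorem gen_induction {p : ArtinB n → Prop} (hgen : ∀ i, i < n → p (gen n i)) (hone : p 1)
    (hmul : ∀ g h, p g → p h → p (g * h)) (hinv : ∀ g, p g → p g⁻¹) (g : ArtinB n) : p g :=
  mem_of_gen_mem
    { carrier := {g | p g}
      one_mem' := hone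
      mul_mem' := fun {_ _} hg hh => hmul _ _ hg hh
      inv_mem' := fun {_} hg => hinv _ hg } hgen g

/-! ### Degrees -/

/-- The homomorphism to `ℤ` with value `x` on `s_1` and `y` on the other generators. -/
def degHom (n : ℕ) (x y : ℤ) : ArtinB n →* Multiplicative ℤ :=
  lift n (fun i => .ofAdd (if i = 0 then x else y))
    (fun _ => by rw [mul_comm])
    (fun i hi _ => by simp [show i ≠ 0 by omega])
    (fun _ _ _ _ => Commute.all _ _)

/-- The total exponent of `s_1`. -/
def delta (g : ArtinB n) : ℤ := (degHom n 1 0 g).toAdd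

/-- The total exponent of the generators other than `s_1`. -/
def beta (g : ArtinB n) : ℤ := (degHom n 0 1 g).toAdd

@[simp] theorem delta_one : delta (1 : ArtinB n) = 0 := by simp [delta]
@[simp] theorem delta_mul (g h : ArtinB n) : delta (g * h) = delta g + delta h := by simp [delta]
@[simp] theorem delta_inv (g : ArtinB n) : delta g⁻¹ = -delta g := by simp [delta]
@[simp] theorem delta_pow (g : ArtinB n) (k : ℕ) : delta (g ^ k) = k * delta g := by
  simp [delta]
@[simp] theorem delta_zpow (g : ArtinB n) (k : ℤ) : delta (g ^ k) = k * delta g := by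
  simp [delta]
@[simp] theorem beta_one : beta (1 : ArtinB n) = 0 := by simp [beta]
@[simp] theorem beta_mul (g h : ArtinB n) : beta (g * h) = beta g + beta h := by simp [beta]
@[simp] theorem beta_inv (g : ArtinB n) : beta g⁻¹ = -beta g := by simp [beta]
@[simp] theorem beta_pow (g : ArtinB n) (k : ℕ) : beta (g ^ k) = k * beta g := by
  simp [beta]
@[simp] theorem beta_zpow (g : ArtinB n) (k : ℤ) : beta (g ^ k) = k * beta g := by
  simp [beta]

theorem delta_gen {i : ℕ} (h0 : 1 ≤ i) : delta (gen n i) = 0 := by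
  rcases lt_or_ge i n with h | h
  · simp [delta, degHom, lift_gen h, show i ≠ 0 by omega]
  · simp [gen_of_le h]

theorem delta_gen_zero (hn : 0 < n) : delta (gen n 0) = 1 := by
  simp [delta, degHom, lift_gen hn]

theorem beta_gen {i : ℕ} (h0 : 1 ≤ i) (h : i < n) : beta (gen n i) = 1 := by
  simp [beta, degHom, lift_gen h, show i ≠ 0 by omega]

theorem beta_gen_zero : beta (gen n 0) = 0 := by
  rcases lt_or_ge 0 n with h | h
  · simp [beta, degHom, lift_gen h]
  · simp [gen_of_le h]

/-- Generators other than `s_1` have the same image in abelian groups. -/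
theorem map_gen_eq {A : Type*} [CommGroup A] (f : ArtinB n →* A) {i : ℕ} (h0 : 1 ≤ i)
    (h : i < n) : f (gen n i) = f (gen n 1) := by
  induction i, h0 using Nat.le_induction with
  | base => rfl
  | succ i hi ih =>
    rw [← ih (by omega)]
    have := congrArg f (gen_braid hi h)
    simp only [map_mul] at this
    rw [mul_comm (f (gen n (i + 1))) (f (gen n i))] at this
    exact (mul_left_cancel this).symm

/-- Additive functions on the group are combinations of `delta` and `beta`. -/
theorem additive_eq (f : ArtinB n → ℤ) (hf : ∀ g h, f (g * h) = f g + f h) (g : ArtinB n) :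
    f g = f (gen n 0) * delta g + f (gen n 1) * beta g := by
  have h1 : f 1 = 0 := by simpa using hf 1 1
  let F : ArtinB n →* Multiplicative ℤ :=
    { toFun := fun g => .ofAdd (f g)
      map_one' := by simp [h1]
      map_mul' := fun g h => by simp [hf] }
  induction g using gen_induction with
  | hgen i hi =>
    rcases Nat.eq_zero_or_pos i with rfl | h0
    · rw [delta_gen_zero hi, beta_gen_zero]; ring
    · have : F (gen n i) = F (gen n 1) := map_gen_eq F h0 hi
      rw [delta_gen h0, beta_gen h0 hi, show f (gen n i) = f (gen n 1) from
        congrArg Multiplicative.toAdd this]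
      ring
  | hone => simp [h1]
  | hmul g h ihg ihh => rw [hf, ihg, ihh, delta_mul, beta_mul]; ring
  | hinv g ih =>
    have : f g⁻¹ = -f g := by
      have := hf g⁻¹ g
      rw [inv_mul_cancel, h1] at this
      linarith
    rw [this, ih, delta_inv, beta_inv]; ring

/-! ### Permutations -/

theorem sg_apply_le (g : ArtinB n) :
    sg n g 0 = 0 ∧ (∀ j, n < j → sg n g j = j) := by
  induction g using gen_induction with
  | hgen i hi =>
    rcases Nat.eq_zero_or_pos i with rfl | h0
    · simp [sg_gen_zero]
    · rw [sg_gen h0 hi]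
      exact ⟨Equiv.swap_apply_of_ne_of_ne (by omega) (by omega),
        fun j hj => Equiv.swap_apply_of_ne_of_ne (by omega) (by omega)⟩
  | hone => simp
  | hmul g h ihg ihh =>
    refine ⟨by simp [ihg.1, ihh.1], fun j hj => ?_⟩
    simp [ihh.2 j hj, ihg.2 j hj]
  | hinv g ih =>
    refine ⟨?_, fun j hj => ?_⟩
    · rw [map_inv, Equiv.Perm.inv_eq_iff_eq, ih.1]
    · rw [map_inv, Equiv.Perm.inv_eq_iff_eq, ih.2 j hj]

@[simp]
theorem sg_zero (g : ArtinB n) : sg n g 0 = 0 := (sg_apply_le g).1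

@[simp]
theorem sg_inv_zero (g : ArtinB n) : (sg n g)⁻¹ 0 = 0 := by rw [← map_inv, sg_zero]

theorem sg_of_lt (g : ArtinB n) {j : ℕ} (h : n < j) : sg n g j = j := (sg_apply_le g).2 j h

theorem sg_mem (g : ArtinB n) {j : ℕ} (h : 1 ≤ j ∧ j ≤ n) : 1 ≤ sg n g j ∧ sg n g j ≤ n := by
  constructor
  · by_contra! h0
    have : sg n g j = sg n g 0 := by rw [sg_zero]; omega
    have := (sg n g).injective this
    omega
  · by_contra! h0
    have := (sg n g).injective (sg_of_lt g h0)
    omega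

theorem sg_inv_mem (g : ArtinB n) {j : ℕ} (h : 1 ≤ j ∧ j ≤ n) :
    1 ≤ (sg n g)⁻¹ j ∧ (sg n g)⁻¹ j ≤ n := by
  rw [← map_inv]; exact sg_mem _ h

theorem swap_mem_range {a b : ℕ} (ha : 1 ≤ a) (hab : a < b) (hb : b ≤ n) :
    ∃ g, sg n g = Equiv.swap a b := by
  induction b, hab using Nat.le_induction with
  | base => exact ⟨gen n a, sg_gen ha hb⟩
  | succ b hab ih =>
    obtain ⟨g, hg⟩ := ih (by omega)
    refine ⟨gen n b * g * gen n b, ?_⟩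
    rw [map_mul, map_mul, sg_gen (by omega) (by omega), hg]
    have := Equiv.swap_mul_swap_mul_swap (x := a) (y := b) (z := b + 1) (by omega) (by omega)
    rw [this, Equiv.swap_comm]

theorem swap_mem_range' {a b : ℕ} (ha : 1 ≤ a ∧ a ≤ n) (hb : 1 ≤ b ∧ b ≤ n) :
    ∃ g, sg n g = Equiv.swap a b := by
  rcases lt_trichotomy a b with h | rfl | h
  · exact swap_mem_range ha.1 h hb.2
  · exact ⟨1, by simp [Equiv.Perm.one_def]⟩
  · rw [Equiv.swap_comm]; exact swap_mem_range hb.1 h ha.2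

/-! ### Crossing numbers -/

@[simp]
theorem cv_self (g : ArtinB n) : ∀ a : ℕ, cv g a a = 0 := by
  induction g using gen_induction with
  | hgen i hi =>
    intro a
    rcases Nat.eq_zero_or_pos i with rfl | h0
    · rw [cv_gen_zero hi, if_neg (by omega)]
    · rw [cv_gen h0 hi, if_neg (by omega)]
  | hone => simp
  | hmul g h ihg ihh => intro a; rw [cv_mul, ihg, ihh]; rfl
  | hinv g ih => intro a; rw [cv_inv, ih]; rfl

theorem cv_sub_cv (g : ArtinB n) : ∀ a b : ℕ, cv g a b - cv g b a =
    (if a < b then 1 else 0) - (if (sg n g)⁻¹ a < (sg n g)⁻¹ b then 1 else 0) := by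
  induction g using gen_induction with
  | hgen i hi =>
    intro a b
    rcases Nat.eq_zero_or_pos i with rfl | h0
    · rw [cv_gen_zero hi, cv_gen_zero hi, sg_gen_zero, inv_one, Equiv.Perm.one_apply,
        Equiv.Perm.one_apply]
      grind
    · rw [cv_gen h0 hi, cv_gen h0 hi, sg_gen h0 hi, Equiv.swap_inv]
      simp only [Equiv.swap_apply_def]
      grind
  | hone => simp
  | hmul g h ihg ihh =>
    intro a b
    have h1 := ihg a b
    have h2 := ihh ((sg n g)⁻¹ a) ((sg n g)⁻¹ b)
    simp only [cv_mul, map_mul, mul_inv_rev, Equiv.Perm.mul_apply] at *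
    linarith
  | hinv g ih =>
    intro a b
    have h1 := ih (sg n g a) (sg n g b)
    simp only [cv_inv, map_inv, inv_inv, perm_inv_apply_self] at *
    linarith

theorem cv_zero_right (g : ArtinB n) (a : ℕ) : cv g a 0 = cv g 0 a := by
  have := cv_sub_cv g a 0
  rcases Nat.eq_zero_or_pos a with rfl | h
  · rfl
  · simp at this; linarith

theorem cv_comm {g : ArtinB n} (hg : sg n g = 1) (a b : ℕ) : cv g a b = cv g b a := by
  have := cv_sub_cv g a b
  rw [hg] at this
  simpa [sub_eq_zero] using this

theorem cv_mul_of_pure {g : ArtinB n} (hg : sg n g = 1) (h : ArtinB n) (a b : ℕ) :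
    cv (g * h) a b = cv g a b + cv h a b := by
  rw [cv_mul, hg]; rfl

theorem sg_conj {g : ArtinB n} (hg : sg n g = 1) (h : ArtinB n) : sg n (h * g * h⁻¹) = 1 := by
  simp [hg]

theorem cv_conj {g : ArtinB n} (hg : sg n g = 1) (h : ArtinB n) (a b : ℕ) :
    cv (h * g * h⁻¹) a b = cv g ((sg n h)⁻¹ a) ((sg n h)⁻¹ b) := by
  simp only [cv_mul, cv_inv, map_mul, hg, mul_one, perm_apply_inv_self]
  ring

theorem cv_of_commute {g h : ArtinB n} (hg : sg n g = 1) (hc : Commute h g) (a b : ℕ) :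
    cv g (sg n h a) (sg n h b) = cv g a b := by
  have := cv_conj hg h (sg n h a) (sg n h b)
  rwa [hc.eq, mul_inv_cancel_right, perm_inv_apply_self, perm_inv_apply_self] at this

theorem delta_eq_sum (g : ArtinB n) : delta g = ∑ j ∈ Finset.Icc 1 n, cv g 0 j := by
  induction g using gen_induction with
  | hgen i hi =>
    rcases Nat.eq_zero_or_pos i with rfl | h0
    · rw [delta_gen_zero hi, Finset.sum_eq_single_of_mem 1 (by simp; omega)]
      · rw [cv_gen_zero hi]; simp
      · intro b _ hb
        rw [cv_gen_zero hi, if_neg (by omega)]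
    · rw [delta_gen h0, Finset.sum_eq_zero]
      intro b _
      rw [cv_gen h0 hi, if_neg (by omega)]
  | hone => simp
  | hmul g h ihg ihh =>
    simp only [cv_mul, delta_mul, ihg, ihh, Finset.sum_add_distrib, sg_inv_zero]
    congr 1
    refine (Finset.sum_bijective _ (sg n g)⁻¹.bijective ?_ (fun _ _ => rfl)).symm
    intro j
    simp only [Finset.mem_Icc]
    refine ⟨sg_inv_mem g, fun h => ?_⟩
    simpa using sg_mem g h
  | hinv g ih =>
    simp only [cv_inv, delta_inv, ih, Finset.sum_neg_distrib, sg_zero]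
    congr 1
    refine (Finset.sum_bijective _ (sg n g).bijective ?_ (fun _ _ => rfl)).symm
    intro j
    simp only [Finset.mem_Icc]
    refine ⟨sg_mem g, fun h => ?_⟩
    simpa using sg_inv_mem g h

theorem beta_eq_sum (g : ArtinB n) :
    beta g = ∑ i ∈ Finset.Icc 1 n, ∑ j ∈ Finset.Icc 1 n, cv g i j := by
  induction g using gen_induction with
  | hgen i hi =>
    rcases Nat.eq_zero_or_pos i with rfl | h0
    · rw [beta_gen_zero, Finset.sum_eq_zero]
      intro a ha
      refine Finset.sum_eq_zero fun b hb => ?_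
      simp only [Finset.mem_Icc] at ha hb
      rw [cv_gen_zero hi, if_neg (by omega)]
    · rw [beta_gen h0 hi, Finset.sum_eq_single_of_mem i (by simp; omega),
        Finset.sum_eq_single_of_mem (i + 1) (by simp; omega)]
      · rw [cv_gen h0 hi]; simp
      · intro b _ hb
        rw [cv_gen h0 hi, if_neg (by omega)]
      · intro b _ hb
        refine Finset.sum_eq_zero fun b hb => ?_
        rw [cv_gen h0 hi, if_neg (by omega)]
  | hone => simp
  | hmul g h ihg ihh =>
    simp only [cv_mul, beta_mul, ihg, ihh, Finset.sum_add_distrib]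
    congr 1
    refine (Finset.sum_bijective _ (sg n g)⁻¹.bijective ?_ fun _ _ =>
      Finset.sum_bijective _ (sg n g)⁻¹.bijective ?_ (fun _ _ => rfl)).symm <;>
    · intro j
      simp only [Finset.mem_Icc]
      refine ⟨sg_inv_mem g, fun h => ?_⟩
      simpa using sg_mem g h
  | hinv g ih =>
    simp only [cv_inv, beta_inv, ih, Finset.sum_neg_distrib]
    congr 1
    refine (Finset.sum_bijective _ (sg n g).bijective ?_ fun _ _ =>
      Finset.sum_bijective _ (sg n g).bijective ?_ (fun _ _ => rfl)).symm <;>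
    · intro j
      simp only [Finset.mem_Icc]
      refine ⟨sg_mem g, fun h => ?_⟩
      simpa using sg_inv_mem g h

/-! ### Central elements -/

theorem sg_of_central {g : ArtinB n} (hg : ∀ h, Commute g h) : sg n g = 1 := by
  ext j
  rw [Equiv.Perm.one_apply]
  by_cases hj : 1 ≤ j ∧ j ≤ n
  · obtain ⟨h, hh⟩ := swap_mem_range' (a := 1) (b := j) ⟨le_rfl, by omega⟩ hj
    have h1 := cv_of_commute (sg_conj (sg_gen_zero (n := n)) h) (hg _) 0 j
    simp only [cv_conj sg_gen_zero, hh, sg_zero, Equiv.swap_inv, cv_gen_zero (show 0 < n by omega),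
      Equiv.swap_apply_of_ne_of_ne (show 0 ≠ 1 by omega) (show 0 ≠ j by omega),
      Equiv.swap_apply_right] at h1
    simp only [true_and, zero_ne_one, false_and, or_false, if_true] at h1
    have h2 : Equiv.swap 1 j (sg n g j) = 1 := by
      by_contra h; rw [if_neg h] at h1; omega
    rw [Equiv.swap_apply_eq_iff, Equiv.swap_apply_left] at h2
    exact h2
  · rcases Nat.eq_zero_or_pos j with rfl | h0
    · exact sg_zero g
    · exact sg_of_lt g (by omega)

theorem cv_of_central {g : ArtinB n} (hg : ∀ h, Commute g h) :
    ∀ {a b : ℕ}, a ≠ b → a ≤ n → b ≤ n → cv g a b = cv g 0 1 := by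
  have h1 := sg_of_central hg
  have hinv : ∀ x y a b, (1 ≤ x ∧ x ≤ n) → (1 ≤ y ∧ y ≤ n) →
      cv g (Equiv.swap x y a) (Equiv.swap x y b) = cv g a b := by
    intro x y a b hx hy
    obtain ⟨h, hh⟩ := swap_mem_range' hx hy
    rw [← hh]
    exact cv_of_commute h1 (hg h).symm a b
  have hzero : ∀ b, 1 ≤ b → b ≤ n → cv g 0 b = cv g 0 1 := by
    intro b hb hbn
    have := hinv 1 b 0 b ⟨le_rfl, by omega⟩ ⟨hb, hbn⟩
    rw [Equiv.swap_apply_of_ne_of_ne (by omega) (by omega), Equiv.swap_apply_right] at this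
    exact this.symm
  have htwo : 2 ≤ n → cv g 1 2 = cv g 0 1 := by
    intro hn
    have hd := det_of_commute h1 sg_gen_zero (hg (gen n 0)) 0 1 2
    simp only [cv_gen_zero (show 0 < n by omega)] at hd
    simp at hd
    rw [hd, hzero 2 (by omega) hn]
  have hone : ∀ b, 2 ≤ b → b ≤ n → cv g 1 b = cv g 0 1 := by
    intro b hb hbn
    have := hinv 2 b 1 b ⟨by omega, by omega⟩ ⟨by omega, hbn⟩
    rw [Equiv.swap_apply_of_ne_of_ne (by omega) (by omega), Equiv.swap_apply_right,
      htwo (by omega)] at this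
    exact this.symm
  intro a b hab ha hb
  rcases Nat.eq_zero_or_pos a with rfl | ha0
  · exact hzero b (by omega) hb
  rcases Nat.eq_zero_or_pos b with rfl | hb0
  · rw [cv_zero_right]; exact hzero a (by omega) ha
  have := hinv 1 a a b ⟨le_rfl, by omega⟩ ⟨ha0, ha⟩
  rw [Equiv.swap_apply_right] at this
  rw [← this]
  refine hone _ ?_ ?_
  · rw [Equiv.swap_apply_def]; split_ifs <;> omega
  · rw [Equiv.swap_apply_def]; split_ifs <;> omega

theorem delta_of_central {g : ArtinB n} (hg : ∀ h, Commute g h) : delta g = n * cv g 0 1 := by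
  rw [delta_eq_sum, Finset.sum_congr rfl (g := fun _ => cv g 0 1)]
  · simp
  · intro j hj
    simp only [Finset.mem_Icc] at hj
    exact cv_of_central hg (by omega) (by omega) hj.2

theorem beta_of_central {g : ArtinB n} (hg : ∀ h, Commute g h) :
    beta g = n * (n - 1) * cv g 0 1 := by
  have : ∀ i ∈ Finset.Icc 1 n, ∑ j ∈ Finset.Icc 1 n, cv g i j = (n - 1) * cv g 0 1 := by
    intro i hi
    rw [← Finset.add_sum_erase _ _ hi, cv_self, zero_add,
      Finset.sum_congr rfl (g := fun _ => cv g 0 1)]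
    · simp only [Finset.mem_Icc] at hi
      rw [Finset.sum_const, Finset.card_erase_of_mem (by simp [hi]), Nat.card_Icc]
      have : ((n + 1 - 1 - 1 : ℕ) : ℤ) = n - 1 := by omega
      simp [← this]
    · intro j hj
      simp only [Finset.mem_erase, Finset.mem_Icc] at hi hj
      exact cv_of_central hg (by omega) hi.2 hj.2.2
  rw [beta_eq_sum, Finset.sum_congr rfl this]
  simp [mul_assoc]

end ArtinB

namespace ArtinB

/-- An element of a free group commuting with two distinct generators is trivial. -/
theorem freeGroup_eq_one_of_commute {α : Type*} [DecidableEq α] {a b : α} (hab : a ≠ b)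
    {w : FreeGroup α} (ha : Commute (.of a) w) (hb : Commute (.of b) w) : w = 1 := by
  have key : ∀ c : α, Commute (.of c) w → ∀ x L, w.toWord = x :: L → x.1 = c := by
    intro c hc x L hw
    by_contra hne
    have hred : FreeGroup.IsReduced w.toWord := FreeGroup.isReduced_toWord
    obtain ⟨ε, hε⟩ : ∃ ε : Bool, FreeGroup.IsReduced (w.toWord ++ [(c, ε)]) := by
      obtain ⟨y, hy⟩ : ∃ y, w.toWord.getLast? = some y :=
        Option.isSome_iff_exists.mp (by simp [hw])
      refine ⟨if y.1 = c then y.2 else true, ?_⟩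
      refine List.isChain_append.mpr ⟨hred, List.isChain_singleton _, ?_⟩
      intro z hz z' hz' hzz
      rw [hy] at hz
      simp only [Option.mem_def, Option.some.injEq, List.head?_cons] at hz hz'
      subst hz hz'
      simp only at hzz ⊢
      rw [if_pos hzz]
    have hl : FreeGroup.IsReduced ((c, ε) :: w.toWord) := by
      rw [hw] at hred ⊢
      exact List.isChain_cons_cons.mpr ⟨fun h => absurd h.symm hne, hred⟩
    have hm : Commute (FreeGroup.mk [(c, ε)]) w := by
      cases ε
      · exact hc.inv_left
      · exact hc
    have h1 := congrArg FreeGroup.toWord hm.eq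
    rw [FreeGroup.toWord_mul, FreeGroup.toWord_mul, FreeGroup.toWord_mk,
      FreeGroup.reduce_singleton, List.singleton_append, hl.reduce_eq, hε.reduce_eq, hw] at h1
    simp only [List.cons_append, List.cons.injEq] at h1
    exact hne (congrArg Prod.fst h1.1).symm
  rw [← FreeGroup.toWord_eq_nil_iff]
  by_contra h
  obtain ⟨x, L, hx⟩ := List.exists_cons_of_ne_nil h
  exact hab ((key a ha x L hx).symm.trans (key b hb x L hx))

/-! ### The twist is central -/

variable {n : ℕ}

/-- The product of the first `k` generators. -/
def pr (n : ℕ) : ℕ → ArtinB n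
  | 0 => 1
  | k + 1 => pr n k * gen n k

theorem pr_succ (k : ℕ) : pr n (k + 1) = pr n k * gen n k := rfl

theorem artinBTwist_eq : artinBTwist n = pr n n ^ n := by
  rw [artinBTwist]
  congr 1
  have : ∀ k, (List.ofFn fun i : Fin k => gen n i).prod = pr n k := by
    intro k
    induction k with
    | zero => simp [pr]
    | succ k ih => rw [List.ofFn_succ', List.prod_concat, pr_succ, ← ih]; rfl
  rw [← this n]
  congr 2
  ext i
  exact (gen_of_lt i.2).symm

theorem gen_comm' {i j : ℕ} (h : i + 2 ≤ j ∨ j + 2 ≤ i) : Commute (gen n i) (gen n j) :=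
  h.elim gen_comm fun h => (gen_comm h).symm

theorem gen_commute_pr {j k : ℕ} (h : k + 1 ≤ j) : Commute (gen n j) (pr n k) := by
  induction k with
  | zero => exact Commute.one_right _
  | succ k ih => exact (ih (by omega)).mul_right (gen_comm (by omega)).symm

theorem pr_mul_gen {i k : ℕ} (hi : 1 ≤ i) (hin : i + 1 < n) (hk : i + 2 ≤ k) :
    pr n k * gen n i = gen n (i + 1) * pr n k := by
  induction k, hk using Nat.le_induction with
  | base =>
    have h1 := gen_braid hi hin
    have h2 := (gen_commute_pr (n := n) (le_refl (i + 1))).eq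
    calc pr n (i + 2) * gen n i = pr n i * (gen n i * gen n (i + 1) * gen n i) := by
          simp only [pr_succ, mul_assoc]
      _ = pr n i * gen n (i + 1) * (gen n i * gen n (i + 1)) := by rw [h1]; simp only [mul_assoc]
      _ = gen n (i + 1) * pr n (i + 2) := by rw [← h2]; simp only [pr_succ, mul_assoc]
  | succ k hk ih =>
    rw [pr_succ, mul_assoc, ← (gen_comm (n := n) hk).eq, ← mul_assoc, ih, mul_assoc]

theorem pr_sq_mul_gen {k : ℕ} (hk : 1 ≤ k) (hkn : k < n) :
    pr n (k + 1) * pr n (k + 1) * gen n k = gen n 1 * (pr n (k + 1) * pr n (k + 1)) := by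
  induction k, hk using Nat.le_induction with
  | base =>
    have h := gen_four n
    simp only [pr, one_mul, pow_two, mul_assoc] at h ⊢
    calc _ = gen n 0 * (gen n 1 * (gen n 0 * gen n 1)) * gen n 1 := by simp only [mul_assoc]
      _ = gen n 1 * (gen n 0 * (gen n 1 * gen n 0)) * gen n 1 := by rw [h]
      _ = _ := by simp only [mul_assoc]
  | succ k hk ih =>
    have hb := gen_braid hk hkn
    have hc := (gen_commute_pr (n := n) (le_refl (k + 1))).eq
    have ih := ih (by omega)
    generalize gen n 1 = u at *
    rw [pr_succ (k + 1)]
    rw [pr_succ k] at ih ⊢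
    generalize pr n k = r at *
    generalize gen n k = t at *
    generalize gen n (k + 1) = s at *
    calc r * t * s * (r * t * s) * s = r * t * (s * r) * t * s * s := by simp only [mul_assoc]
      _ = r * t * r * (s * t * s) * s := by rw [hc]; simp only [mul_assoc]
      _ = r * t * r * (t * s * t) * s := by rw [← hb]
      _ = r * t * (r * t) * (s * t * s) := by simp only [mul_assoc]
      _ = (r * t * (r * t) * t) * (s * t) := by rw [← hb]; simp only [mul_assoc]
      _ = u * (r * t * r * (t * s * t)) := by rw [ih]; simp only [mul_assoc]
      _ = u * (r * t * (r * s) * (t * s)) := by rw [hb]; simp only [mul_assoc]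
      _ = u * (r * t * s * (r * t * s)) := by rw [← hc]; simp only [mul_assoc]

theorem pr_pow_mul_gen {j : ℕ} (hj : j + 1 < n) :
    pr n n ^ j * gen n 1 = gen n (1 + j) * pr n n ^ j := by
  induction j with
  | zero => simp
  | succ j ih =>
    rw [pow_succ', mul_assoc, ih (by omega), ← mul_assoc, pr_mul_gen (by omega) (by omega) (by omega),
      mul_assoc]
    rfl

theorem commute_artinBTwist (g : ArtinB n) : Commute (artinBTwist n) g := by
  rw [artinBTwist_eq]
  have hρ : Commute (pr n n ^ n) (pr n n) := (Commute.refl _).pow_left n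
  have h1 : 2 ≤ n → Commute (pr n n ^ n) (gen n 1) := by
    intro h
    obtain ⟨m, rfl⟩ : ∃ m, n = m + 2 := ⟨n - 2, by omega⟩
    have h2 := pr_sq_mul_gen (n := m + 2) (k := m + 1) (by omega) (by omega)
    have h3 := pr_pow_mul_gen (n := m + 2) (j := m) (by omega)
    rw [add_comm 1 m] at h3
    rw [← pow_two] at h2
    show _ = _
    rw [add_comm m 2] at h2 ⊢
    rw [add_comm m 2] at h3
    rw [pow_add, mul_assoc, h3, ← mul_assoc]
    rw [show 2 + m = m + 1 + 1 by ring] at h2 ⊢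
    rw [h2, mul_assoc]
  have hpos : ∀ i, 1 ≤ i → i < n → Commute (pr n n ^ n) (gen n i) := by
    intro i hi hin
    obtain ⟨j, rfl⟩ : ∃ j, i = 1 + j := ⟨i - 1, by omega⟩
    have := pr_pow_mul_gen (n := n) (j := j) (by omega)
    rw [← mul_inv_eq_iff_eq_mul.mpr this]
    exact ((hρ.pow_right j).mul_right (h1 (by omega))).mul_right (hρ.pow_right j).inv_right
  have hpr : ∀ k, k + 1 ≤ n → Commute (pr n n ^ n) (pr n (n - k)) := by
    intro k hk
    induction k with
    | zero => exact hρ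
    | succ k ih =>
      have h2 := ih (by omega)
      rw [show n - k = n - (k + 1) + 1 by omega, pr_succ] at h2
      have h3 := h2.mul_right (hpos (n - (k + 1)) (by omega) (by omega)).inv_right
      rwa [mul_inv_cancel_right] at h3
  refine mem_of_gen_mem (Subgroup.centralizer {pr n n ^ n}) (fun i hi => ?_) g |>
    fun h => (Subgroup.mem_centralizer_singleton_iff.mp h).symm
  rw [Subgroup.mem_centralizer_singleton_iff]
  rcases Nat.eq_zero_or_pos i with rfl | h0
  · have := hpr (n - 1) (by omega)
    rw [show n - (n - 1) = 0 + 1 by omega, pr_succ, pr, one_mul] at this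
    exact this.symm
  · exact (hpos i h0 hi).symm

theorem delta_artinBTwist : delta (artinBTwist n) = n := by
  rw [artinBTwist_eq, delta_pow]
  rcases Nat.eq_zero_or_pos n with rfl | h
  · simp
  have : ∀ k, 1 ≤ k → delta (pr n k) = 1 := by
    intro k hk
    induction k, hk using Nat.le_induction with
    | base => rw [pr_succ, pr, one_mul, delta_gen_zero h]
    | succ k hk ih => rw [pr_succ, delta_mul, ih, delta_gen hk, add_zero]
  rw [this n h, mul_one]

theorem beta_artinBTwist : beta (artinBTwist n) = n * (n - 1) := by
  rw [artinBTwist_eq, beta_pow]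
  rcases Nat.eq_zero_or_pos n with rfl | h
  · simp
  have : ∀ k, 1 ≤ k → k ≤ n → beta (pr n k) = k - 1 := by
    intro k hk
    induction k, hk using Nat.le_induction with
    | base => simp [pr, beta_gen_zero]
    | succ k hk ih =>
      intro hkn
      rw [pr_succ, beta_mul, ih (by omega), beta_gen hk (by omega)]
      push_cast; ring
  rw [this n h le_rfl]

end ArtinB

namespace ArtinB

variable {n : ℕ}

/-! ### The free generators `x_i` -/

/-- The conjugates `s_i ⋯ s_1 s_0 s_1⁻¹ ⋯ s_i⁻¹` of the special generator. -/
def xg (n : ℕ) : ℕ → ArtinB n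
  | 0 => gen n 0
  | i + 1 => gen n (i + 1) * xg n i * (gen n (i + 1))⁻¹

theorem xg_succ (i : ℕ) : xg n (i + 1) = gen n (i + 1) * xg n i * (gen n (i + 1))⁻¹ := rfl

theorem gen_mul_xg (i : ℕ) : gen n (i + 1) * xg n i = xg n (i + 1) * gen n (i + 1) := by
  rw [xg_succ]; simp

theorem gen_commute_xg {i j : ℕ} (hi : i < n) (hj : 1 ≤ j) (h1 : j ≠ i) (h2 : j ≠ i + 1) :
    Commute (gen n j) (xg n i) := by
  induction i generalizing j with
  | zero => exact (gen_comm (by omega)).symm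
  | succ i ih =>
    by_cases hji : j = i
    · subst hji
      obtain ⟨i, rfl⟩ : ∃ i, j = i + 1 := ⟨j - 1, by omega⟩
      have hb := gen_braid (n := n) (i := i + 1) (by omega) hi
      rw [xg_succ, xg_succ]
      have h0 : Commute (gen n (i + 1 + 1)) (xg n i) := by
        have : ∀ k, k ≤ i → Commute (gen n (i + 1 + 1)) (xg n k) := by
          intro k hk
          induction k with
          | zero => exact (gen_comm (by omega)).symm
          | succ k ihk =>
            have h3 : Commute (gen n (i + 1 + 1)) (gen n (k + 1)) := (gen_comm (by omega)).symm
            exact (h3.mul_right (ihk (by omega))).mul_right h3.inv_right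
        exact this i le_rfl
      generalize gen n (i + 1 + 1) = s at *
      generalize gen n (i + 1) = t at *
      generalize xg n i = x at *
      have e : t = MulAut.conj (s * t) s := by
        rw [MulAut.conj_apply, eq_mul_inv_iff_mul_eq, ← mul_assoc, hb]
      have e' : s * (t * x * t⁻¹) * s⁻¹ = MulAut.conj (s * t) x := by
        rw [MulAut.conj_apply]; group
      rw [e']
      nth_rw 1 [e]
      exact h0.map (MulAut.conj (s * t))
    · have h3 : Commute (gen n j) (gen n (i + 1)) := gen_comm' (by omega)
      exact (h3.mul_right (ih (by omega) hj hji (by omega))).mul_right h3.inv_right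

theorem xg_four {i : ℕ} (hi : i + 1 < n) :
    (xg n i * gen n (i + 1)) ^ 2 = (gen n (i + 1) * xg n i) ^ 2 := by
  induction i with
  | zero => exact gen_four n
  | succ i ih =>
    have ih := ih (by omega)
    have hb := gen_braid (n := n) (i := i + 1) (by omega) hi
    have h0 := gen_commute_xg (n := n) (i := i) (j := i + 1 + 1) (by omega) (by omega) (by omega)
      (by omega)
    set c := gen n (i + 1) * gen n (i + 1 + 1) with hc
    have e1 : xg n (i + 1) = MulAut.conj c (xg n i) := by
      rw [MulAut.conj_apply, hc, mul_assoc (gen n (i + 1)), h0.eq, xg_succ]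
      group
    have e2 : gen n (i + 1 + 1) = MulAut.conj c (gen n (i + 1)) := by
      rw [MulAut.conj_apply, hc, eq_mul_inv_iff_mul_eq, hb, ← mul_assoc]
    rw [e1, e2, ← map_mul, ← map_mul, ← map_pow, ← map_pow, ih]

theorem gen_commute_xg_mul_xg {i : ℕ} (hi : i + 1 < n) :
    gen n (i + 1) * (xg n i * xg n (i + 1)) = xg n i * xg n (i + 1) * gen n (i + 1) := by
  have h := xg_four hi
  simp only [pow_two] at h
  rw [← mul_left_inj (gen n (i + 1)), mul_assoc, mul_assoc (xg n i), ← gen_mul_xg]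
  calc _ = gen n (i + 1) * xg n i * (gen n (i + 1) * xg n i) := by group
    _ = _ := by rw [← h]; group

end ArtinB

namespace ArtinB

variable {m : ℕ}

/-! ### The action of `ArtinB (m + 1)` on `m + 1` copies of `ArtinB m` -/

/-- The cocycle of the action. -/
def coc (m k j : ℕ) : ArtinB m :=
  if m < j ∨ j = k then 1 else if j = k + 1 then xg m k else if j < k then gen m k else gen m (k + 1)

/-- The permutation by which the generator `k + 1` acts. -/
def shear (m k : ℕ) : Equiv.Perm (ℕ × ArtinB m) :=
  Equiv.prodShear (Equiv.swap k (k + 1)) fun j => Equiv.mulLeft (coc m k j)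

theorem shear_apply (k j : ℕ) (h : ArtinB m) :
    shear m k (j, h) = (Equiv.swap k (k + 1) j, coc m k j * h) := rfl

theorem shear_self (k : ℕ) (h : ArtinB m) : shear m k (k, h) = (k + 1, h) := by
  simp [shear_apply, coc]

theorem shear_succ {k : ℕ} (hk : k + 1 ≤ m) (h : ArtinB m) :
    shear m k (k + 1, h) = (k, xg m k * h) := by
  have : ¬ (m < k + 1) := by omega
  simp [shear_apply, coc, this]

theorem shear_lt {k j : ℕ} (hj : j < k) (hk : k ≤ m) (h : ArtinB m) :
    shear m k (j, h) = (j, gen m k * h) := by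
  rw [shear_apply, Equiv.swap_apply_of_ne_of_ne (by omega) (by omega), coc, if_neg (by omega),
    if_neg (by omega), if_pos hj]

theorem shear_gt {k j : ℕ} (hk : k + 1 < j) (hj : j ≤ m) (h : ArtinB m) :
    shear m k (j, h) = (j, gen m (k + 1) * h) := by
  rw [shear_apply, Equiv.swap_apply_of_ne_of_ne (by omega) (by omega), coc, if_neg (by omega),
    if_neg (by omega), if_neg (by omega)]

theorem shear_of_lt {k j : ℕ} (hk : k < m) (hj : m < j) (h : ArtinB m) :
    shear m k (j, h) = (j, h) := by
  rw [shear_apply, Equiv.swap_apply_of_ne_of_ne (by omega) (by omega), coc, if_pos (by omega),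
    one_mul]

/-- The generators act by these permutations. -/
def shearGen (m : ℕ) : ℕ → Equiv.Perm (ℕ × ArtinB m)
  | 0 => 1
  | k + 1 => shear m k

theorem shear_braid {k : ℕ} (hk : k + 1 < m) :
    shear m k * shear m (k + 1) * shear m k = shear m (k + 1) * shear m k * shear m (k + 1) := by
  ext1 ⟨j, h⟩
  simp only [Equiv.Perm.mul_apply]
  rcases lt_or_ge m j with h0 | h0
  · simp (disch := omega) only [shear_of_lt]
  rcases lt_trichotomy j k with h1 | rfl | h1
  · simp (disch := omega) only [shear_lt]
    simp only [← mul_assoc, gen_braid (by omega : 1 ≤ k) hk]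
  · simp (disch := omega) only [shear_self, shear_lt, shear_gt]
  rcases eq_or_lt_of_le (Nat.succ_le_of_lt h1) with rfl | h1
  · simp (disch := omega) only [Nat.succ_eq_add_one, shear_self, shear_succ, shear_lt, shear_gt]
    rw [← mul_assoc, ← mul_assoc, gen_mul_xg]
  rcases eq_or_lt_of_le (Nat.succ_le_of_lt h1) with rfl | h1
  · simp (disch := omega) only [Nat.succ_eq_add_one, shear_succ, shear_lt, shear_gt]
    have := gen_commute_xg_mul_xg hk
    simp only [← mul_assoc] at this ⊢
    rw [this]
  · simp (disch := omega) only [shear_gt]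
    simp only [← mul_assoc, gen_braid (by omega : 1 ≤ k + 1) (by omega : k + 1 + 1 < m)]

theorem shear_comm {k l : ℕ} (hk : k + 2 ≤ l) (hl : l < m) :
    Commute (shear m k) (shear m l) := by
  show _ = _
  ext1 ⟨j, h⟩
  simp only [Equiv.Perm.mul_apply]
  rcases lt_or_ge m j with h0 | h0
  · simp (disch := omega) only [shear_of_lt]
  rcases lt_trichotomy j k with h1 | rfl | h1
  · simp (disch := omega) only [shear_lt]
    simp only [← mul_assoc, (gen_comm hk).eq]
  · simp (disch := omega) only [shear_self, shear_lt]
  rcases eq_or_lt_of_le (Nat.succ_le_of_lt h1) with rfl | h1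
  · simp (disch := omega) only [Nat.succ_eq_add_one, shear_succ, shear_lt]
    simp only [← mul_assoc]
    rw [(gen_commute_xg (by omega) (by omega) (by omega) (by omega)).eq]
  rcases lt_trichotomy j l with h2 | rfl | h2
  · simp (disch := omega) only [shear_lt, shear_gt]
    simp only [← mul_assoc, (gen_comm (by omega : k + 1 + 2 ≤ l)).eq]
  · simp (disch := omega) only [shear_self, shear_gt]
  rcases eq_or_lt_of_le (Nat.succ_le_of_lt h2) with rfl | h2
  · simp (disch := omega) only [Nat.succ_eq_add_one, shear_succ, shear_gt]
    simp only [← mul_assoc]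
    rw [(gen_commute_xg (by omega) (by omega) (by omega) (by omega)).eq]
  · simp (disch := omega) only [shear_gt]
    simp only [← mul_assoc, (gen_comm (by omega : k + 1 + 2 ≤ l + 1)).eq]

/-- The action of `ArtinB (m + 1)` on `ℕ × ArtinB m`. -/
def shearHom (m : ℕ) : ArtinB (m + 1) →* Equiv.Perm (ℕ × ArtinB m) :=
  lift (m + 1) (shearGen m) (fun _ => by simp [shearGen])
    (fun i hi h => by
      obtain ⟨k, rfl⟩ : ∃ k, i = k + 1 := ⟨i - 1, by omega⟩
      exact shear_braid (by omega))
    (fun i j hij hj => by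
      obtain ⟨l, rfl⟩ : ∃ l, j = l + 1 := ⟨j - 1, by omega⟩
      cases i with
      | zero => exact Commute.one_left _
      | succ k => exact shear_comm (by omega) (by omega))

theorem shearHom_gen_zero : shearHom m (gen (m + 1) 0) = 1 := lift_gen (Nat.succ_pos m)

theorem shearHom_gen {k : ℕ} (hk : k < m) : shearHom m (gen (m + 1) (k + 1)) = shear m k :=
  lift_gen (Nat.succ_lt_succ hk)

theorem shearHom_right (g : ArtinB (m + 1)) (h' : ArtinB m) : ∀ (j : ℕ) (h : ArtinB m),
    shearHom m g (j, h * h') = ((shearHom m g (j, h)).1, (shearHom m g (j, h)).2 * h') := by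
  induction g using gen_induction with
  | hgen i hi =>
    intro j h
    cases i with
    | zero => rw [shearHom_gen_zero]; rfl
    | succ k => rw [shearHom_gen (by omega)]; simp only [shear_apply, mul_assoc]
  | hone => intro j h; rw [map_one]; rfl
  | hmul g g' h1 h2 => intro j h; rw [map_mul, Equiv.Perm.mul_apply, h2, h1]; rfl
  | hinv g h1 =>
    intro j h
    rw [map_inv, Equiv.Perm.inv_eq_iff_eq, h1, Prod.mk.eta, perm_apply_inv_self]

theorem shearHom_fst (g : ArtinB (m + 1)) : ∀ y : ℕ × ArtinB m,
    (shearHom m g y).1 + 1 = sg (m + 1) g (y.1 + 1) := by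
  induction g using gen_induction with
  | hgen i hi =>
    rintro ⟨j, h⟩
    cases i with
    | zero => rw [shearHom_gen_zero, sg_gen_zero]; rfl
    | succ k =>
      rw [shearHom_gen (by omega), sg_gen (by omega) hi, shear_apply]
      simp only [Equiv.swap_apply_def]
      split_ifs <;> omega
  | hone => intro y; simp
  | hmul g g' h1 h2 => intro y; rw [map_mul, map_mul, Equiv.Perm.mul_apply, Equiv.Perm.mul_apply, h1, h2]
  | hinv g h1 =>
    intro y
    rw [map_inv, map_inv, Equiv.Perm.eq_inv_iff_eq, ← h1, perm_apply_inv_self]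

/-! ### The quotient by the special generator -/

/-- The quotient of `ArtinB n` killing the special generator: a braid group. -/
abbrev Br (n : ℕ) : Type := ArtinB n ⧸ Subgroup.normalClosure {gen n 0}

/-- The projection onto the braid group. -/
def toBr (n : ℕ) : ArtinB n →* Br n := QuotientGroup.mk' _

theorem toBr_gen_zero (n : ℕ) : toBr n (gen n 0) = 1 :=
  (QuotientGroup.eq_one_iff _).mpr (Subgroup.subset_normalClosure rfl)

theorem beta_eq_of_toBr_eq {n : ℕ} {g h : ArtinB n} (hgh : toBr n g = toBr n h) : beta g = beta h := by
  have h1 : g⁻¹ * h ∈ Subgroup.normalClosure {gen n 0} := QuotientGroup.eq.mp hgh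
  have h2 : Subgroup.normalClosure {gen n 0} ≤ (degHom n 0 1).ker :=
    Subgroup.normalClosure_le_normal (by
      rintro _ rfl
      exact congrArg Multiplicative.ofAdd (beta_gen_zero (n := n)))
  have h3 : beta (g⁻¹ * h) = 0 := congrArg Multiplicative.toAdd (h2 h1)
  rw [beta_mul, beta_inv] at h3
  omega

/-- The embedding of `ArtinB m` into the braid group as a stabiliser. -/
def embBr (m : ℕ) : ArtinB m →* Br (m + 1) :=
  lift m (fun i => toBr (m + 1) (if i = 0 then gen (m + 1) 1 ^ 2 else gen (m + 1) (i + 1)))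
    (fun h => by
      have := four_of_braid (gen_braid (n := m + 1) le_rfl (by omega))
      simp only [← map_mul, ← map_pow]
      exact congrArg _ this)
    (fun i hi h => by
      simp only [← map_mul]
      rw [if_neg (by omega), if_neg (by omega), gen_braid (by omega) (by omega)])
    (fun i j hij hj => by
      refine Commute.map ?_ _
      rw [if_neg (by omega : ¬ j = 0)]
      split_ifs with h
      · exact (gen_comm (by omega)).pow_left 2
      · exact gen_comm (by omega))

theorem embBr_gen_zero (hm : 0 < m) : embBr m (gen m 0) = toBr (m + 1) (gen (m + 1) 1) ^ 2 := by
  rw [embBr, lift_gen hm, if_pos rfl, map_pow]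

theorem embBr_gen {i : ℕ} (hi : 1 ≤ i) (him : i < m) :
    embBr m (gen m i) = toBr (m + 1) (gen (m + 1) (i + 1)) := by
  rw [embBr, lift_gen him, if_neg (by omega)]

/-- Coset representatives for `embBr`. -/
def rep (m : ℕ) : ℕ → Br (m + 1)
  | 0 => 1
  | j + 1 => toBr (m + 1) (gen (m + 1) (j + 1)) * rep m j

theorem toBr_commute_rep {i j : ℕ} (h : j + 2 ≤ i) :
    Commute (toBr (m + 1) (gen (m + 1) i)) (rep m j) := by
  induction j with
  | zero => exact Commute.one_right _
  | succ j ih => exact ((gen_comm (by omega)).symm.map (toBr (m + 1))).mul_right (ih (by omega))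

theorem toBr_braid {n i : ℕ} (hi : 1 ≤ i) (h : i + 1 < n) :
    toBr n (gen n i) * toBr n (gen n (i + 1)) * toBr n (gen n i) =
      toBr n (gen n (i + 1)) * toBr n (gen n i) * toBr n (gen n (i + 1)) := by
  simp only [← map_mul, gen_braid hi h]

theorem toBr_mul_rep {k j : ℕ} (hk : k + 2 ≤ j) (hj : j ≤ m) :
    toBr (m + 1) (gen (m + 1) (k + 1)) * rep m j =
      rep m j * toBr (m + 1) (gen (m + 1) (k + 1 + 1)) := by
  induction j, hk using Nat.le_induction with
  | base =>
    have h1 := toBr_braid (n := m + 1) (i := k + 1) (by omega) (by omega)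
    have h2 := toBr_commute_rep (m := m) (i := k + 2) (j := k) le_rfl
    simp only [rep]
    rw [← mul_assoc, ← mul_assoc, h1, mul_assoc, h2.eq]
    simp only [mul_assoc]
  | succ j hj' ih =>
    have h1 : Commute (toBr (m + 1) (gen (m + 1) (k + 1))) (toBr (m + 1) (gen (m + 1) (j + 1))) :=
      (gen_comm (by omega)).map _
    rw [rep, ← mul_assoc, h1.eq, mul_assoc, ih (by omega), mul_assoc]

theorem rep_mul_embBr_xg {k : ℕ} (hk : k < m) :
    rep m k * embBr m (xg m k) = toBr (m + 1) (gen (m + 1) (k + 1)) ^ 2 * rep m k := by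
  induction k with
  | zero => rw [xg, embBr_gen_zero hk, rep]; simp
  | succ k ih =>
    have ih := ih (by omega)
    have h1 := toBr_braid (n := m + 1) (i := k + 1) (by omega) (by omega)
    have h2 := toBr_commute_rep (m := m) (i := k + 2) (j := k) le_rfl
    rw [xg_succ, map_mul, map_mul, map_inv, embBr_gen (by omega) hk, rep, ← mul_assoc,
      mul_inv_eq_iff_eq_mul]
    rw [show k + 1 + 1 = k + 2 from rfl] at *
    generalize toBr (m + 1) (gen (m + 1) (k + 1)) = a at *
    generalize toBr (m + 1) (gen (m + 1) (k + 2)) = b at *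
    generalize rep m k = r at *
    generalize embBr m (xg m k) = x at *
    calc a * r * (b * x) = a * (r * b) * x := by simp only [mul_assoc]
      _ = a * b * (r * x) := by rw [← h2.eq]; simp only [mul_assoc]
      _ = a * b * a * a * r := by rw [ih]; simp only [pow_two, mul_assoc]
      _ = b * (a * b * a) * r := by nth_rw 1 [h1]; simp only [mul_assoc]
      _ = b * b * a * (b * r) := by rw [h1]; simp only [mul_assoc]
      _ = b ^ 2 * (a * r) * b := by rw [h2.eq]; simp only [pow_two, mul_assoc]

theorem toBr_mul_rep_mul_embBr (g : ArtinB (m + 1)) : ∀ (j : ℕ) (h : ArtinB m), j ≤ m →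
    toBr (m + 1) g * (rep m j * embBr m h) =
      rep m (shearHom m g (j, h)).1 * embBr m (shearHom m g (j, h)).2 := by
  induction g using gen_induction with
  | hgen i hi =>
    intro j h hj
    cases i with
    | zero => rw [shearHom_gen_zero, toBr_gen_zero, one_mul]; rfl
    | succ k =>
      rw [shearHom_gen (by omega)]
      rcases lt_trichotomy j k with h1 | rfl | h1
      · rw [shear_lt h1 (by omega), map_mul, embBr_gen (by omega) (by omega), ← mul_assoc,
          ← mul_assoc, (toBr_commute_rep (by omega)).eq]
      · rw [shear_self, ← mul_assoc, rep]
      rcases eq_or_lt_of_le (Nat.succ_le_of_lt h1) with rfl | h1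
      · rw [Nat.succ_eq_add_one, shear_succ hj, map_mul, ← mul_assoc, ← mul_assoc,
          rep_mul_embBr_xg (by omega), rep, ← mul_assoc, pow_two]
      · rw [shear_gt h1 hj, map_mul, embBr_gen (by omega) (by omega), ← mul_assoc, ← mul_assoc,
          toBr_mul_rep (by omega) hj]
  | hone => intro j h _; simp
  | hmul g g' h1 h2 =>
    intro j h hj
    have h3 := shearHom_fst g' (j, h)
    have h4 := sg_mem g' (j := j + 1) (by omega)
    simp only at h3
    rw [map_mul, map_mul, mul_assoc, h2 j h hj, Equiv.Perm.mul_apply, h1 _ _ (by omega)]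
  | hinv g h1 =>
    intro j h hj
    have h3 := shearHom_fst g⁻¹ (j, h)
    have h4 := sg_mem g⁻¹ (j := j + 1) (by omega)
    simp only at h3
    rw [map_inv, inv_mul_eq_iff_eq_mul, h1 _ _ (by omega), Prod.mk.eta, map_inv, perm_apply_inv_self]

theorem exists_shearHom_zero (h' : ArtinB m) : ∃ g : ArtinB (m + 1),
    (∀ h, shearHom m g (0, h) = (0, h' * h)) ∧ toBr (m + 1) g = embBr m h' ∧
      beta g = 2 * delta h' + beta h' := by
  induction h' using gen_induction with
  | hgen i hi =>
    cases i with
    | zero =>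
      refine ⟨gen (m + 1) 1 ^ 2, fun h => ?_, ?_, ?_⟩
      · rw [map_pow, shearHom_gen hi, pow_two, Equiv.Perm.mul_apply, shear_self, shear_succ (by omega)]
        rfl
      · rw [embBr_gen_zero hi, map_pow]
      · rw [beta_pow, beta_gen le_rfl (by omega), delta_gen_zero hi, beta_gen_zero]; norm_num
    | succ i =>
      refine ⟨gen (m + 1) (i + 2), fun h => ?_, ?_, ?_⟩
      · rw [shearHom_gen hi, shear_lt (by omega) (by omega)]
      · rw [embBr_gen (by omega) hi]
      · rw [beta_gen (by omega) (by omega), delta_gen (by omega), beta_gen (by omega) hi]; norm_num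
  | hone => exact ⟨1, by simp⟩
  | hmul a b ha hb =>
    obtain ⟨g, h1, h2, h3⟩ := ha
    obtain ⟨g', h1', h2', h3'⟩ := hb
    refine ⟨g * g', fun h => ?_, ?_, ?_⟩
    · rw [map_mul, Equiv.Perm.mul_apply, h1', h1, mul_assoc]
    · rw [map_mul, map_mul, h2, h2']
    · rw [beta_mul, beta_mul, delta_mul, h3, h3']; ring
  | hinv a ha =>
    obtain ⟨g, h1, h2, h3⟩ := ha
    refine ⟨g⁻¹, fun h => ?_, ?_, ?_⟩
    · rw [map_inv, Equiv.Perm.inv_eq_iff_eq, h1, mul_inv_cancel_left]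
    · rw [map_inv, map_inv, h2]
    · rw [beta_inv, beta_inv, delta_inv, h3]; ring

/-- If central elements of `ArtinB m` are detected by `2 δ + β`, then a central element of
`ArtinB (m + 1)` with `β = 0` lies in the normal closure of the special generator. -/
theorem toBr_eq_one_of_central
    (ih : ∀ h : ArtinB m, (∀ h', Commute h h') → 2 * delta h + beta h = 0 → h = 1)
    {g : ArtinB (m + 1)} (hg : ∀ h, Commute g h) (hb : beta g = 0) : toBr (m + 1) g = 1 := by
  have h1 := shearHom_fst g (0, 1)
  rw [sg_of_central hg] at h1
  obtain ⟨h0, hh0⟩ : ∃ h0, shearHom m g (0, 1) = (0, h0) :=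
    ⟨(shearHom m g (0, 1)).2, Prod.ext (Nat.succ_injective h1) rfl⟩
  have hc : ∀ h', Commute h0 h' := by
    intro h'
    obtain ⟨g', h2, -⟩ := exists_shearHom_zero h'
    have h3 : shearHom m (g * g') (0, 1) = shearHom m (g' * g) (0, 1) := by rw [(hg g').eq]
    rw [map_mul, map_mul, Equiv.Perm.mul_apply, Equiv.Perm.mul_apply, h2, hh0, h2, mul_one] at h3
    have h4 := shearHom_right g h' 0 1
    rw [one_mul, h3, hh0] at h4
    exact (congrArg Prod.snd h4).symm
  have hp : toBr (m + 1) g = embBr m h0 := by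
    have := toBr_mul_rep_mul_embBr g 0 1 (by omega)
    rw [hh0] at this
    simpa [rep] using this
  obtain ⟨g', -, h3, h4⟩ := exists_shearHom_zero h0
  rw [hp, ih h0 hc (by rw [← h4, beta_eq_of_toBr_eq (h3.trans hp.symm), hb]), map_one]

end ArtinB

namespace ArtinB

variable {n : ℕ}

/-! ### The action on the free group -/

theorem gen_conj_xg_succ {i : ℕ} (hi : i + 1 < n) :
    gen n (i + 1) * xg n (i + 1) * (gen n (i + 1))⁻¹ = (xg n (i + 1))⁻¹ * xg n i * xg n (i + 1) := by
  have h := gen_commute_xg_mul_xg hi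
  rw [← mul_assoc, gen_mul_xg] at h
  rw [mul_inv_eq_iff_eq_mul, mul_assoc, mul_assoc, eq_inv_mul_iff_mul_eq, ← mul_assoc, ← mul_assoc, h]

/-- The elementary braid automorphism of a free group. -/
def artinEnd (j : ℕ) : FreeGroup ℕ →* FreeGroup ℕ :=
  FreeGroup.lift fun i => if i = j then .of (j + 1) else
    if i = j + 1 then (.of (j + 1))⁻¹ * .of j * .of (j + 1) else .of i

/-- The inverse of the elementary braid automorphism. -/
def artinEndInv (j : ℕ) : FreeGroup ℕ →* FreeGroup ℕ :=
  FreeGroup.lift fun i => if i = j + 1 then .of j else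
    if i = j then .of j * .of (j + 1) * (.of j)⁻¹ else .of i

/-- The elementary braid automorphism as an automorphism. -/
def artinAut (j : ℕ) : MulAut (FreeGroup ℕ) :=
  MonoidHom.toMulEquiv (artinEnd j) (artinEndInv j)
    (FreeGroup.ext_hom _ _ fun i => by
      rcases eq_or_ne i j with rfl | h1
      · simp [artinEnd, artinEndInv]
      rcases eq_or_ne i (j + 1) with rfl | h2
      · simp [artinEnd, artinEndInv, mul_assoc]
      · simp [artinEnd, artinEndInv, h1, h2])
    (FreeGroup.ext_hom _ _ fun i => by
      rcases eq_or_ne i j with rfl | h1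
      · simp [artinEnd, artinEndInv, mul_assoc]
      rcases eq_or_ne i (j + 1) with rfl | h2
      · simp [artinEnd, artinEndInv]
      · simp [artinEnd, artinEndInv, h1, h2])

theorem artinAut_of (j i : ℕ) : artinAut j (.of i) = if i = j then .of (j + 1) else
    if i = j + 1 then (.of (j + 1))⁻¹ * .of j * .of (j + 1) else .of i :=
  FreeGroup.lift_apply_of

theorem artinAut_self (j : ℕ) : artinAut j (.of j) = .of (j + 1) := by simp [artinAut_of]

theorem artinAut_succ (j : ℕ) :
    artinAut j (.of (j + 1)) = (.of (j + 1))⁻¹ * .of j * .of (j + 1) := by simp [artinAut_of]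

theorem artinAut_ne {j i : ℕ} (h1 : i ≠ j) (h2 : i ≠ j + 1) : artinAut j (.of i) = .of i := by
  simp [artinAut_of, h1, h2]

theorem mulAut_ext {φ ψ : MulAut (FreeGroup ℕ)} (h : ∀ i, φ (.of i) = ψ (.of i)) : φ = ψ :=
  MulEquiv.toMonoidHom_injective (FreeGroup.ext_hom _ _ h)

theorem artinAut_braid (k : ℕ) : artinAut k * artinAut (k + 1) * artinAut k =
    artinAut (k + 1) * artinAut k * artinAut (k + 1) := by
  refine mulAut_ext fun i => ?_
  simp only [MulAut.mul_apply]
  rcases eq_or_ne i k with rfl | h1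
  · simp (disch := omega) [artinAut_self, artinAut_ne]
  rcases eq_or_ne i (k + 1) with rfl | h2
  · simp (disch := omega) [artinAut_self, artinAut_succ, artinAut_ne]
  rcases eq_or_ne i (k + 1 + 1) with rfl | h3
  · simp (disch := omega) [artinAut_self, artinAut_succ, artinAut_ne, mul_assoc]
  · simp (disch := omega) only [artinAut_ne]

theorem artinAut_comm {k l : ℕ} (h : k + 2 ≤ l) : Commute (artinAut k) (artinAut l) := by
  refine mulAut_ext fun i => ?_
  simp only [MulAut.mul_apply]
  rcases eq_or_ne i k with rfl | h1
  · simp (disch := omega) [artinAut_self, artinAut_ne]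
  rcases eq_or_ne i (k + 1) with rfl | h2
  · simp (disch := omega) [artinAut_succ, artinAut_ne]
  rcases eq_or_ne i l with rfl | h3
  · simp (disch := omega) [artinAut_self, artinAut_ne]
  rcases eq_or_ne i (l + 1) with rfl | h4
  · simp (disch := omega) [artinAut_succ, artinAut_ne]
  · simp (disch := omega) only [artinAut_ne]

/-- The automorphisms of the free group attached to the generators. -/
def freeAutGen : ℕ → MulAut (FreeGroup ℕ)
  | 0 => MulAut.conj (.of 0)
  | k + 1 => artinAut k

/-- The action of `ArtinB n` on a free group. -/
def freeAut (n : ℕ) : ArtinB n →* MulAut (FreeGroup ℕ) :=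
  lift n freeAutGen
    (fun _ => mulAut_ext fun i => by
      simp only [pow_two, MulAut.mul_apply, freeAutGen, MulAut.conj_apply]
      have e0 : artinAut 0 (.of 0) = .of 1 := artinAut_self 0
      have e1 : artinAut 0 (.of 1) = (.of 1)⁻¹ * .of 0 * .of 1 := artinAut_succ 0
      rcases eq_or_ne i 0 with rfl | h1
      · simp only [map_mul, map_inv, e0, e1]; group
      rcases eq_or_ne i 1 with rfl | h2
      · simp only [map_mul, map_inv, e0, e1]; group
      · simp only [map_mul, map_inv, e0, e1, artinAut_ne h1 h2]; group)
    (fun i hi h => by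
      obtain ⟨k, rfl⟩ : ∃ k, i = k + 1 := ⟨i - 1, by omega⟩
      exact artinAut_braid k)
    (fun i j hij hj => by
      obtain ⟨l, rfl⟩ : ∃ l, j = l + 1 := ⟨j - 1, by omega⟩
      cases i with
      | zero =>
        refine mulAut_ext fun i => ?_
        simp only [MulAut.mul_apply, freeAutGen, MulAut.conj_apply, map_mul, map_inv]
        rw [artinAut_ne (i := 0) (by omega) (by omega)]
      | succ k => exact artinAut_comm (by omega))

theorem freeAut_gen_zero (hn : 0 < n) : freeAut n (gen n 0) = MulAut.conj (.of 0) := lift_gen hn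

theorem freeAut_gen {k : ℕ} (hk : k + 1 < n) : freeAut n (gen n (k + 1)) = artinAut k := lift_gen hk

/-- The embedding of the free group on the `x_i`, killing the letters out of range. -/
def freeEmb (n : ℕ) : FreeGroup ℕ →* ArtinB n := FreeGroup.lift fun i => if i < n then xg n i else 1

theorem freeEmb_of {i : ℕ} (hi : i < n) : freeEmb n (.of i) = xg n i := by simp [freeEmb, hi]

theorem freeEmb_of_le {i : ℕ} (hi : n ≤ i) : freeEmb n (.of i) = 1 := by simp [freeEmb, hi]

theorem freeEmb_freeAut (h : ArtinB n) : ∀ w, freeEmb n (freeAut n h w) = h * freeEmb n w * h⁻¹ := by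
  induction h using gen_induction with
  | hgen i hi =>
    intro w
    have : (freeEmb n).comp (freeAut n (gen n i)).toMonoidHom =
        (MulAut.conj (gen n i)).toMonoidHom.comp (freeEmb n) := by
      refine FreeGroup.ext_hom _ _ fun j => ?_
      show freeEmb n (freeAut n (gen n i) (.of j)) = gen n i * freeEmb n (.of j) * (gen n i)⁻¹
      cases i with
      | zero =>
        rw [freeAut_gen_zero hi, MulAut.conj_apply, map_mul, map_mul, map_inv, freeEmb_of hi]
        rfl
      | succ k =>
        rw [freeAut_gen hi]
        rcases eq_or_ne j k with rfl | h1
        · rw [artinAut_self, freeEmb_of hi, freeEmb_of (by omega), xg_succ]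
        rcases eq_or_ne j (k + 1) with rfl | h2
        · rw [artinAut_succ, map_mul, map_mul, map_inv, freeEmb_of hi, freeEmb_of (by omega),
            gen_conj_xg_succ hi]
        · rw [artinAut_ne h1 h2]
          rcases lt_or_ge j n with h3 | h3
          · rw [freeEmb_of h3, (gen_commute_xg h3 (by omega) (by omega) (by omega)).eq,
              mul_inv_cancel_right]
          · rw [freeEmb_of_le h3]; simp
    exact DFunLike.congr_fun this w
  | hone => intro w; simp
  | hmul a b ha hb =>
    intro w
    rw [map_mul, MulAut.mul_apply, ha, hb]; group
  | hinv a ha =>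
    intro w
    have := ha ((freeAut n a)⁻¹ w)
    rw [MulAut.apply_inv_self] at this
    rw [map_inv, this]; group

theorem conj_mulAut {G : Type*} [Group G] (φ : MulAut G) (w : G) :
    φ * MulAut.conj w * φ⁻¹ = MulAut.conj (φ w) := by
  ext x
  simp [MulAut.mul_apply]

theorem freeAut_xg {i : ℕ} (hi : i < n) : freeAut n (xg n i) = MulAut.conj (.of i) := by
  induction i with
  | zero => exact freeAut_gen_zero hi
  | succ i ih =>
    rw [xg_succ, map_mul, map_mul, map_inv, ih (by omega), conj_mulAut, freeAut_gen hi, artinAut_self]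

theorem exists_freeEmb {g : ArtinB n} (hn : 0 < n) (hg : g ∈ Subgroup.normalClosure {gen n 0}) :
    ∃ w, freeEmb n w = g ∧ freeAut n g = MulAut.conj w := by
  let N : Subgroup (ArtinB n) :=
    { carrier := {g | ∃ w, freeEmb n w = g ∧ freeAut n g = MulAut.conj w}
      one_mem' := ⟨1, by simp⟩
      mul_mem' := by
        rintro _ _ ⟨w, rfl, h⟩ ⟨w', rfl, h'⟩
        exact ⟨w * w', map_mul _ _ _, by rw [map_mul, h, h', map_mul]⟩
      inv_mem' := by
        rintro _ ⟨w, rfl, h⟩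
        exact ⟨w⁻¹, map_inv _ _, by rw [map_inv, h, map_inv]⟩ }
  have hN : N.Normal := ⟨by
    rintro _ ⟨w, rfl, h⟩ g
    exact ⟨freeAut n g w, freeEmb_freeAut g w, by rw [map_mul, map_mul, map_inv, h, conj_mulAut]⟩⟩
  have : Subgroup.normalClosure {gen n 0} ≤ N := Subgroup.normalClosure_le_normal (by
    rintro _ rfl
    exact ⟨.of 0, freeEmb_of hn, freeAut_gen_zero hn⟩)
  exact this hg

theorem commute_of_conj_eq {a w : FreeGroup ℕ}
    (h : Commute (MulAut.conj a) (MulAut.conj w)) : Commute a w := by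
  have h1 : MulAut.conj (a * w * a⁻¹ * w⁻¹) = 1 := by
    rw [map_mul, map_mul, map_mul, map_inv, map_inv, h.eq]; group
  have h2 : ∀ b, Commute (.of b) (a * w * a⁻¹ * w⁻¹) := fun b => by
    have := DFunLike.congr_fun h1 (.of b)
    rw [MulAut.conj_apply, MulAut.one_apply, mul_inv_eq_iff_eq_mul] at this
    exact this.symm
  have := freeGroup_eq_one_of_commute zero_ne_one (h2 0) (h2 1)
  rwa [mul_inv_eq_one, mul_inv_eq_iff_eq_mul] at this

theorem eq_one_of_mem_normalClosure {g : ArtinB n} (hn : 2 ≤ n)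
    (hg : g ∈ Subgroup.normalClosure {gen n 0}) (hc : ∀ h, Commute g h) : g = 1 := by
  obtain ⟨w, rfl, hw⟩ := exists_freeEmb (by omega) hg
  have key : ∀ i, i < n → Commute (.of i) w := fun i hi => commute_of_conj_eq (by
    rw [← hw, ← freeAut_xg hi]
    exact (hc _).symm.map _)
  rw [freeGroup_eq_one_of_commute zero_ne_one (key 0 (by omega)) (key 1 (by omega)), map_one]

/-! ### The center -/

theorem eq_one_of_central : ∀ (n : ℕ) (g : ArtinB n), (∀ h, Commute g h) →
    2 * delta g + beta g = 0 → g = 1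
  | 0 => fun g _ _ => gen_induction (p := fun g => g = 1) (fun i hi => by omega) rfl
      (fun a b ha hb => by rw [ha, hb, one_mul]) (fun a ha => by rw [ha, inv_one]) g
  | 1 => fun g _ h => by
      have h1 : ∀ g : ArtinB 1, g = gen 1 0 ^ delta g ∧ beta g = 0 := fun g => by
        induction g using gen_induction with
        | hgen i hi =>
          obtain rfl : i = 0 := by omega
          rw [delta_gen_zero hi, zpow_one]; exact ⟨rfl, beta_gen_zero⟩
        | hone => simp
        | hmul a b ha hb =>
          rw [delta_mul, zpow_add, ← ha.1, ← hb.1, beta_mul, ha.2, hb.2]; exact ⟨rfl, rfl⟩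
        | hinv a ha => rw [delta_inv, zpow_neg, ← ha.1, beta_inv, ha.2]; exact ⟨rfl, rfl⟩
      obtain ⟨h2, h3⟩ := h1 g
      rw [h2, show delta g = 0 by omega, zpow_zero]
  | m + 2 => fun g hg h => by
      have h1 := delta_of_central hg
      have h2 := beta_of_central hg
      have h3 : beta g = 0 := by
        rw [h1, h2] at h
        have : (((m + 2 : ℕ) : ℤ) * ((m + 2 : ℕ) + 1)) * cv g 0 1 = 0 := by linarith
        have h4 := (mul_eq_zero.mp this).resolve_left (by positivity)
        rw [h2, h4, mul_zero]
      exact eq_one_of_mem_normalClosure (by omega)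
        ((QuotientGroup.eq_one_iff _).mp
          (toBr_eq_one_of_central (eq_one_of_central (m + 1)) hg h3)) hg

theorem eq_of_central {g g' : ArtinB n} (hg : ∀ h, Commute g h) (hg' : ∀ h, Commute g' h)
    (h : 2 * delta g + beta g = 2 * delta g' + beta g') : g = g' := by
  rw [← mul_inv_eq_one]
  refine eq_one_of_central n _ (fun h => (hg h).mul_left (hg' h).inv_left) ?_
  rw [delta_mul, beta_mul, delta_inv, beta_inv]
  linarith

theorem eq_zpow_of_central {g : ArtinB n} (hg : ∀ h, Commute g h) :
    g = artinBTwist n ^ cv g 0 1 := by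
  refine eq_of_central hg (fun h => (commute_artinBTwist h).zpow_left _) ?_
  rw [delta_of_central hg, beta_of_central hg, delta_zpow, beta_zpow, delta_artinBTwist,
    beta_artinBTwist]
  ring

end ArtinB

namespace ArtinB

variable {n : ℕ}

/-! ### Lifting automorphisms of the central quotient -/

/-- The homomorphism to `ℤ` separating central elements. -/
def edeg (g : ArtinB n) : ℤ := 2 * delta g + beta g

theorem edeg_mul (g h : ArtinB n) : edeg (g * h) = edeg g + edeg h := by
  simp only [edeg, delta_mul, beta_mul]; ring

theorem edeg_pow (g : ArtinB n) (k : ℕ) : edeg (g ^ k) = k * edeg g := by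
  simp only [edeg, delta_pow, beta_pow]; ring

theorem edeg_zpow (g : ArtinB n) (k : ℤ) : edeg (g ^ k) = k * edeg g := by
  simp only [edeg, delta_zpow, beta_zpow]; ring

theorem mem_center {g : ArtinB n} : g ∈ Subgroup.center (ArtinB n) ↔ ∀ h, Commute g h := by
  rw [Subgroup.mem_center_iff]
  exact ⟨fun h x => (h x).symm, fun h x => (h x).symm⟩

theorem mk_eq_mk {g h : ArtinB n} :
    (g : ArtinB n ⧸ Subgroup.center (ArtinB n)) = h ↔ ∃ j : ℤ, h = g * artinBTwist n ^ j := by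
  rw [QuotientGroup.eq, mem_center]
  constructor
  · intro hc
    exact ⟨_, by rw [← eq_zpow_of_central hc, mul_inv_cancel_left]⟩
  · rintro ⟨j, rfl⟩ x
    rw [inv_mul_cancel_left]
    exact (commute_artinBTwist x).zpow_left j

theorem eq_of_mk_eq {g h : ArtinB n}
    (h1 : (g : ArtinB n ⧸ Subgroup.center (ArtinB n)) = h) (h2 : edeg g = edeg h) : g = h := by
  have h3 := eq_of_central (g := g⁻¹ * h) (g' := 1) (mem_center.mp (QuotientGroup.eq.mp h1))
    (fun x => Commute.one_left x) (by
      rw [delta_mul, beta_mul, delta_inv, beta_inv, delta_one, beta_one]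
      simp only [edeg] at h2
      linarith)
  rw [inv_mul_eq_one] at h3
  exact h3

/-- `Φ` is a lift of the automorphism `φ` of the central quotient. -/
def IsLift (φ : MulAut (ArtinB n ⧸ Subgroup.center (ArtinB n))) (Φ : ArtinB n →* ArtinB n) : Prop :=
  ∀ g : ArtinB n, (Φ g : ArtinB n ⧸ Subgroup.center (ArtinB n)) = φ g

theorem exists_isLift (φ : MulAut (ArtinB n ⧸ Subgroup.center (ArtinB n))) :
    ∃ Φ, IsLift φ Φ := by
  choose a ha using fun i => QuotientGroup.mk_surjective (s := Subgroup.center (ArtinB n))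
    (φ (gen n i))
  have key : ∀ i, ∃ b : ArtinB n, (b : ArtinB n ⧸ Subgroup.center (ArtinB n)) = φ (gen n i) ∧
      (1 ≤ i → i < n → edeg b = edeg (a 1)) := by
    intro i
    induction i with
    | zero => exact ⟨a 0, ha 0, by omega⟩
    | succ i ih =>
      rcases Nat.eq_zero_or_pos i with rfl | hi
      · exact ⟨a 1, ha 1, fun _ _ => rfl⟩
      by_cases hn : i + 1 < n
      · obtain ⟨b, hb, hb'⟩ := ih
        have h1 : ((b * a (i + 1) * b : ArtinB n) : ArtinB n ⧸ Subgroup.center (ArtinB n)) =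
            (a (i + 1) * b * a (i + 1) : ArtinB n) := by
          simp only [QuotientGroup.mk_mul, hb, ha, ← map_mul]
          simp only [← QuotientGroup.mk_mul, gen_braid hi hn]
        obtain ⟨j, hj⟩ := mk_eq_mk.mp h1
        refine ⟨a (i + 1) * artinBTwist n ^ (-j), ?_, fun _ _ => ?_⟩
        · rw [← ha]; exact (mk_eq_mk.mpr ⟨-j, rfl⟩).symm
        · have := congrArg edeg hj
          simp only [edeg_mul, edeg_zpow] at this ⊢
          rw [← hb' hi (by omega)]
          linarith
      · exact ⟨a (i + 1), ha _, by omega⟩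
  choose f hf hf' using key
  let Φ := lift n f
    (fun h => eq_of_mk_eq
      (by
        simp only [QuotientGroup.mk_mul, QuotientGroup.mk_pow, hf, ← map_mul, ← map_pow]
        simp only [← QuotientGroup.mk_mul, ← QuotientGroup.mk_pow, gen_four])
      (by simp only [edeg_mul, edeg_pow]; ring))
    (fun i hi h => eq_of_mk_eq
      (by
        simp only [QuotientGroup.mk_mul, hf, ← map_mul]
        simp only [← QuotientGroup.mk_mul, gen_braid hi h])
      (by simp only [edeg_mul, hf' i hi (by omega), hf' (i + 1) (by omega) h]))
    (fun i j h _ => eq_of_mk_eq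
      (by
        simp only [QuotientGroup.mk_mul, hf, ← map_mul]
        simp only [← QuotientGroup.mk_mul, (gen_comm h).eq])
      (by simp only [edeg_mul]; ring))
  refine ⟨Φ, fun g => ?_⟩
  have : (QuotientGroup.mk' (Subgroup.center (ArtinB n))).comp Φ =
      φ.toMonoidHom.comp (QuotientGroup.mk' (Subgroup.center (ArtinB n))) :=
    hom_ext fun i hi => by
      show ((Φ (gen n i) : ArtinB n) : ArtinB n ⧸ Subgroup.center (ArtinB n)) = φ (gen n i)
      rw [← hf]
      congr 1
      exact lift_gen hi
  exact DFunLike.congr_fun this g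

theorem IsLift.comp {φ ψ : MulAut (ArtinB n ⧸ Subgroup.center (ArtinB n))}
    {Φ Ψ : ArtinB n →* ArtinB n} (hΦ : IsLift φ Φ) (hΨ : IsLift ψ Ψ) :
    IsLift (φ * ψ) (Φ.comp Ψ) := fun g => by
  rw [MonoidHom.comp_apply, hΦ, hΨ, MulAut.mul_apply]

theorem IsLift.conj {φ : MulAut (ArtinB n ⧸ Subgroup.center (ArtinB n))}
    {Φ : ArtinB n →* ArtinB n} (hΦ : IsLift φ Φ) (c : ArtinB n) :
    IsLift (MulAut.conj (c : ArtinB n ⧸ Subgroup.center (ArtinB n)) * φ)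
      ((MulAut.conj c).toMonoidHom.comp Φ) :=
  IsLift.comp (fun _ => rfl) hΦ

/-- Multiplying an endomorphism by a homomorphism to the center. -/
def twist (Φ : ArtinB n →* ArtinB n) (x y : ℤ) : ArtinB n →* ArtinB n :=
  MonoidHom.mk' (fun g => Φ g * artinBTwist n ^ (x * delta g + y * beta g)) fun g h => by
    rw [map_mul, delta_mul, beta_mul, show x * (delta g + delta h) + y * (beta g + beta h) =
      (x * delta g + y * beta g) + (x * delta h + y * beta h) by ring, zpow_add, mul_assoc, mul_assoc,
      ← mul_assoc (Φ h), ← mul_assoc (artinBTwist n ^ (x * delta g + y * beta g)),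
      ((commute_artinBTwist (Φ h)).zpow_left _).eq]

theorem twist_apply (Φ : ArtinB n →* ArtinB n) (x y : ℤ) (g : ArtinB n) :
    twist Φ x y g = Φ g * artinBTwist n ^ (x * delta g + y * beta g) := rfl

theorem IsLift.twist {φ : MulAut (ArtinB n ⧸ Subgroup.center (ArtinB n))}
    {Φ : ArtinB n →* ArtinB n} (hΦ : IsLift φ Φ) (x y : ℤ) : IsLift φ (twist Φ x y) := fun g => by
  rw [← hΦ]
  exact (mk_eq_mk.mpr ⟨_, rfl⟩).symm

theorem delta_map (Φ : ArtinB n →* ArtinB n) (g : ArtinB n) :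
    delta (Φ g) = delta (Φ (gen n 0)) * delta g + delta (Φ (gen n 1)) * beta g :=
  additive_eq (fun g => delta (Φ g)) (fun g h => by rw [map_mul, delta_mul]) g

theorem beta_map (Φ : ArtinB n →* ArtinB n) (g : ArtinB n) :
    beta (Φ g) = beta (Φ (gen n 0)) * delta g + beta (Φ (gen n 1)) * beta g :=
  additive_eq (fun g => beta (Φ g)) (fun g h => by rw [map_mul, beta_mul]) g

/-- `Φ` is a lift of some automorphism of the central quotient. -/
def Good (Φ : ArtinB n →* ArtinB n) : Prop := ∃ φ, IsLift φ Φ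

theorem Good.conj {Φ : ArtinB n →* ArtinB n} (h : Good Φ) (c : ArtinB n) :
    Good ((MulAut.conj c).toMonoidHom.comp Φ) := h.elim fun _ h => ⟨_, h.conj c⟩

theorem Good.twist {Φ : ArtinB n →* ArtinB n} (h : Good Φ) (x y : ℤ) : Good (twist Φ x y) :=
  h.elim fun _ h => ⟨_, h.twist x y⟩

theorem Good.exists_quasi_inverse {Φ : ArtinB n →* ArtinB n} (h : Good Φ) :
    ∃ Ψ : ArtinB n →* ArtinB n, Good Ψ ∧ (∀ g, ∃ j : ℤ, Φ (Ψ g) = g * artinBTwist n ^ j) ∧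
      (∀ g, ∃ j : ℤ, Ψ (Φ g) = g * artinBTwist n ^ j) := by
  obtain ⟨φ, hφ⟩ := h
  obtain ⟨Ψ, hΨ⟩ := exists_isLift φ⁻¹
  refine ⟨Ψ, ⟨_, hΨ⟩, fun g => mk_eq_mk.mp ?_, fun g => mk_eq_mk.mp ?_⟩
  · rw [hφ, hΨ, MulAut.apply_inv_self]
  · rw [hΨ, hφ, MulAut.inv_apply_self]

theorem Good.exists_map_eq {Φ : ArtinB n →* ArtinB n} (h : Good Φ) (g : ArtinB n) :
    ∃ h, ∃ j : ℤ, Φ h = g * artinBTwist n ^ j := by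
  obtain ⟨Ψ, -, h, -⟩ := h.exists_quasi_inverse
  exact ⟨Ψ g, h g⟩

theorem Good.map_twist {Φ : ArtinB n →* ArtinB n} (h : Good Φ) :
    ∃ k : ℤ, Φ (artinBTwist n) = artinBTwist n ^ k := by
  obtain ⟨φ, hφ⟩ := h
  have h1 : ((1 : ArtinB n) : ArtinB n ⧸ Subgroup.center (ArtinB n)) = Φ (artinBTwist n) := by
    rw [hφ, ← (mk_eq_mk (g := 1) (h := artinBTwist n)).mpr ⟨1, by simp⟩, QuotientGroup.mk_one, map_one]
  obtain ⟨k, hk⟩ := mk_eq_mk.mp h1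
  exact ⟨k, by rw [hk, one_mul]⟩

/-- The exponent by which `Φ` acts on the center. -/
def cexp (Φ : ArtinB n →* ArtinB n) : ℤ := delta (Φ (gen n 0)) + (n - 1) * delta (Φ (gen n 1))

theorem Good.map_artinBTwist {Φ : ArtinB n →* ArtinB n} (hn : 0 < n) (h : Good Φ) :
    Φ (artinBTwist n) = artinBTwist n ^ cexp Φ := by
  obtain ⟨k, hk⟩ := h.map_twist
  have h1 := congrArg delta hk
  rw [delta_map, delta_zpow, delta_artinBTwist, beta_artinBTwist] at h1
  have h2 : (n : ℤ) * k = n * cexp Φ := by rw [cexp]; linarith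
  rw [hk, mul_left_cancel₀ (by positivity) h2]

theorem Good.isCoprime {Φ : ArtinB n →* ArtinB n} (hn : 0 < n) (h : Good Φ) :
    IsCoprime (cexp Φ) n := by
  obtain ⟨Ψ, hΨ, -, h1⟩ := h.exists_quasi_inverse
  have h2 := congrArg (fun g => delta (Ψ g)) (h.map_artinBTwist hn)
  simp only [map_zpow] at h2
  rw [hΨ.map_artinBTwist hn, ← zpow_mul, delta_zpow, delta_artinBTwist] at h2
  have h3 := delta_map (Ψ.comp Φ) (artinBTwist n)
  obtain ⟨a, ha⟩ := h1 (gen n 0)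
  obtain ⟨b, hb⟩ := h1 (gen n 1)
  simp only [MonoidHom.comp_apply] at h3
  rw [h2, ha, hb, delta_mul, delta_mul, delta_zpow, delta_zpow, delta_artinBTwist,
    beta_artinBTwist, delta_gen_zero hn, delta_gen le_rfl] at h3
  have h4 : (n : ℤ) * (cexp Ψ * cexp Φ) = n * (1 + a * n + (n - 1) * b * n) := by linarith
  have h5 := mul_left_cancel₀ (by positivity) h4
  exact ⟨cexp Ψ, -a - (n - 1) * b, by rw [h5]; ring⟩

theorem Good.beta_sub {Φ : ArtinB n →* ArtinB n} (hn : 2 ≤ n) (h : Good Φ) (g : ArtinB n) :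
    beta (Φ g) - (n - 1) * delta (Φ g) =
      (beta (Φ (gen n 1)) - (n - 1) * delta (Φ (gen n 1))) * (beta g - (n - 1) * delta g) := by
  have h1 := congrArg (fun g => beta g - (n - 1) * delta g) (h.map_artinBTwist (by omega))
  simp only [beta_zpow, delta_zpow, beta_artinBTwist, delta_artinBTwist] at h1
  rw [delta_map, beta_map, delta_artinBTwist, beta_artinBTwist] at h1
  rw [delta_map, beta_map]
  have h2 : (n : ℤ) * (beta (Φ (gen n 0)) - (n - 1) * delta (Φ (gen n 0)) +
      (n - 1) * (beta (Φ (gen n 1)) - (n - 1) * delta (Φ (gen n 1)))) = 0 := by linarith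
  have h3 := (mul_eq_zero.mp h2).resolve_left (by positivity)
  linear_combination delta g * h3

theorem Good.beta_gen_one {Φ : ArtinB n →* ArtinB n} (hn : 2 ≤ n) (h : Good Φ) :
    ∃ η : ℤ, (η = 1 ∨ η = -1) ∧ beta (Φ (gen n 1)) = η + (n - 1) * delta (Φ (gen n 1)) := by
  obtain ⟨Ψ, hΨ, -, h1⟩ := h.exists_quasi_inverse
  obtain ⟨j, hj⟩ := h1 (gen n 1)
  have h2 := hΨ.beta_sub hn (Φ (gen n 1))
  rw [hj, beta_mul, delta_mul, beta_zpow, delta_zpow, beta_artinBTwist, delta_artinBTwist,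
    beta_gen le_rfl (by omega), delta_gen le_rfl] at h2
  refine ⟨beta (Φ (gen n 1)) - (n - 1) * delta (Φ (gen n 1)), ?_, by ring⟩
  exact Int.isUnit_iff.mp (IsUnit.of_mul_eq_one (beta (Ψ (gen n 1)) - (n - 1) * delta (Ψ (gen n 1)))
    (by linarith))

end ArtinB

namespace ArtinB

variable {n : ℕ}

/-! ### Linking numbers of the images of the generators -/

theorem eq_of_swap_invariant {f : ℕ → ℤ} {p n : ℕ}
    (h : ∀ i, p ≤ i → i < n → ∀ a, f (Equiv.swap i (i + 1) a) = f a) {j : ℕ} (hj : p ≤ j)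
    (hjn : j ≤ n) : f j = f p := by
  induction j, hj using Nat.le_induction with
  | base => rfl
  | succ j hj ih =>
    rw [← ih (by omega), ← h j hj (by omega), Equiv.swap_apply_right]

theorem eq_of_swap_invariant₂ {f : ℕ → ℕ → ℤ} {p n : ℕ}
    (h : ∀ i, p ≤ i → i < n → ∀ a b, f (Equiv.swap i (i + 1) a) (Equiv.swap i (i + 1) b) = f a b)
    {j k : ℕ} (hj : p ≤ j) (hjk : j < k) (hk : k ≤ n) : f j k = f p (p + 1) := by
  have h1 : ∀ j, p ≤ j → ∀ k, j + 1 ≤ k → k ≤ n → f j k = f j (j + 1) := by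
    intro j hj k hjk
    induction k, hjk using Nat.le_induction with
    | base => intro _; rfl
    | succ k hk ih =>
      intro hkn
      rw [← ih (by omega), ← h k (by omega) (by omega), Equiv.swap_apply_right,
        Equiv.swap_apply_of_ne_of_ne (by omega) (by omega)]
  rw [h1 j hj k hjk hk]
  have h2 : j + 1 ≤ n := by omega
  clear hjk hk
  induction j, hj using Nat.le_induction with
  | base => rfl
  | succ j hj ih =>
    rw [← ih (by omega), ← h1 j hj (j + 1 + 1) (by omega) h2, ← h j hj (by omega),
      Equiv.swap_apply_right, Equiv.swap_apply_of_ne_of_ne (by omega) (by omega)]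

theorem sum_Icc_of_const {f : ℕ → ℤ} {p n : ℕ} (hpn : p ≤ n) (c : ℤ)
    (h : ∀ j, p < j → j ≤ n → f j = c) :
    ∑ j ∈ Finset.Icc 1 n, f j = (∑ j ∈ Finset.Icc 1 p, f j) + (n - p : ℤ) * c := by
  induction n, hpn using Nat.le_induction with
  | base => simp
  | succ n hn ih =>
    rw [Finset.sum_Icc_succ_top (by omega), ih fun j h1 h2 => h j h1 (by omega),
      h (n + 1) (by omega) le_rfl]
    push_cast; ring

variable {Φ : ArtinB n →* ArtinB n}

theorem sg_gen_sq {i : ℕ} (hi : 1 ≤ i) (hin : i < n) : sg n (gen n i ^ 2) = 1 := by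
  rw [map_pow, sg_gen hi hin, pow_two, Equiv.swap_mul_self]

theorem cv_map_of_commute (hsg : ∀ g, sg n (Φ g) = sg n g) {g h : ArtinB n} (hg : sg n g = 1)
    (hc : Commute h g) (a b : ℕ) : cv (Φ g) (sg n h a) (sg n h b) = cv (Φ g) a b := by
  have := cv_of_commute (by rw [hsg, hg]) (hc.map Φ) a b
  rwa [hsg] at this

theorem det_map_of_commute (hsg : ∀ g, sg n (Φ g) = sg n g) {g h : ArtinB n} (hg : sg n g = 1)
    (hh : sg n h = 1) (hc : Commute g h) (a b c : ℕ) :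
    cv (Φ g) a b * (cv (Φ h) a c - cv (Φ h) b c) + cv (Φ g) b c * (cv (Φ h) a b - cv (Φ h) a c) +
      cv (Φ g) a c * (cv (Φ h) b c - cv (Φ h) a b) = 0 := by
  have hg' : sg n (Φ g) = 1 := by rw [hsg, hg]
  have hh' : sg n (Φ h) = 1 := by rw [hsg, hh]
  have := det_of_commute hg' hh' (hc.map Φ) a b c
  rw [cv_comm hg' c b, cv_comm hh' c b] at this
  linear_combination this

theorem cv_map_gen_zero_swap (hsg : ∀ g, sg n (Φ g) = sg n g) {i : ℕ} (hi : 2 ≤ i) (hin : i < n)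
    (a b : ℕ) : cv (Φ (gen n 0)) (Equiv.swap i (i + 1) a) (Equiv.swap i (i + 1) b) =
      cv (Φ (gen n 0)) a b := by
  have := cv_map_of_commute hsg sg_gen_zero (gen_comm (i := 0) (by omega : 0 + 2 ≤ i)).symm a b
  rwa [sg_gen (by omega) hin] at this

theorem cv_map_gen_one_sq_swap (hsg : ∀ g, sg n (Φ g) = sg n g) {i : ℕ} (hi : i = 1 ∨ 3 ≤ i)
    (hin : i < n) (a b : ℕ) :
    cv (Φ (gen n 1 ^ 2)) (Equiv.swap i (i + 1) a) (Equiv.swap i (i + 1) b) =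
      cv (Φ (gen n 1 ^ 2)) a b := by
  have hc : Commute (gen n i) (gen n 1) := hi.elim (fun h => by rw [h]) fun h =>
    (gen_comm (i := 1) (by omega)).symm
  have := cv_map_of_commute hsg (sg_gen_sq le_rfl (by omega)) (hc.pow_right 2) a b
  rwa [sg_gen (by omega) hin] at this

theorem cv_map_gen_succ_sq (hsg : ∀ g, sg n (Φ g) = sg n g) {i : ℕ} (hi : 1 ≤ i) (hin : i + 1 < n)
    (a b : ℕ) : cv (Φ (gen n (i + 1) ^ 2)) a b =
      cv (Φ (gen n i ^ 2)) (Equiv.swap (i + 1) (i + 2) (Equiv.swap i (i + 1) a))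
        (Equiv.swap (i + 1) (i + 2) (Equiv.swap i (i + 1) b)) := by
  have h1 : gen n (i + 1) ^ 2 = (gen n i * gen n (i + 1)) * gen n i ^ 2 *
      (gen n i * gen n (i + 1))⁻¹ := by
    rw [← conj_pow]
    congr 1
    rw [eq_mul_inv_iff_mul_eq, gen_braid hi hin, mul_assoc]
  rw [h1, map_mul, map_mul, map_inv, cv_conj (by rw [hsg, sg_gen_sq hi (by omega)]), hsg, map_mul,
    sg_gen hi (by omega), sg_gen (by omega) hin, mul_inv_rev, Equiv.swap_inv, Equiv.swap_inv]
  rfl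

theorem cv_map_gen_one_sq (hsg : ∀ g, sg n (Φ g) = sg n g) (hn : 2 ≤ n) (a b : ℕ) :
    cv (Φ (gen n 1 ^ 2)) a b = cv (Φ (gen n 1)) a b +
      cv (Φ (gen n 1)) (Equiv.swap 1 2 a) (Equiv.swap 1 2 b) := by
  rw [pow_two, map_mul, cv_mul, hsg, sg_gen le_rfl (by omega), Equiv.swap_inv]

theorem cv_map_bar (hsg : ∀ g, sg n (Φ g) = sg n g) (hn : 2 ≤ n) (a b : ℕ) :
    cv (Φ (gen n 1 * gen n 0 * gen n 1)) a b = cv (Φ (gen n 1 ^ 2)) a b +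
      cv (Φ (gen n 0)) (Equiv.swap 1 2 a) (Equiv.swap 1 2 b) := by
  rw [cv_map_gen_one_sq hsg hn, map_mul, map_mul, cv_mul, cv_mul, map_mul (sg n), hsg, hsg,
    sg_gen le_rfl (by omega), sg_gen_zero, mul_one, Equiv.swap_inv]
  ring

theorem commute_gen_zero_bar : Commute (gen n 0) (gen n 1 * gen n 0 * gen n 1) := by
  have := gen_four n
  simp only [pow_two] at this
  show _ = _
  simpa only [mul_assoc] using this

theorem sg_bar (hn : 2 ≤ n) : sg n (gen n 1 * gen n 0 * gen n 1) = 1 := by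
  rw [map_mul, map_mul, sg_gen_zero, mul_one, ← map_mul, ← pow_two, sg_gen_sq le_rfl (by omega)]

theorem three_strand_arith {l m v x b g a k e : ℤ} (he : e = 1 ∨ e = -1)
    (h1 : (l - v) * (b - k) = (m - v) * (g - k))
    (h2 : (l - m) * (l + m + b - a - 2 * v) = 0)
    (h3 : (l - v) * (m + g - x - k) = (m - v) * (m + b - x - k))
    (h4 : (x - m) * (l + b - m - g) = 0)
    (h6 : a + 2 * k = e + 2 * b + g)
    (h7 : 2 * v + x = l + 2 * m - e) : b = g := by
  by_contra hbg
  rcases eq_or_ne l m with rfl | hlm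
  · have h8 : l = v := by
      by_contra hlv
      exact hbg (by linarith [mul_left_cancel₀ (sub_ne_zero.mpr hlv) h1])
    have h9 : x = l := by
      by_contra hxl
      exact hbg (by linarith [(mul_eq_zero.mp h4).resolve_left (sub_ne_zero.mpr hxl)])
    omega
  · have h8 := (mul_eq_zero.mp h2).resolve_left (sub_ne_zero.mpr hlm)
    rcases mul_eq_zero.mp h4 with h9 | h9
    · obtain rfl : g = 2 * k - b := by linarith
      have h10 : (l + m - 2 * v) * (b - k) = 0 := by linear_combination h1
      rcases mul_eq_zero.mp h10 with h11 | h11 <;> omega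
    · have h10 : (b - g) * (l - v - (g - k)) = 0 := by
        linear_combination h1 - (g - k) * h9
      have h11 := (mul_eq_zero.mp h10).resolve_left (sub_ne_zero.mpr hbg)
      omega

theorem dvd_delta_three {Φ : ArtinB 3 →* ArtinB 3} (hsg : ∀ g, sg 3 (Φ g) = sg 3 g) (h : Good Φ) :
    (3 : ℤ) ∣ delta (Φ (gen 3 1)) := by
  obtain ⟨e, he, hb⟩ := h.beta_gen_one (by omega)
  have hb0 := h.beta_sub (by omega) (gen 3 0)
  rw [beta_gen_zero, delta_gen_zero (by omega), hb] at hb0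
  have hy := fun a b => cv_map_gen_one_sq_swap hsg (i := 1) (by omega) (by omega) a b
  have hx := fun a b => cv_map_gen_zero_swap hsg (i := 2) (by omega) (by omega) a b
  have x02 := hx 0 2
  have x12 := hx 1 2
  have y01 := hy 0 1
  have y13 := hy 1 3
  have xs := fun a b => cv_comm (g := Φ (gen 3 0)) (by rw [hsg, sg_gen_zero]) a b
  have ys := fun a b => cv_comm (g := Φ (gen 3 1 ^ 2))
    (by rw [hsg, sg_gen_sq le_rfl (by omega)]) a b
  have hc : Commute (gen 3 0) (gen 3 2 ^ 2) := (gen_comm (by omega)).pow_right 2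
  have h3 := sg_gen_sq (n := 3) (i := 2) (by omega) (by omega)
  have d1 := det_map_of_commute hsg sg_gen_zero h3 hc 0 1 2
  have d2 := det_map_of_commute hsg sg_gen_zero (sg_bar (by omega)) commute_gen_zero_bar 0 1 2
  have d3 := det_map_of_commute hsg sg_gen_zero (sg_bar (by omega)) commute_gen_zero_bar 0 1 3
  have d4 := det_map_of_commute hsg sg_gen_zero (sg_bar (by omega)) commute_gen_zero_bar 0 2 3
  have e1 := delta_eq_sum (Φ (gen 3 0))
  have e2 := delta_eq_sum (Φ (gen 3 1 ^ 2))
  have e3 := beta_eq_sum (Φ (gen 3 0))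
  have e4 := beta_eq_sum (Φ (gen 3 1 ^ 2))
  rw [map_pow, delta_pow] at e2
  rw [map_pow, beta_pow, hb] at e4
  rw [← map_pow] at e2 e4
  simp only [cv_map_gen_succ_sq hsg (i := 1) le_rfl (by omega : 1 + 1 < 3),
    cv_map_bar hsg (by omega : 2 ≤ 3), Equiv.swap_apply_def] at *
  norm_num [Finset.sum_Icc_succ_top, cv_self] at *
  have x21 := xs 2 1
  have x31 := xs 3 1
  have x32 := xs 3 2
  have y21 := ys 2 1
  have y31 := ys 3 1
  have y32 := ys 3 2
  clear xs ys hx hy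
  simp only [x21, x31, x32, y21, y31, y32, x02, x12, y01, y13] at *
  have key := three_strand_arith (l := cv (Φ (gen 3 0)) 0 1) (m := cv (Φ (gen 3 0)) 0 2)
    (v := cv (Φ (gen 3 0)) 1 2) (x := cv (Φ (gen 3 0)) 2 3) (b := cv (Φ (gen 3 1) ^ 2) 0 1)
    (g := cv (Φ (gen 3 1) ^ 2) 0 3) (a := cv (Φ (gen 3 1) ^ 2) 1 2)
    (k := cv (Φ (gen 3 1) ^ 2) 1 3) he (by linear_combination d1) (by linear_combination d2)
    (by linear_combination d3) (by linear_combination d4) (by linarith) (by linarith)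
  rw [← key] at e2
  omega

end ArtinB

namespace ArtinB

variable {n : ℕ} {Φ : ArtinB n →* ArtinB n}

theorem cv_map_gen_zero_of_lt_two (hsg : ∀ g, sg n (Φ g) = sg n g) {a j : ℕ} (ha : a < 2)
    (hj : 2 ≤ j) (hjn : j ≤ n) : cv (Φ (gen n 0)) a j = cv (Φ (gen n 0)) a 2 :=
  eq_of_swap_invariant (f := fun b => cv (Φ (gen n 0)) a b) (fun i hi hin b => by
    have := cv_map_gen_zero_swap hsg hi hin a b
    rwa [Equiv.swap_apply_of_ne_of_ne (by omega : a ≠ i) (by omega : a ≠ i + 1)] at this) hj hjn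

theorem cv_map_gen_one_sq_of_lt_three (hsg : ∀ g, sg n (Φ g) = sg n g) {a j : ℕ} (ha : a < 3)
    (hj : 3 ≤ j) (hjn : j ≤ n) : cv (Φ (gen n 1 ^ 2)) a j = cv (Φ (gen n 1 ^ 2)) a 3 :=
  eq_of_swap_invariant (f := fun b => cv (Φ (gen n 1 ^ 2)) a b) (fun i hi hin b => by
    have := cv_map_gen_one_sq_swap hsg (Or.inr hi) hin a b
    rwa [Equiv.swap_apply_of_ne_of_ne (by omega : a ≠ i) (by omega : a ≠ i + 1)] at this) hj hjn

theorem cv_map_gen_one_sq_of_three_le (hsg : ∀ g, sg n (Φ g) = sg n g) {j k : ℕ}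
    (hj : 3 ≤ j) (hjk : j < k) (hk : k ≤ n) :
    cv (Φ (gen n 1 ^ 2)) j k = cv (Φ (gen n 1 ^ 2)) 3 4 :=
  eq_of_swap_invariant₂ (fun _ hi hin => cv_map_gen_one_sq_swap hsg (Or.inr hi) hin) hj hjk hk

theorem delta_map_gen_zero (hsg : ∀ g, sg n (Φ g) = sg n g) (hn : 1 ≤ n) :
    delta (Φ (gen n 0)) = cv (Φ (gen n 0)) 0 1 + (n - 1) * cv (Φ (gen n 0)) 0 2 := by
  rw [delta_eq_sum, sum_Icc_of_const hn _ fun j h1 h2 =>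
    cv_map_gen_zero_of_lt_two hsg (by omega) h1 h2]
  simp

theorem cv_map_gen_one_sq_zero_two (hsg : ∀ g, sg n (Φ g) = sg n g) (hn : 2 ≤ n) :
    cv (Φ (gen n 1 ^ 2)) 0 2 = cv (Φ (gen n 1 ^ 2)) 0 1 := by
  simpa [Equiv.swap_apply_def] using cv_map_gen_one_sq_swap hsg (Or.inl rfl) hn 0 1

theorem cv_map_gen_one_sq_two_three (hsg : ∀ g, sg n (Φ g) = sg n g) (hn : 2 ≤ n) :
    cv (Φ (gen n 1 ^ 2)) 2 3 = cv (Φ (gen n 1 ^ 2)) 1 3 := by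
  simpa [Equiv.swap_apply_def] using cv_map_gen_one_sq_swap hsg (Or.inl rfl) hn 1 3

theorem two_mul_delta_map_gen_one (hsg : ∀ g, sg n (Φ g) = sg n g) (hn : 2 ≤ n) :
    2 * delta (Φ (gen n 1)) =
      2 * cv (Φ (gen n 1 ^ 2)) 0 1 + (n - 2) * cv (Φ (gen n 1 ^ 2)) 0 3 := by
  have h := delta_eq_sum (Φ (gen n 1 ^ 2))
  rw [sum_Icc_of_const hn _ fun j h1 h2 =>
    cv_map_gen_one_sq_of_lt_three hsg (by omega) h1 h2, map_pow, delta_pow, ← map_pow,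
    Finset.sum_Icc_succ_top (by omega), cv_map_gen_one_sq_zero_two hsg hn] at h
  simp [-map_pow] at h
  linarith

theorem two_dvd_cv_map_gen_one_sq (hsg : ∀ g, sg n (Φ g) = sg n g) (hn : 2 ≤ n) :
    2 ∣ cv (Φ (gen n 1 ^ 2)) 0 3 := by
  rw [cv_map_gen_one_sq hsg hn, Equiv.swap_apply_of_ne_of_ne (by omega) (by omega),
    Equiv.swap_apply_of_ne_of_ne (by omega) (by omega)]
  exact ⟨_, (two_mul _).symm⟩

theorem cv_map_of_five_le (hsg : ∀ g, sg n (Φ g) = sg n g) (hn : 5 ≤ n) :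
    cv (Φ (gen n 1 ^ 2)) 0 1 = cv (Φ (gen n 1 ^ 2)) 0 3 ∧
      cv (Φ (gen n 1 ^ 2)) 3 4 = cv (Φ (gen n 1 ^ 2)) 1 3 := by
  have h1 := sg_gen_sq (n := n) (i := 1) le_rfl (by omega)
  have h3 := sg_gen_sq (n := n) (i := 3) (by omega) (by omega)
  have hc : Commute (gen n 1 ^ 2) (gen n 3 ^ 2) := Commute.pow_pow (gen_comm (by omega)) 2 2
  have d1 := det_map_of_commute hsg h1 h3 hc 1 3 5
  have d2 := det_map_of_commute hsg h1 h3 hc 0 1 3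
  have d3 := det_map_of_commute hsg h1 h3 hc 0 1 5
  have ys := fun a b => cv_comm (g := Φ (gen n 1 ^ 2)) (by rw [hsg, h1]) a b
  have y05 := cv_map_gen_one_sq_of_lt_three hsg (a := 0) (j := 5) (by omega) (by omega) (by omega)
  have y15 := cv_map_gen_one_sq_of_lt_three hsg (a := 1) (j := 5) (by omega) (by omega) (by omega)
  have y35 := cv_map_gen_one_sq_of_three_le hsg (j := 3) (k := 5) (by omega) (by omega) (by omega)
  have y31 := ys 3 1
  clear ys hc h1 h3
  simp only [cv_map_gen_succ_sq hsg (i := 2) (by omega) (by omega : 2 + 1 < n),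
    cv_map_gen_succ_sq hsg (i := 1) le_rfl (by omega : 1 + 1 < n), Equiv.swap_apply_def] at d1 d2 d3
  norm_num [-map_pow] at d1 d2 d3
  simp only [y05, y15, y35, y31] at d1 d2 d3
  have h : cv (Φ (gen n 1 ^ 2)) 3 4 = cv (Φ (gen n 1 ^ 2)) 1 3 := by
    have : (cv (Φ (gen n 1 ^ 2)) 3 4 - cv (Φ (gen n 1 ^ 2)) 1 3) ^ 2 = 0 := by
      linear_combination - d1
    linarith [pow_eq_zero_iff (two_ne_zero) |>.mp this]
  refine ⟨?_, h⟩
  rw [h] at d3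
  by_contra hne
  have hne := sub_ne_zero.mpr hne
  have h4 := mul_left_cancel₀ hne (b := cv (Φ (gen n 1 ^ 2)) 0 1 + cv (Φ (gen n 1 ^ 2)) 0 3 -
    2 * cv (Φ (gen n 1 ^ 2)) 1 3) (c := 0) (by linear_combination d2)
  have h5 := mul_left_cancel₀ hne (b := cv (Φ (gen n 1 ^ 2)) 0 3 -
    cv (Φ (gen n 1 ^ 2)) 1 3) (c := 0) (by linear_combination d3)
  omega

end ArtinB

namespace ArtinB

variable {n : ℕ} {Φ : ArtinB n →* ArtinB n}

theorem not_isCoprime_mul_self (hn : 2 ≤ n) (a : ℤ) : ¬ IsCoprime (n * a) (n : ℤ) := by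
  intro h
  have := Int.isUnit_iff.mp (isCoprime_self.mp h.of_mul_left_left)
  omega

theorem beta_map_gen_one_of_cv_eq_zero (hsg : ∀ g, sg n (Φ g) = sg n g) (hn : 4 ≤ n)
    (h13 : cv (Φ (gen n 1 ^ 2)) 1 3 = 0) (h34 : cv (Φ (gen n 1 ^ 2)) 3 4 = 0) :
    beta (Φ (gen n 1)) = cv (Φ (gen n 1 ^ 2)) 1 2 := by
  have hs : ∀ a b, cv (Φ (gen n 1 ^ 2)) a b = cv (Φ (gen n 1 ^ 2)) b a :=
    cv_comm (by rw [hsg, sg_gen_sq le_rfl (by omega)])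
  have hz : ∀ a b, 1 ≤ a → 3 ≤ b → a < b → b ≤ n → cv (Φ (gen n 1 ^ 2)) a b = 0 := by
    intro a b h1 h3 hab hb
    rcases lt_or_ge a 3 with ha | ha
    · rw [cv_map_gen_one_sq_of_lt_three hsg ha h3 hb]
      obtain rfl | rfl : a = 1 ∨ a = 2 := by omega
      · exact h13
      · rw [cv_map_gen_one_sq_two_three hsg (by omega), h13]
    · rw [cv_map_gen_one_sq_of_three_le hsg ha hab hb, h34]
  have hz' : ∀ a b, 1 ≤ a → 1 ≤ b → 3 ≤ a ∨ 3 ≤ b → a ≤ n → b ≤ n →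
      cv (Φ (gen n 1 ^ 2)) a b = 0 := by
    intro a b h1 h2 h3 ha hb
    rcases lt_trichotomy a b with hab | rfl | hab
    · exact hz a b h1 (by omega) hab hb
    · exact cv_self _ _
    · rw [hs]
      exact hz b a h2 (by omega) hab ha
  have h := beta_eq_sum (Φ (gen n 1 ^ 2))
  have hrow : ∀ a, 1 ≤ a → a ≤ 2 → ∑ j ∈ Finset.Icc 1 n, cv (Φ (gen n 1 ^ 2)) a j =
      cv (Φ (gen n 1 ^ 2)) a 1 + cv (Φ (gen n 1 ^ 2)) a 2 := by
    intro a h1 h2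
    rw [sum_Icc_of_const (p := 2) (by omega) 0 fun j hj hjn =>
      hz' a j h1 (by omega) (by omega) (by omega) hjn, Finset.sum_Icc_succ_top (by omega)]
    simp [-map_pow]
  rw [sum_Icc_of_const (p := 2) (by omega) 0 fun i hi hin => Finset.sum_eq_zero fun j hj => by
      rw [Finset.mem_Icc] at hj
      exact hz' _ _ (by omega) (by omega) (by omega) (by omega) (by omega),
    Finset.sum_Icc_succ_top (by omega), Finset.Icc_self, Finset.sum_singleton,
    hrow 1 le_rfl (by omega), hrow (1 + 1) (by omega) le_rfl] at h
  norm_num [cv_self, -map_pow, hs 2 1] at h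
  rw [map_pow, beta_pow, ← map_pow] at h
  push_cast at h
  linarith

theorem Good.cexp_of_delta_eq_zero (hsg : ∀ g, sg n (Φ g) = sg n g) (h : Good Φ) (hn : 5 ≤ n)
    (h0 : delta (Φ (gen n 1)) = 0) : (n : ℤ) ∣ cexp Φ - 1 ∨ (n : ℤ) ∣ cexp Φ + 1 := by
  obtain ⟨e, he, hb⟩ := h.beta_gen_one (by omega)
  obtain ⟨hb3, hw⟩ := cv_map_of_five_le hsg hn
  have hd := two_mul_delta_map_gen_one hsg (by omega)
  have hcop := h.isCoprime (by omega)
  have hk : cexp Φ = cv (Φ (gen n 0)) 0 1 + (n - 1) * cv (Φ (gen n 0)) 0 2 := by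
    rw [cexp, h0, mul_zero, add_zero, delta_map_gen_zero hsg (by omega)]
  have hlm : cv (Φ (gen n 0)) 0 1 ≠ cv (Φ (gen n 0)) 0 2 := by
    intro hlm
    refine not_isCoprime_mul_self (by omega : 2 ≤ n) (cv (Φ (gen n 0)) 0 2) ?_
    convert hcop using 1
    rw [hk, hlm]; ring
  have hb0 : cv (Φ (gen n 1 ^ 2)) 0 3 = 0 := by
    rw [hb3, h0] at hd
    have : (n : ℤ) * cv (Φ (gen n 1 ^ 2)) 0 3 = 0 := by linarith
    exact (mul_eq_zero.mp this).resolve_left (by omega)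
  have hc : Commute (gen n 0) (gen n 2 ^ 2) := (gen_comm (by omega)).pow_right 2
  have h2 := sg_gen_sq (n := n) (i := 2) (by omega) (by omega)
  have d1 := det_map_of_commute hsg sg_gen_zero h2 hc 0 1 2
  have d2 := det_map_of_commute hsg sg_gen_zero (sg_bar (by omega)) commute_gen_zero_bar 0 1 2
  have d3 := det_map_of_commute hsg sg_gen_zero (sg_bar (by omega)) commute_gen_zero_bar 0 1 3
  have d5 := det_map_of_commute hsg sg_gen_zero (sg_bar (by omega)) commute_gen_zero_bar 1 2 3
  have x03 := cv_map_gen_zero_of_lt_two hsg (a := 0) (j := 3) (by omega) (by omega) (by omega)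
  have x13 := cv_map_gen_zero_of_lt_two hsg (a := 1) (j := 3) (by omega) (by omega) (by omega)
  have y02 := cv_map_gen_one_sq_zero_two hsg (by omega)
  have y23 := cv_map_gen_one_sq_two_three hsg (by omega)
  have y31 := cv_comm (g := Φ (gen n 1 ^ 2)) (by rw [hsg, sg_gen_sq le_rfl (by omega)]) 3 1
  have x21 := cv_comm (g := Φ (gen n 0)) (by rw [hsg, sg_gen_zero]) 2 1
  simp only [cv_map_gen_succ_sq hsg (i := 1) le_rfl (by omega : 1 + 1 < n),
    cv_map_bar hsg (by omega : 2 ≤ n), Equiv.swap_apply_def] at d1 d2 d3 d5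
  norm_num [-map_pow] at d1 d2 d3 d5
  simp only [x03, x13, y02, y23, y31, x21, hb3, hb0] at d1 d2 d3 d5
  have hlm' := sub_ne_zero.mpr hlm
  have hk0 := mul_left_cancel₀ hlm' (b := cv (Φ (gen n 1 ^ 2)) 1 3) (c := 0) (by
    linear_combination - d1)
  rw [hk0] at hw d3 d5
  have ha : cv (Φ (gen n 1 ^ 2)) 1 2 = e := by
    rw [← beta_map_gen_one_of_cv_eq_zero hsg (by omega) hk0 hw, hb, h0, mul_zero, add_zero]
  rw [ha] at d2 d5
  have h4 := mul_left_cancel₀ hlm' (b := cv (Φ (gen n 0)) 0 1 + cv (Φ (gen n 0)) 0 2 -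
    2 * cv (Φ (gen n 0)) 1 2 - e) (c := 0) (by linear_combination d2)
  have h5 := mul_left_cancel₀ hlm' (b := cv (Φ (gen n 0)) 0 2 - cv (Φ (gen n 0)) 2 3) (c := 0) (by
    linear_combination d3)
  have h6 : (cv (Φ (gen n 0)) 2 3 - cv (Φ (gen n 0)) 1 2) *
      (cv (Φ (gen n 0)) 1 2 + e - cv (Φ (gen n 0)) 2 3) = 0 := by linear_combination d5
  have key : (n : ℤ) ∣ cexp Φ - e ∨ (n : ℤ) ∣ cexp Φ + e := by
    rw [hk]
    rcases mul_eq_zero.mp h6 with h6 | h6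
    · exact Or.inl ⟨cv (Φ (gen n 0)) 1 2, by linear_combination h4 + (n - 2) * (h5 + h6)⟩
    · exact Or.inr ⟨cv (Φ (gen n 0)) 1 2 + e, by linear_combination h4 + (n - 2) * (h5 - h6)⟩
  rcases he with rfl | rfl
  · exact key
  · simpa [or_comm, sub_eq_add_neg] using key

theorem Good.arith_of_sg_of_five_le (hsg : ∀ g, sg n (Φ g) = sg n g) (h : Good Φ) (hn : 5 ≤ n) :
    (n : ℤ) ∣ delta (Φ (gen n 1)) ∧ ((n : ℤ) ∣ cexp Φ - 1 ∨ (n : ℤ) ∣ cexp Φ + 1) := by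
  have hm : (n : ℤ) ∣ delta (Φ (gen n 1)) := by
    obtain ⟨c, hc⟩ := two_dvd_cv_map_gen_one_sq hsg (by omega)
    have hd := two_mul_delta_map_gen_one hsg (by omega)
    rw [(cv_map_of_five_le hsg hn).1, hc] at hd
    exact ⟨c, by linarith⟩
  refine ⟨hm, ?_⟩
  obtain ⟨y, hy⟩ := hm
  have hz : sg n (artinBTwist n) = 1 := sg_of_central commute_artinBTwist
  have key := Good.cexp_of_delta_eq_zero (Φ := ArtinB.twist Φ 0 (-y)) (fun g => by
    rw [twist_apply, map_mul, map_zpow, hz, one_zpow, mul_one, hsg]) (h.twist _ _) hn (by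
    rw [twist_apply, delta_mul, delta_zpow, delta_artinBTwist, beta_gen le_rfl (by omega), hy]
    ring)
  have hcx : cexp (ArtinB.twist Φ 0 (-y)) = cexp Φ - (n - 1) * y * n := by
    rw [cexp, cexp, twist_apply, twist_apply, delta_mul, delta_mul, delta_zpow, delta_zpow,
      delta_artinBTwist, beta_gen le_rfl (by omega), beta_gen_zero]
    ring
  rw [hcx] at key
  refine key.imp (fun hk => ?_) fun hk => ?_
  · exact (Int.dvd_iff_dvd_of_dvd_sub (a := (n : ℤ)) ⟨(n - 1) * y, by ring⟩).mpr hk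
  · exact (Int.dvd_iff_dvd_of_dvd_sub (a := (n : ℤ)) ⟨(n - 1) * y, by ring⟩).mpr hk

end ArtinB

namespace ArtinB

theorem dvd_delta_four {Φ : ArtinB 4 →* ArtinB 4} (hsg : ∀ g, sg 4 (Φ g) = sg 4 g) (h : Good Φ) :
    (4 : ℤ) ∣ delta (Φ (gen 4 1)) := by
  obtain ⟨e, he, hb⟩ := h.beta_gen_one (by omega)
  have hd := two_mul_delta_map_gen_one hsg (by omega)
  obtain ⟨c, hc⟩ := two_dvd_cv_map_gen_one_sq hsg (by omega)
  have hcop := h.isCoprime (by omega)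
  rw [cexp, delta_map_gen_zero hsg (by omega)] at hcop
  have h1 := sg_gen_sq (n := 4) (i := 1) le_rfl (by omega)
  have h3 := sg_gen_sq (n := 4) (i := 3) (by omega) (by omega)
  have hc1 : Commute (gen 4 1 ^ 2) (gen 4 3 ^ 2) := Commute.pow_pow (gen_comm (by omega)) 2 2
  have hc0 : Commute (gen 4 0) (gen 4 3 ^ 2) := (gen_comm (by omega)).pow_right 2
  have d1 := det_map_of_commute hsg h1 h3 hc1 0 1 3
  have d2 := det_map_of_commute hsg sg_gen_zero h3 hc0 0 1 2
  have d3 := det_map_of_commute hsg sg_gen_zero h3 hc0 0 1 3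
  have d4 := det_map_of_commute hsg sg_gen_zero (sg_bar (by omega)) commute_gen_zero_bar 0 1 2
  have d5 := det_map_of_commute hsg sg_gen_zero (sg_bar (by omega)) commute_gen_zero_bar 0 1 3
  have x03 := cv_map_gen_zero_of_lt_two hsg (a := 0) (j := 3) (by omega) (by omega) (by omega)
  have x13 := cv_map_gen_zero_of_lt_two hsg (a := 1) (j := 3) (by omega) (by omega) (by omega)
  have y02 := cv_map_gen_one_sq_zero_two hsg (by omega)
  have y23 := cv_map_gen_one_sq_two_three hsg (by omega)
  have y04 := cv_map_gen_one_sq_of_lt_three hsg (a := 0) (j := 4) (by omega) (by omega) (by omega)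
  have y14 := cv_map_gen_one_sq_of_lt_three hsg (a := 1) (j := 4) (by omega) (by omega) (by omega)
  have y24 := cv_map_gen_one_sq_of_lt_three hsg (a := 2) (j := 4) (by omega) (by omega) (by omega)
  have ys := cv_comm (g := Φ (gen 4 1 ^ 2)) (by rw [hsg, h1])
  have y21 := ys 2 1
  have y31 := ys 3 1
  have y41 := ys 4 1
  have y32 := ys 3 2
  have y42 := ys 4 2
  have y43 := ys 4 3
  have x21 := cv_comm (g := Φ (gen 4 0)) (by rw [hsg, sg_gen_zero]) 2 1
  have hs := beta_eq_sum (Φ (gen 4 1 ^ 2))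
  rw [map_pow, beta_pow, hb, ← map_pow] at hs
  simp only [cv_map_gen_succ_sq hsg (i := 2) (by omega) (by omega : 2 + 1 < 4),
    cv_map_gen_succ_sq hsg (i := 1) le_rfl (by omega : 1 + 1 < 4),
    cv_map_bar hsg (by omega : 2 ≤ 4), Equiv.swap_apply_def] at d1 d2 d3 d4 d5
  norm_num [-map_pow, Finset.sum_Icc_succ_top, cv_self] at d1 d2 d3 d4 d5 hs hd hcop
  simp only [x03, x13, y02, y14, y24, y23, y04, y31, y32, y41, y42, y43, y21, x21]
    at d1 d2 d3 d4 d5 hs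
  by_contra hdvd
  have hne := sub_ne_zero.mpr (show cv (Φ (gen 4 1 ^ 2)) 0 1 ≠ cv (Φ (gen 4 1 ^ 2)) 0 3 by
    intro heq; omega)
  have e1 := mul_left_cancel₀ hne (b := cv (Φ (gen 4 1 ^ 2)) 0 1 + cv (Φ (gen 4 1 ^ 2)) 0 3 -
    2 * cv (Φ (gen 4 1 ^ 2)) 1 3) (c := 0) (by linear_combination d1)
  have hlm := sub_ne_zero.mpr (show cv (Φ (gen 4 0)) 0 1 ≠ cv (Φ (gen 4 0)) 0 2 by
    intro heq
    obtain ⟨u, v, huv⟩ := hcop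
    have h5 : delta (Φ (gen 4 1)) = 2 * cv (Φ (gen 4 1 ^ 2)) 1 3 := by linarith
    rw [heq, h5] at huv
    have : 2 * (u * (2 * cv (Φ (gen 4 0)) 0 2 + 3 * cv (Φ (gen 4 1 ^ 2)) 1 3) + v * 2) = 1 := by
      linear_combination huv
    omega)
  have e2 := mul_left_cancel₀ hlm (b := cv (Φ (gen 4 1 ^ 2)) 0 3 - cv (Φ (gen 4 1 ^ 2)) 3 4)
    (c := 0) (by linear_combination d2)
  have e3 := mul_left_cancel₀ hne (b := cv (Φ (gen 4 0)) 0 1 + cv (Φ (gen 4 0)) 0 2 -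
    2 * cv (Φ (gen 4 0)) 1 2) (c := 0) (by
      linear_combination 2 * d3 + (cv (Φ (gen 4 0)) 0 2 - cv (Φ (gen 4 0)) 0 1) * e1)
  have e4 := mul_left_cancel₀ hlm (b := cv (Φ (gen 4 0)) 0 1 + cv (Φ (gen 4 0)) 0 2 +
    cv (Φ (gen 4 1 ^ 2)) 0 1 - cv (Φ (gen 4 1 ^ 2)) 1 2 - 2 * cv (Φ (gen 4 0)) 1 2)
    (c := 0) (by linear_combination d4)
  omega

/-- The arithmetic constraints on an endomorphism compatible with the permutation action. -/
theorem Good.arith_of_sg {n : ℕ} {Φ : ArtinB n →* ArtinB n} (hsg : ∀ g, sg n (Φ g) = sg n g)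
    (h : Good Φ) (hn : 3 ≤ n) :
    (n : ℤ) ∣ delta (Φ (gen n 1)) ∧ ((n : ℤ) ∣ cexp Φ - 1 ∨ (n : ℤ) ∣ cexp Φ + 1) := by
  rcases le_or_gt 5 n with h5 | h5
  · exact h.arith_of_sg_of_five_le hsg h5
  have hcop := h.isCoprime (by omega)
  obtain rfl | rfl : n = 3 ∨ n = 4 := by omega
  · refine ⟨dvd_delta_three hsg h, ?_⟩
    have : ¬ (3 : ℤ) ∣ cexp Φ := fun hd => by
      have := hcop.of_isCoprime_of_dvd_left hd
      exact absurd (Int.isUnit_iff.mp (isCoprime_self.mp this)) (by omega)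
    push_cast
    omega
  · refine ⟨dvd_delta_four hsg h, ?_⟩
    have : ¬ (2 : ℤ) ∣ cexp Φ := fun hd => by
      have := (hcop.of_isCoprime_of_dvd_left hd).of_isCoprime_of_dvd_right (show (2 : ℤ) ∣ ((4 : ℕ) : ℤ) by norm_num)
      exact absurd (Int.isUnit_iff.mp (isCoprime_self.mp this)) (by omega)
    push_cast
    omega

end ArtinB

namespace ArtinB

/-! ### Braid tuples of permutations -/

/-- The first `N` entries of `y` satisfy the braid relations of type `A`. -/
structure IsBraid {G : Type*} [Group G] (N : ℕ) (y : ℕ → G) : Prop where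
  braid : ∀ i, i + 1 < N → y i * y (i + 1) * y i = y (i + 1) * y i * y (i + 1)
  comm : ∀ i j, i + 2 ≤ j → j < N → Commute (y i) (y j)

theorem eq_of_braid_of_commute {G : Type*} [Group G] {a b : G} (h : a * b * a = b * a * b)
    (hc : Commute a b) : a = b := by
  rw [hc.eq, mul_right_inj] at h
  exact h

namespace IsBraid

variable {G H : Type*} [Group G] [Group H] {N : ℕ} {y : ℕ → G}

theorem map (h : IsBraid N y) (f : G →* H) : IsBraid N fun i => f (y i) where
  braid i hi := by simp only [← map_mul, h.braid i hi]
  comm i j hij hj := (h.comm i j hij hj).map f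

theorem shift (h : IsBraid N y) (k : ℕ) : IsBraid (N - k) fun i => y (i + k) where
  braid i hi := by
    have := h.braid (i + k) (by omega)
    rwa [show i + k + 1 = i + 1 + k by omega] at this
  comm i j hij hj := h.comm _ _ (by omega) (by omega)

theorem exists_lift (h : IsBraid N y) (K : Subgroup G) (hK : ∀ i < N, y i ∈ K) :
    ∃ w : ℕ → K, IsBraid N w ∧ ∀ i < N, (w i : G) = y i := by
  classical
  refine ⟨fun i => if hi : i < N then ⟨y i, hK i hi⟩ else 1, ⟨fun i hi => ?_, fun i j hij hj => ?_⟩,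
    fun i hi => by simp [hi]⟩
  · have h1 : i < N := by omega
    ext
    simpa [hi, h1] using h.braid i hi
  · have h1 : i < N := by omega
    ext
    simpa [hj, h1] using (h.comm i j hij hj).eq

theorem eq_of_eq (h : IsBraid N y) {i : ℕ} (hi : i + 1 < N) (he : y i = y (i + 1)) :
    ∀ j < N, y j = y i := by
  have up : ∀ k, k + 2 < N → y k = y (k + 1) → y (k + 1) = y (k + 2) := fun k hk e =>
    eq_of_braid_of_commute (h.braid (k + 1) (by omega)) (e ▸ h.comm k (k + 2) le_rfl hk)
  have down : ∀ k, k + 2 < N → y (k + 1) = y (k + 2) → y k = y (k + 1) := fun k hk e =>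
    eq_of_braid_of_commute (h.braid k (by omega)) (e ▸ h.comm k (k + 2) le_rfl hk)
  have all : ∀ k, k + 1 < N → y 0 = y 1 → y k = y (k + 1) := by
    intro k
    induction k with
    | zero => exact fun _ h => h
    | succ k ih => exact fun hk h0 => up k hk (ih (by omega) h0)
  have zero : ∀ k, k + 1 < N → y k = y (k + 1) → y 0 = y 1 := by
    intro k
    induction k with
    | zero => exact fun _ h => h
    | succ k ih => exact fun hk h0 => ih (by omega) (down k hk h0)
  have h0 := zero i hi he
  have hj : ∀ j < N, y j = y 0 := by
    intro j
    induction j with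
    | zero => exact fun _ => rfl
    | succ j ih => exact fun hj => (all j hj h0).symm.trans (ih (by omega))
  exact fun j hjN => (hj j hjN).trans (hj i (by omega)).symm

theorem ne_of_ne (h : IsBraid N y) (hN : 4 ≤ N) (h01 : y 0 ≠ y 1) {i j : ℕ} (hij : i < j)
    (hj : j < N) : y i ≠ y j := by
  have adj : ∀ k, k + 1 < N → y k ≠ y (k + 1) := fun k hk e =>
    h01 ((h.eq_of_eq hk e 0 (by omega)).trans (h.eq_of_eq hk e 1 (by omega)).symm)
  intro e
  rcases (show i + 1 ≤ j from hij).eq_or_lt with rfl | hij'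
  · exact adj i hj e
  · by_cases h1 : j + 1 < N
    · exact adj j h1 (eq_of_braid_of_commute (h.braid j h1) (e ▸ h.comm i (j + 1) (by omega) h1))
    · by_cases h2 : i = 0
      · subst h2
        exact adj 0 (by omega) (eq_of_braid_of_commute (h.braid 0 (by omega))
          (e ▸ h.comm 1 j (by omega) hj).symm)
      · obtain ⟨i, rfl⟩ := Nat.exists_eq_succ_of_ne_zero h2
        exact adj i (by omega) (eq_of_braid_of_commute (h.braid i (by omega))
          (e ▸ h.comm i j (by omega) hj))

end IsBraid

section Perm

open Equiv

variable {α : Type} {x : Perm α}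

theorem commute_of_sameCycle {p q : Perm α} (hp : Commute x p) (hq : Commute x q)
    (hps : ∀ a, x.SameCycle a (p a)) (hqs : ∀ a, x.SameCycle a (q a)) : Commute p q := by
  refine Equiv.ext fun a => ?_
  obtain ⟨i, hi⟩ := hps a
  obtain ⟨j, hj⟩ := hqs a
  have h1 : p (q a) = (x ^ j) (p a) := by
    rw [← hj, ← Perm.mul_apply, ← Perm.mul_apply, (hp.zpow_left j).eq]
  have h2 : q (p a) = (x ^ i) (q a) := by
    rw [← hi, ← Perm.mul_apply, ← Perm.mul_apply, (hq.zpow_left i).eq]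
  rw [Perm.mul_apply, Perm.mul_apply, h1, h2, ← hi, ← hj, ← Perm.mul_apply, ← Perm.mul_apply,
    ← zpow_add, ← zpow_add, add_comm]

/-- The centralizer of `x`. -/
abbrev Cent (x : Perm α) : Subgroup (Perm α) := Subgroup.centralizer {x}

theorem commute_cent (c : Cent x) : Commute x (c : Perm α) :=
  Subgroup.mem_centralizer_singleton_iff.mp c.2 |>.symm

theorem mem_cent {g : Perm α} : g ∈ Cent x ↔ Commute x g :=
  Subgroup.mem_centralizer_singleton_iff.trans ⟨Eq.symm, Eq.symm⟩

/-- The set of cycles of `x`, including the trivial ones. -/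
abbrev Cyc (x : Perm α) : Type := Quotient (Perm.SameCycle.setoid x)

theorem sameCycle_apply_of_commute {c : Perm α} (hc : Commute x c) {a b : α}
    (h : x.SameCycle a b) : x.SameCycle (c a) (c b) := by
  obtain ⟨i, rfl⟩ := h
  exact ⟨i, by rw [← Perm.mul_apply, ← Perm.mul_apply, (hc.zpow_left i).eq]⟩

/-- The action of the centralizer of `x` on the cycles of `x`. -/
def cycHom (x : Perm α) : Cent x →* Perm (Cyc x) where
  toFun c := Quotient.congr (c : Perm α) fun a b =>
    ⟨sameCycle_apply_of_commute (commute_cent c), fun h => by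
      have := sameCycle_apply_of_commute (commute_cent c⁻¹) h
      exact (show x.SameCycle a b by simpa using this)⟩
  map_one' := by
    ext q
    induction q using Quotient.inductionOn
    rfl
  map_mul' c d := by
    ext q
    induction q using Quotient.inductionOn
    rfl

theorem cycHom_mk (c : Cent x) (a : α) :
    cycHom x c (Quotient.mk _ a) = Quotient.mk _ ((c : Perm α) a) := rfl

theorem sameCycle_of_cycHom_eq_one {c : Cent x} (h : cycHom x c = 1) (a : α) :
    x.SameCycle a ((c : Perm α) a) := by
  have := DFunLike.congr_fun h (Quotient.mk _ a)
  rw [cycHom_mk] at this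
  exact (Quotient.exact this).symm

theorem commute_of_cycHom_eq_one {c d : Cent x} (hc : cycHom x c = 1) (hd : cycHom x d = 1) :
    Commute c d :=
  Subtype.ext (commute_of_sameCycle (commute_cent c) (commute_cent d) (sameCycle_of_cycHom_eq_one hc)
    (sameCycle_of_cycHom_eq_one hd))

theorem eq_of_cycHom_eq {z : ℕ → Cent x} (hz : IsBraid 3 z) (h1 : cycHom x (z 1) = cycHom x (z 0))
    (h2 : cycHom x (z 2) = cycHom x (z 0)) : z 2 = z 0 := by
  have hc := commute_of_cycHom_eq_one (c := z 1 * (z 0)⁻¹) (d := z 2 * (z 0)⁻¹)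
    (by rw [map_mul, map_inv, h1, mul_inv_cancel]) (by rw [map_mul, map_inv, h2, mul_inv_cancel])
  have h02 := hz.comm 0 2 le_rfl (by omega)
  have hq0 : Commute (z 2 * (z 0)⁻¹) (z 0) := h02.symm.mul_left (Commute.refl _).inv_left
  have hq1 : Commute (z 2 * (z 0)⁻¹) (z 1) := by
    simpa using hc.symm.mul_right hq0
  have hb := hz.braid 1 (by omega)
  have hb0 := hz.braid 0 (by omega)
  generalize hq : z 2 * (z 0)⁻¹ = q at hq0 hq1
  have h2q : z 2 = q * z 0 := by rw [← hq]; group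
  simp only [zero_add, Nat.reduceAdd] at hb hb0
  rw [h2q] at hb
  have e1 : z 1 * (q * z 0) * z 1 = q * (z 1 * z 0 * z 1) := by
    rw [← mul_assoc, ← hq1.eq]; group
  have e2 : q * z 0 * z 1 * (q * z 0) = q * (q * (z 0 * z 1 * z 0)) := by
    have : z 0 * z 1 * q = q * (z 0 * z 1) := by
      rw [mul_assoc, ← hq1.eq, ← mul_assoc, ← hq0.eq, mul_assoc]
    calc q * z 0 * z 1 * (q * z 0) = q * (z 0 * z 1 * q) * z 0 := by group
      _ = _ := by rw [this]; group
  rw [e1, e2, mul_right_inj, ← hb0] at hb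
  have : q = 1 := by simpa using hb
  rw [h2q, this, one_mul]

end Perm

end ArtinB

namespace ArtinB

open Equiv

variable {α : Type} {x : Perm α}

theorem three_le_card [Finite α] {a b c : α} (hab : a ≠ b) (hac : a ≠ c) (hbc : b ≠ c) :
    3 ≤ Nat.card α := by
  classical
  have := Fintype.ofFinite α
  rw [Nat.card_eq_fintype_card, ← Finset.card_eq_three.mpr ⟨a, b, c, hab, hac, hbc, rfl⟩]
  exact Finset.card_le_univ _

theorem mul_self_of_card_le_two [Finite α] (h : Nat.card α ≤ 2) (g : Perm α) : g * g = 1 := by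
  ext a
  by_contra hne
  have h1 : g (g a) ≠ a := hne
  have h2 : g a ≠ a := fun e => h1 (by rw [e, e])
  have h3 : g (g a) ≠ g a := fun e => h2 (g.injective e)
  have := three_le_card h2.symm h1.symm h3.symm
  omega

theorem commute_of_card_le_two [Finite α] (h : Nat.card α ≤ 2) (g k : Perm α) : Commute g k := by
  have e := fun g : Perm α => inv_eq_of_mul_eq_one_left (mul_self_of_card_le_two h g)
  have := mul_inv_rev g k
  rwa [e, e, e] at this

theorem three_le_card_of_braid [Finite α] {g k : Perm α} (h : g * k * g = k * g * k)
    (hne : g ≠ k) : 3 ≤ Nat.card α := by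
  by_contra hc
  exact hne (eq_of_braid_of_commute h (commute_of_card_le_two (by omega) g k))

theorem exists_of_braid_fin_three : ∀ g k : Perm (Fin 3), g * k * g = k * g * k → g ≠ k →
    ∀ a b, g a = b ∨ k a = b ∨ g (k a) = b ∨ k (g a) = b ∨ a = b := by
  decide

theorem commute_of_pow_three_fin_three : ∀ g k : Perm (Fin 3), g ^ 3 = 1 → k ^ 3 = 1 →
    g * k = k * g := by
  decide

theorem eq_of_braid_of_card_eq_three [Finite α] (h3 : Nat.card α = 3) {g k : Perm α}
    (h : g * k * g = k * g * k) (hne : g ≠ k) {X : Type*} (f : α → X) (hg : ∀ a, f (g a) = f a)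
    (hk : ∀ a, f (k a) = f a) (a b : α) : f a = f b := by
  have e : α ≃ Fin 3 := Finite.equivFinOfCardEq h3
  have := exists_of_braid_fin_three (e.permCongrHom g) (e.permCongrHom k)
    (by simp only [← map_mul, h]) (fun h' => hne (e.permCongrHom.injective h')) (e a) (e b)
  simp at this
  rcases this with h | h | h | h | h <;> rw [← h] <;> simp [hg, hk]

theorem commute_of_pow_three [Finite α] (h3 : Nat.card α = 3) {g k : Perm α}
    (hg : g ^ 3 = 1) (hk : k ^ 3 = 1) : Commute g k := by
  have e : α ≃ Fin 3 := Finite.equivFinOfCardEq h3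
  have := commute_of_pow_three_fin_three (e.permCongrHom g) (e.permCongrHom k)
    (by rw [← map_pow, hg, map_one]) (by rw [← map_pow, hk, map_one])
  rw [← map_mul, ← map_mul] at this
  exact e.permCongrHom.injective this

theorem mk_ite_out (b : Bool) (p : Cyc x) :
    (Quotient.mk _ (if b then x p.out else p.out) : Cyc x) = p := by
  cases b
  · exact p.out_eq
  · exact (Quotient.sound (Perm.sameCycle_apply_left.mpr (Perm.SameCycle.refl _ _))).trans p.out_eq

theorem injective_out_cyc (hx : ∀ a, x a ≠ a) :
    Function.Injective fun p : Bool × Cyc x => if p.1 then x p.2.out else p.2.out := by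
  rintro ⟨b, p⟩ ⟨b', q⟩ h
  have hpq : p = q := by
    have := congrArg (Quotient.mk (Perm.SameCycle.setoid x)) h
    rwa [mk_ite_out, mk_ite_out] at this
  subst hpq
  cases b <;> cases b' <;> simp_all
  exact absurd h.symm (hx _)

theorem two_mul_card_cyc_le [Finite α] (hx : ∀ a, x a ≠ a) :
    2 * Nat.card (Cyc x) ≤ Nat.card α := by
  have := Nat.card_le_card_of_injective _ (injective_out_cyc hx)
  rwa [Nat.card_prod, Nat.card_eq_fintype_card, Fintype.card_bool] at this

theorem apply_apply_of_card_cyc [Finite α] (hx : ∀ a, x a ≠ a)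
    (hc : Nat.card α = 2 * Nat.card (Cyc x)) (a : α) : x (x a) = a := by
  have hbij := (Nat.bijective_iff_injective_and_card _).mpr ⟨injective_out_cyc hx, by
    rw [hc, Nat.card_prod, Nat.card_eq_fintype_card (α := Bool), Fintype.card_bool]⟩
  have key : ∀ q : Cyc x, x (x q.out) = q.out := by
    intro q
    obtain ⟨⟨b, p⟩, hp⟩ := hbij.2 (x (x q.out))
    have hpq : p = q := by
      have h1 := congrArg (Quotient.mk (Perm.SameCycle.setoid x)) hp
      have h2 : (Quotient.mk (Perm.SameCycle.setoid x) (x (x q.out))) = q :=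
        (Quotient.sound (Perm.sameCycle_apply_left.mpr
          (Perm.sameCycle_apply_left.mpr (Perm.SameCycle.refl _ _)))).trans q.out_eq
      exact (mk_ite_out b p).symm.trans (h1.trans h2)
    subst hpq
    cases b
    · exact hp.symm
    · exact absurd (x.injective hp).symm (hx _)
  obtain ⟨⟨b, q⟩, rfl⟩ := hbij.2 a
  cases b
  · exact key q
  · exact congrArg x (key q)

/-- The action of the centralizer of `x` on the points moved by `x`. -/
def moveHom (x : Perm α) : Cent x →* Perm {a // x a ≠ a} where
  toFun c := (c : Perm α).subtypePerm fun a => by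
    have : x ((c : Perm α) a) = (c : Perm α) (x a) := DFunLike.congr_fun (commute_cent c) a
    rw [this, (c : Perm α).injective.ne_iff]
  map_one' := rfl
  map_mul' _ _ := rfl

/-- The action of the centralizer of `x` on the points fixed by `x`. -/
def fixHom (x : Perm α) : Cent x →* Perm {a // x a = a} where
  toFun c := (c : Perm α).subtypePerm fun a => by
    have : x ((c : Perm α) a) = (c : Perm α) (x a) := DFunLike.congr_fun (commute_cent c) a
    rw [this, (c : Perm α).injective.eq_iff]
  map_one' := rfl
  map_mul' _ _ := rfl

theorem card_move_add_card_fix [Finite α] (x : Perm α) :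
    Nat.card {a // x a ≠ a} + Nat.card {a // x a = a} = Nat.card α := by
  classical
  rw [add_comm, ← Nat.card_sum]
  exact Nat.card_congr (Equiv.sumCompl fun a => x a = a)

theorem eq_of_moveHom_of_fixHom {c d : Cent x} (hm : moveHom x c = moveHom x d)
    (hf : fixHom x c = fixHom x d) : c = d := by
  refine Subtype.ext (Equiv.ext fun a => ?_)
  by_cases ha : x a = a
  · exact congrArg Subtype.val (DFunLike.congr_fun hf ⟨a, ha⟩)
  · exact congrArg Subtype.val (DFunLike.congr_fun hm ⟨a, ha⟩)

theorem self_mem_cent (x : Perm α) : x ∈ Cent x := mem_cent.mpr (Commute.refl x)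

theorem moveHom_self_ne (x : Perm α) (a : {a // x a ≠ a}) :
    moveHom x ⟨x, self_mem_cent x⟩ a ≠ a := fun h => a.2 (congrArg Subtype.val h)

theorem commute_moveHom_self (c : Cent x) :
    Commute (moveHom x ⟨x, self_mem_cent x⟩) (moveHom x c) :=
  Commute.map (Subtype.ext (commute_cent c) : Commute (⟨x, self_mem_cent x⟩ : Cent x) c) _

end ArtinB

namespace ArtinB

open Equiv

variable {α : Type} {x : Perm α}

theorem IsBraid.mono {G : Type*} [Group G] {N N' : ℕ} {y : ℕ → G} (h : IsBraid N y)
    (hN : N' ≤ N) : IsBraid N' y :=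
  ⟨fun i hi => h.braid i (by omega), fun i j hij hj => h.comm i j hij (by omega)⟩

theorem eq_of_braid_of_card_le_five [Finite α] (h5 : Nat.card α ≤ 5) (hx : ∀ a, x a ≠ a)
    {z w : Cent x} (h : z * w * z = w * z * w) : z = w := by
  have hQ : Nat.card (Cyc x) ≤ 2 := by
    have := two_mul_card_cyc_le hx
    omega
  have hzz : cycHom x (z * z) = 1 := by rw [map_mul, mul_self_of_card_le_two hQ]
  have hww : cycHom x (w * w) = 1 := by rw [map_mul, mul_self_of_card_le_two hQ]
  have hqzw : cycHom x z = cycHom x w := by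
    by_contra hne
    have := three_le_card_of_braid (by rw [← map_mul, ← map_mul, h, map_mul, map_mul]) hne
    omega
  have hzw : cycHom x (z * w) = 1 := by rw [map_mul, hqzw, mul_self_of_card_le_two hQ]
  have huq : cycHom x (z * w⁻¹) = 1 := by rw [map_mul, map_inv, hqzw, mul_inv_cancel]
  have c1 : Commute w (z * z) := by
    have := (commute_of_cycHom_eq_one hzw hzz).eq
    have h' : z * (w * (z * z)) = z * (z * z * w) := by simpa only [mul_assoc] using this
    exact mul_left_cancel h'
  have c2 : Commute z (w * w) := by
    have := (commute_of_cycHom_eq_one hzw hww).eq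
    have h' : z * (w * w) * w = w * w * z * w := by simpa only [mul_assoc] using this
    exact mul_right_cancel h'
  have hu : w * (z * w⁻¹) * w⁻¹ = (z * w⁻¹) * (z * w⁻¹) := by
    have e1 : z * w * z = z * w⁻¹ * (z * w⁻¹) * (w * w * w) := by
      have : z * w⁻¹ * (z * w⁻¹) * (w * w * w) = z * w⁻¹ * (z * (w * w)) := by group
      rw [this, c2.eq]; group
    have e2 : w * z * w = w * (z * w⁻¹) * w⁻¹ * (w * w * w) := by group
    rw [e1, e2] at h
    exact (mul_right_cancel h).symm
  by_contra hne
  set u := z * w⁻¹ with hudef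
  have hu1 : u ≠ 1 := fun e => hne (mul_inv_eq_one.mp e)
  have hw2 : Commute (w * w) u := (c2.symm).mul_right (((Commute.refl w).mul_left
    (Commute.refl w)).inv_right)
  have hu3 : u * u * u = 1 := by
    have e1 : w * w * u * (w * w)⁻¹ = u * u * (u * u) := by
      calc w * w * u * (w * w)⁻¹ = w * (w * u * w⁻¹) * w⁻¹ := by group
        _ = w * (u * u) * w⁻¹ := by rw [hu]
        _ = (w * u * w⁻¹) * (w * u * w⁻¹) := by group
        _ = _ := by rw [hu]
    rw [hw2.eq, mul_inv_cancel_right] at e1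
    have : u * 1 = u * (u * u * u) := by rw [mul_one]; nth_rewrite 1 [e1]; group
    exact (mul_left_cancel this).symm
  have hxu : Commute x (u : Perm α) := commute_cent u
  obtain ⟨p, hp⟩ : ∃ p, (u : Perm α) p ≠ p := by
    by_contra! hall
    exact hu1 (Subtype.ext (Equiv.ext hall))
  have hup : ∀ q : α, (w : Perm α) ((u : Perm α) q) =
      (u : Perm α) ((u : Perm α) ((w : Perm α) q)) := by
    intro q
    have : w * u = u * u * w := by rw [← hu]; group
    exact DFunLike.congr_fun (congrArg Subtype.val this) q
  have hu3' : ∀ q : α, (u : Perm α) ((u : Perm α) ((u : Perm α) q)) = q := fun q =>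
    DFunLike.congr_fun (congrArg Subtype.val hu3) q
  have hsc := fun q => sameCycle_of_cycHom_eq_one huq q
  by_cases hwp : x.SameCycle p ((w : Perm α) p)
  · obtain ⟨i, hi⟩ := hwp
    obtain ⟨j, hj⟩ := hsc p
    have hxw : Commute x (w : Perm α) := commute_cent w
    have e1 : (w : Perm α) ((u : Perm α) p) = (u : Perm α) ((w : Perm α) p) := by
      rw [← hi, ← hj, ← Perm.mul_apply, ← (hxw.zpow_left j).eq, Perm.mul_apply, ← hi,
        ← Perm.mul_apply (u : Perm α), ← (hxu.zpow_left i).eq, Perm.mul_apply, ← hj,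
        ← Perm.mul_apply, ← Perm.mul_apply, ← zpow_add, ← zpow_add, add_comm]
    rw [hup] at e1
    have e2 : (u : Perm α) ((w : Perm α) p) = (w : Perm α) p := (u : Perm α).injective e1
    rw [← hi, ← Perm.mul_apply, ← (hxu.zpow_left i).eq, Perm.mul_apply] at e2
    exact hp ((x ^ i).injective e2)
  · classical
    have hin : ∀ q : α, q ∈ ({p, (u : Perm α) p, (u : Perm α) ((u : Perm α) p)} : Finset α) →
        x.SameCycle p q := by
      intro q hq
      simp only [Finset.mem_insert, Finset.mem_singleton] at hq
      rcases hq with rfl | rfl | rfl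
      · exact Perm.SameCycle.refl _ _
      · exact hsc p
      · exact (hsc p).trans (hsc _)
    have hcard : ({p, (u : Perm α) p, (u : Perm α) ((u : Perm α) p)} : Finset α).card = 3 := by
      refine Finset.card_eq_three.mpr ⟨_, _, _, hp.symm, fun e => hp ?_, fun e => hp ?_, rfl⟩
      · have := congrArg (u : Perm α) e
        rwa [hu3'] at this
      · exact ((u : Perm α).injective e).symm
    have hdisj : Disjoint ({p, (u : Perm α) p, (u : Perm α) ((u : Perm α) p)} : Finset α)
        (({p, (u : Perm α) p, (u : Perm α) ((u : Perm α) p)} : Finset α).map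
          (w : Perm α).toEmbedding) := by
      rw [Finset.disjoint_left]
      intro q hq hq'
      obtain ⟨r, hr, rfl⟩ := Finset.mem_map.mp hq'
      exact hwp ((hin _ hq).trans (sameCycle_apply_of_commute (commute_cent w) (hin r hr)).symm)
    have := Fintype.ofFinite α
    have hle := Finset.card_le_univ (({p, (u : Perm α) p, (u : Perm α) ((u : Perm α) p)} :
      Finset α) ∪ (({p, (u : Perm α) p, (u : Perm α) ((u : Perm α) p)} : Finset α).map
          (w : Perm α).toEmbedding))
    rw [Finset.card_union_of_disjoint hdisj, Finset.card_map, hcard, ← Nat.card_eq_fintype_card]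
      at hle
    omega

/-- Braid tuples of length `N` on at most `N` points are constant. -/
def BraidConst (N : ℕ) : Prop :=
  ∀ (β : Type) [Finite β], Nat.card β ≤ N → ∀ z : ℕ → Perm β, IsBraid N z → z 0 = z 1

theorem exists_lift_move {N : ℕ} {z : ℕ → Cent x} (hz : IsBraid N z) :
    ∃ w : ℕ → Cent (moveHom x ⟨x, self_mem_cent x⟩), IsBraid N w ∧
      ∀ i < N, (w i : Perm {a // x a ≠ a}) = moveHom x (z i) :=
  (hz.map (moveHom x)).exists_lift _ fun i _ => mem_cent.mpr (commute_moveHom_self (z i))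

theorem IsBraid.card_fix [Finite α] {N : ℕ} (hN : 4 ≤ N) (hW : BraidConst N)
    (hα : Nat.card α ≤ 2 * N + 1) {z : ℕ → Cent x} (hz : IsBraid N z) (hne : z 0 ≠ z 1) :
    N + 1 ≤ Nat.card {a // x a = a} := by
  by_contra hF
  have hf := hW _ (by omega) _ (hz.map (fixHom x))
  refine hne (eq_of_moveHom_of_fixHom ?_ hf)
  obtain ⟨w, hw, hwz⟩ := exists_lift_move hz
  rw [← hwz 0 (by omega), ← hwz 1 (by omega)]
  congr 1
  by_contra hw01
  have hQ := two_mul_card_cyc_le (moveHom_self_ne x)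
  have hM := card_move_add_card_fix x
  have hq := hw.map (cycHom _)
  have hq01 := hW _ (by omega) _ hq
  have hall := hq.eq_of_eq (i := 0) (by omega) hq01
  exact hw.ne_of_ne hN hw01 (i := 0) (j := 2) (by omega) (by omega)
    (eq_of_cycHom_eq (hw.mono (by omega)) (hall 1 (by omega)) (hall 2 (by omega))).symm

end ArtinB

namespace ArtinB

open Equiv

variable {α : Type} {x : Perm α} {N : ℕ} {y : ℕ → Perm α}

theorem ne_of_commute_swap [DecidableEq α] {a b c d : α} (hab : a ≠ b) (hcd : c ≠ d)
    (h : Commute (swap a b) (swap c d)) (hne : swap a b ≠ swap c d) :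
    a ≠ c ∧ a ≠ d ∧ b ≠ c ∧ b ≠ d := by
  have h' : ∀ p, swap a b (swap c d p) = swap c d (swap a b p) := fun p => DFunLike.congr_fun h p
  have key : ∀ a b c d : α, a ≠ b → c ≠ d → (∀ p, swap a b (swap c d p) = swap c d (swap a b p)) →
      swap a b ≠ swap c d → a ≠ c := by
    rintro a b c d hab hcd h hne rfl
    have hbd : b ≠ d := fun e => hne (by rw [e])
    have := h a
    rw [swap_apply_left, swap_apply_left, swap_apply_of_ne_of_ne hcd.symm hbd.symm,
      swap_apply_of_ne_of_ne hab.symm hbd] at this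
    exact hbd this.symm
  refine ⟨key a b c d hab hcd h' hne, key a b d c hab hcd.symm ?_ ?_,
    key b a c d hab.symm hcd ?_ ?_, key b a d c hab.symm hcd.symm ?_ ?_⟩ <;>
    simpa only [swap_comm b a, swap_comm d c]

theorem isSwap_conj [DecidableEq α] (h : x.IsSwap) (g : Perm α) : (g * x * g⁻¹).IsSwap := by
  obtain ⟨a, b, hab, rfl⟩ := h
  exact ⟨g a, g b, g.injective.ne hab, (Equiv.swap_apply_apply g a b).symm⟩

theorem IsBraid.conj_succ {G : Type*} [Group G] {y : ℕ → G} (h : IsBraid N y) {i : ℕ}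
    (hi : i + 1 < N) : y (i + 1) = (y i * y (i + 1)) * y i * (y i * y (i + 1))⁻¹ := by
  rw [h.braid i hi]; group

theorem IsBraid.isSwap [DecidableEq α] (h : IsBraid N y) (h0 : (y 0).IsSwap) :
    ∀ i < N, (y i).IsSwap := by
  intro i
  induction i with
  | zero => exact fun _ => h0
  | succ i ih =>
    intro hi
    rw [h.conj_succ hi]
    exact isSwap_conj (ih (by omega)) _

theorem IsBraid.pow_eq_one {G : Type*} [Group G] {y : ℕ → G} (h : IsBraid N y) {k : ℕ}
    (h0 : y 0 ^ k = 1) : ∀ i < N, y i ^ k = 1 := by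
  intro i
  induction i with
  | zero => exact fun _ => h0
  | succ i ih =>
    intro hi
    rw [h.conj_succ hi, conj_pow, ih (by omega), mul_one, mul_inv_cancel]

theorem IsBraid.ne_one {G : Type*} [Group G] {y : ℕ → G} (h : IsBraid N y) (hN : 2 ≤ N)
    (hne : y 0 ≠ y 1) : y 0 ≠ 1 := fun h0 =>
  hne (eq_of_braid_of_commute (h.braid 0 (by omega)) (h0 ▸ Commute.one_left _))

theorem two_le_card_move [Finite α] (hx : x ≠ 1) : 2 ≤ Nat.card {a // x a ≠ a} := by
  classical
  have := Fintype.ofFinite α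
  rw [Nat.card_eq_fintype_card, Fintype.card_subtype]
  exact Perm.two_le_card_support_of_ne_one hx

theorem isSwap_of_card_move [Finite α] [DecidableEq α] (h : Nat.card {a // x a ≠ a} = 2) :
    x.IsSwap := by
  have := Fintype.ofFinite α
  rw [Nat.card_eq_fintype_card, Fintype.card_subtype] at h
  exact Perm.card_support_eq_two.mp h

theorem pow_three_of_card_move [Finite α] (h : Nat.card {a // x a ≠ a} = 3) : x ^ 3 = 1 := by
  classical
  have := Fintype.ofFinite α
  rw [Nat.card_eq_fintype_card, Fintype.card_subtype] at h
  have h3 : x.IsThreeCycle := card_support_eq_three_iff.mp h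
  rw [← h3.orderOf]
  exact pow_orderOf_eq_one x

/-- The tail of a braid tuple, as a tuple in the centralizer of its first entry. -/
theorem IsBraid.exists_tail (h : IsBraid N y) (hN : 4 ≤ N) (hne : y 0 ≠ y 1) :
    ∃ w : ℕ → Cent (y 0), IsBraid (N - 2) w ∧ (∀ i < N - 2, (w i : Perm α) = y (i + 2)) ∧
      w 0 ≠ w 1 := by
  obtain ⟨w, hw, hwy⟩ := (h.shift 2).exists_lift (Cent (y 0)) fun i hi =>
    mem_cent.mpr (h.comm 0 _ (by omega) (by omega))
  refine ⟨w, hw, hwy, fun e => ?_⟩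
  have := congrArg Subtype.val e
  rw [hwy 0 (by omega), hwy 1 (by omega)] at this
  exact h.ne_of_ne hN hne (by omega) (by omega) this

theorem IsBraid.exists_fix_ne [Finite α] (h : IsBraid N y) (hN : 4 ≤ N) (hne : y 0 ≠ y 1)
    (hM : Nat.card {a // y 0 a ≠ a} ≤ 5) :
    ∃ w : ℕ → Cent (y 0), IsBraid (N - 2) w ∧ (∀ i < N - 2, (w i : Perm α) = y (i + 2)) ∧
      fixHom (y 0) (w 0) ≠ fixHom (y 0) (w 1) := by
  obtain ⟨w, hw, hwy, hw01⟩ := h.exists_tail hN hne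
  refine ⟨w, hw, hwy, fun hf => hw01 (eq_of_moveHom_of_fixHom ?_ hf)⟩
  have hb := hw.braid 0 (by omega)
  have := eq_of_braid_of_card_le_five hM (moveHom_self_ne (y 0))
    (z := ⟨_, mem_cent.mpr (commute_moveHom_self (w 0))⟩)
    (w := ⟨_, mem_cent.mpr (commute_moveHom_self (w 1))⟩)
    (Subtype.ext (by
      simp only [Subgroup.coe_mul, ← map_mul]
      exact congrArg (moveHom (y 0)) hb))
  exact congrArg Subtype.val this

theorem IsBraid.three_le_card_fix [Finite α] (h : IsBraid N y) (hN : 4 ≤ N) (hne : y 0 ≠ y 1)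
    (hM : Nat.card {a // y 0 a ≠ a} ≤ 5) : 3 ≤ Nat.card {a // y 0 a = a} := by
  obtain ⟨w, hw, -, hf⟩ := h.exists_fix_ne hN hne hM
  exact three_le_card_of_braid ((hw.map (fixHom (y 0))).braid 0 (by omega)) hf

theorem braidConst_four : BraidConst 4 := by
  intro β _ hβ y h
  by_contra hne
  have h1 := card_move_add_card_fix (y 0)
  have h2 := h.three_le_card_fix le_rfl hne (by omega)
  have h3 := two_le_card_move (h.ne_one (by omega) hne)
  omega

theorem braidConst_five : BraidConst 5 := by
  classical
  intro β _ hβ y h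
  by_contra hne
  have h1 := card_move_add_card_fix (y 0)
  have h2 := h.three_le_card_fix (by omega) hne (by omega)
  have h3 := two_le_card_move (h.ne_one (by omega) hne)
  have hs := h.isSwap (isSwap_of_card_move (by omega))
  obtain ⟨a, b, hab, h0⟩ := hs 0 (by omega)
  obtain ⟨c, d, hcd, h2⟩ := hs 2 (by omega)
  obtain ⟨e, f, hef, h4⟩ := hs 4 (by omega)
  have c02 := h.comm 0 2 (by omega) (by omega)
  have c04 := h.comm 0 4 (by omega) (by omega)
  have c24 := h.comm 2 4 (by omega) (by omega)
  have n02 := h.ne_of_ne (by omega) hne (i := 0) (j := 2) (by omega) (by omega)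
  have n04 := h.ne_of_ne (by omega) hne (i := 0) (j := 4) (by omega) (by omega)
  have n24 := h.ne_of_ne (by omega) hne (i := 2) (j := 4) (by omega) (by omega)
  rw [h0, h2] at c02 n02
  rw [h0, h4] at c04 n04
  rw [h2, h4] at c24 n24
  have e1 := ne_of_commute_swap hab hcd c02 n02
  have e2 := ne_of_commute_swap hab hef c04 n04
  have e3 := ne_of_commute_swap hcd hef c24 n24
  have hcard : ({a, b, c, d, e, f} : Finset β).card = 6 := by
    rw [Finset.card_insert_of_notMem, Finset.card_insert_of_notMem, Finset.card_insert_of_notMem,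
      Finset.card_insert_of_notMem, Finset.card_insert_of_notMem, Finset.card_singleton] <;>
    simp [*]
  have := Fintype.ofFinite β
  have hle := Finset.card_le_univ ({a, b, c, d, e, f} : Finset β)
  rw [hcard, ← Nat.card_eq_fintype_card] at hle
  omega

theorem braidConst (hN : 4 ≤ N) : BraidConst N := by
  induction N using Nat.strong_induction_on with
  | _ N ih =>
    obtain rfl | rfl | h6 : N = 4 ∨ N = 5 ∨ 6 ≤ N := by omega
    · exact braidConst_four
    · exact braidConst_five
    · intro β _ hβ y h
      by_contra hne
      obtain ⟨w, hw, -, hw01⟩ := h.exists_tail (by omega) hne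
      have h1 := hw.card_fix (by omega) (ih (N - 2) (by omega) (by omega)) (by omega) hw01
      have h2 := card_move_add_card_fix (y 0)
      have h3 := two_le_card_move (h.ne_one (by omega) hne)
      omega

/-- Artin's theorem on braid tuples of permutations, with the exceptional case on six points. -/
theorem IsBraid.isSwap_or [Finite α] [DecidableEq α] (h : IsBraid N y) (hN : 4 ≤ N)
    (hα : Nat.card α = N + 1) (hne : y 0 ≠ y 1) :
    (y 0).IsSwap ∨ N = 5 ∧ (∀ a, y 0 (y 0 a) = a) ∧ ∀ f : α → ℤ, (∀ a, f (y 0 a) = f a) → (∀ a, f (y 2 a) = f a) →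
      (∀ a, f (y 3 a) = f a) → ∀ a b, f a = f b := by
  have h1 := card_move_add_card_fix (y 0)
  have h2 := two_le_card_move (h.ne_one (by omega) hne)
  obtain rfl | rfl | h6 : N = 4 ∨ N = 5 ∨ 6 ≤ N := by omega
  · have h3 := h.three_le_card_fix (by omega) hne (by omega)
    exact Or.inl (isSwap_of_card_move (by omega))
  · by_cases hfix : Nat.card {a // y 0 a = a} = 0
    · have hx : ∀ a, y 0 a ≠ a := fun a ha =>
        (Finite.card_eq_zero_iff.mp hfix).false ⟨a, ha⟩
      obtain ⟨w, hw, hwy, hw01⟩ := h.exists_tail (by omega) hne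
      have hq := hw.map (cycHom (y 0))
      have hq01 : cycHom (y 0) (w 0) ≠ cycHom (y 0) (w 1) := by
        intro e
        have e2 : cycHom (y 0) (w 1) = cycHom (y 0) (w 2) :=
          eq_of_braid_of_commute (hq.braid 1 (by omega)) (e ▸ hq.comm 0 2 le_rfl (by omega))
        have := congrArg Subtype.val (eq_of_cycHom_eq hw e.symm (e2.symm.trans e.symm))
        rw [hwy 0 (by omega), hwy 2 (by omega)] at this
        exact h.ne_of_ne (by omega) hne (i := 2) (j := 4) (by omega) (by omega) this.symm
      have h3 := three_le_card_of_braid (hq.braid 0 (by omega)) hq01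
      have h4 := two_mul_card_cyc_le hx
      refine Or.inr ⟨rfl, apply_apply_of_card_cyc hx (by omega), fun f f0 f2 f3 => ?_⟩
      have hf : ∀ a b, (y 0).SameCycle a b → f a = f b := by
        have hz : ∀ (k : ℤ) a, f ((y 0 ^ k) a) = f a := by
          intro k
          induction k using Int.induction_on with
          | zero => exact fun _ => rfl
          | succ k ih =>
            intro a
            rw [zpow_add_one, Perm.mul_apply, ih, f0]
          | pred k ih =>
            intro a
            rw [zpow_sub_one, Perm.mul_apply, ih, ← f0, perm_apply_inv_self]
        rintro a b ⟨k, rfl⟩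
        exact (hz k a).symm
      intro a b
      refine eq_of_braid_of_card_eq_three (by omega) (hq.braid 0 (by omega)) hq01
        (f := Quotient.lift f hf) ?_ ?_ (Quotient.mk _ a) (Quotient.mk _ b)
      · intro q
        induction q using Quotient.inductionOn with
        | h q =>
          rw [cycHom_mk, Quotient.lift_mk, Quotient.lift_mk, hwy 0 (by omega), f2]
      · intro q
        induction q using Quotient.inductionOn with
        | h q =>
          show Quotient.lift f hf (cycHom (y 0) (w 1) _) = _
          rw [cycHom_mk, Quotient.lift_mk, Quotient.lift_mk, hwy 1 (by omega), f3]
    · left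
      obtain ⟨w, hw, hwy, hf⟩ := h.exists_fix_ne (by omega) hne (by omega)
      have hb := (hw.map (fixHom (y 0))).braid 0 (by omega)
      have h3 := three_le_card_of_braid hb hf
      obtain h4 | h4 : Nat.card {a // y 0 a ≠ a} = 2 ∨ Nat.card {a // y 0 a ≠ a} = 3 := by omega
      · exact isSwap_of_card_move h4
      · have hp := h.pow_eq_one (pow_three_of_card_move h4)
        have hp' : ∀ i < 3, fixHom (y 0) (w i) ^ 3 = 1 := fun i hi => by
          rw [← map_pow, show w i ^ 3 = 1 from Subtype.ext (by
            rw [Subgroup.coe_pow, hwy i hi, hp _ (by omega)]; rfl), map_one]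
        exact absurd (eq_of_braid_of_commute hb
          (commute_of_pow_three (by omega) (hp' 0 (by omega)) (hp' 1 (by omega)))) hf
  · left
    obtain ⟨w, hw, -, hw01⟩ := h.exists_tail (by omega) hne
    have h3 := hw.card_fix (by omega) (braidConst (by omega)) (by omega) hw01
    exact isSwap_of_card_move (by omega)

end ArtinB

namespace ArtinB

open Equiv

/-! ### The action on the strands -/

variable {α : Type} {N n : ℕ} {y : ℕ → Perm α} {Φ : ArtinB n →* ArtinB n}

theorem exists_swap_of_braid [DecidableEq α] {p q : α} {w : Perm α} (hpq : p ≠ q) (hw : w.IsSwap)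
    (h : swap p q * w * swap p q = w * swap p q * w) (hne : swap p q ≠ w) :
    ∃ r, r ≠ p ∧ r ≠ q ∧ (w = swap q r ∨ w = swap p r) := by
  obtain ⟨a, b, hab, rfl⟩ := hw
  by_cases hap : a = p
  · subst hap
    exact ⟨b, hab.symm, fun e => hne (by rw [e]), Or.inr rfl⟩
  by_cases haq : a = q
  · subst haq
    exact ⟨b, fun e => hne (by rw [e, swap_comm]), hab.symm, Or.inl rfl⟩
  by_cases hbp : b = p
  · subst hbp
    exact ⟨a, hap, haq, Or.inr (swap_comm _ _)⟩
  by_cases hbq : b = q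
  · subst hbq
    exact ⟨a, hap, haq, Or.inl (swap_comm _ _)⟩
  refine absurd (eq_of_braid_of_commute h (Perm.Disjoint.commute fun c => ?_)) hne
  by_cases hc : c = p ∨ c = q
  · exact Or.inr (swap_apply_of_ne_of_ne (by grind) (by grind))
  · push Not at hc
    exact Or.inl (swap_apply_of_ne_of_ne hc.1 hc.2)

/-- A braid tuple of distinct transpositions is a chain of adjacent transpositions. -/
theorem IsBraid.exists_chain [DecidableEq α] (hN : 2 ≤ N) (h : IsBraid N y)
    (hs : ∀ i < N, (y i).IsSwap) (hne : ∀ i j, i < j → j < N → y i ≠ y j) :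
    ∃ e : ℕ → α, (∀ i j, i < j → j ≤ N → e i ≠ e j) ∧ ∀ i < N, y i = swap (e i) (e (i + 1)) := by
  induction N, hN using Nat.le_induction with
  | base =>
    obtain ⟨p, q, hpq, h0⟩ := hs 0 (by omega)
    have hb := h.braid 0 (by omega)
    have hn := hne 0 1 (by omega) (by omega)
    rw [h0] at hb hn
    obtain ⟨r, hrp, hrq, h1 | h1⟩ := exists_swap_of_braid hpq (hs 1 (by omega)) hb hn
    · refine ⟨fun i => if i = 0 then p else if i = 1 then q else r, fun i j hij hj => ?_,
        fun i hi => ?_⟩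
      · grind
      · obtain rfl | rfl : i = 0 ∨ i = 1 := by omega
        · simpa using h0
        · simpa using h1
    · refine ⟨fun i => if i = 0 then q else if i = 1 then p else r, fun i j hij hj => ?_,
        fun i hi => ?_⟩
      · grind
      · obtain rfl | rfl : i = 0 ∨ i = 1 := by omega
        · simpa [swap_comm q p] using h0
        · simpa using h1
  | succ N hN ih =>
    obtain ⟨e, he, hy⟩ := ih (h.mono (by omega)) (fun i hi => hs i (by omega))
      fun i j hij hj => hne i j hij (by omega)
    obtain ⟨k, rfl⟩ : ∃ k, N = k + 2 := ⟨N - 2, by omega⟩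
    have hb := h.braid (k + 1) (by omega)
    have hn := hne (k + 1) (k + 2) (by omega) (by omega)
    rw [hy (k + 1) (by omega)] at hb hn
    obtain ⟨r, hrp, hrq, hr⟩ := exists_swap_of_braid (he _ _ (by omega) (by omega))
      (hs (k + 2) (by omega)) hb hn
    have key : ∀ i ≤ k, ∀ a b, a ≠ b → y (k + 2) = swap a b →
        e i ≠ a ∧ e i ≠ b ∧ e (i + 1) ≠ a ∧ e (i + 1) ≠ b := by
      intro i hi a b hab hw
      have hc := h.comm i (k + 2) (by omega) (by omega)
      have hn := hne i (k + 2) (by omega) (by omega)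
      rw [hy i (by omega), hw] at hc hn
      exact ne_of_commute_swap (he _ _ (by omega) (by omega)) hab hc hn
    rcases hr with hr | hr
    · refine ⟨Function.update e (k + 3) r, fun i j hij hj => ?_, fun i hi => ?_⟩
      · rw [Function.update_of_ne (by omega)]
        by_cases hj' : j = k + 3
        · subst hj'
          rw [Function.update_self]
          by_cases h2 : i ≤ k
          · exact (key i h2 _ _ hrq.symm hr).2.1
          · obtain rfl | rfl : i = k + 1 ∨ i = k + 2 := by omega
            exacts [hrp.symm, hrq.symm]
        · rw [Function.update_of_ne hj']
          exact he _ _ hij (by omega)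
      · rw [Function.update_of_ne (by omega)]
        by_cases hi' : i = k + 2
        · subst hi'
          rw [Function.update_self, hr]
        · rw [Function.update_of_ne (by omega), hy i (by omega)]
    · exact absurd rfl (key k le_rfl _ _ hrp.symm hr).2.2.1

/-- The permutation action on the strands other than the fixed one. -/
def sgF (n : ℕ) : ArtinB n →* Perm (Fin n) :=
  MonoidHom.toHomPerm
    { toFun := fun g i => ⟨sg n g (i + 1) - 1, by
        have := sg_mem g (j := i + 1) (by omega)
        omega⟩
      map_one' := by
        funext i
        simp [Function.End.one_def]
      map_mul' := fun g h => by
        funext i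
        have := sg_mem h (j := i + 1) (by omega)
        ext
        show sg n (g * h) (i + 1) - 1 = sg n g (sg n h (i + 1) - 1 + 1) - 1
        rw [map_mul, Perm.mul_apply, Nat.sub_add_cancel this.1] }

theorem sgF_apply (g : ArtinB n) (i : Fin n) : (sgF n g i : ℕ) + 1 = sg n g (i + 1) :=
  Nat.sub_add_cancel (sg_mem g (by omega)).1

theorem sg_eq_of_sgF_eq {g h : ArtinB n} (e : sgF n g = sgF n h) : sg n g = sg n h := by
  ext j
  rcases Nat.eq_zero_or_pos j with rfl | hj
  · rw [sg_zero, sg_zero]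
  by_cases hjn : j ≤ n
  · have h1 := sgF_apply g ⟨j - 1, by omega⟩
    have h2 := sgF_apply h ⟨j - 1, by omega⟩
    rw [e] at h1
    rw [h1] at h2
    simpa [Nat.sub_add_cancel hj] using h2
  · rw [sg_of_lt _ (by omega), sg_of_lt _ (by omega)]

theorem sgF_eq_of_sg_eq {g h : ArtinB n} (e : sg n g = sg n h) : sgF n g = sgF n h := by
  ext i
  have h1 := sgF_apply g i
  have h2 := sgF_apply h i
  rw [e] at h1
  omega

theorem sgF_eq_swap {g : ArtinB n} {a b : Fin n} (h : sg n g = swap ((a : ℕ) + 1) (b + 1)) :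
    sgF n g = swap a b := by
  ext i
  have h1 := sgF_apply g i
  rw [h, swap_apply_def] at h1
  rw [swap_apply_def]
  split_ifs at h1 ⊢ <;> simp_all [Fin.ext_iff]

theorem sgF_surjective : Function.Surjective (sgF n) := by
  intro p
  induction p using Perm.swap_induction_on with
  | one => exact ⟨1, map_one _⟩
  | swap_mul f a b hab ih =>
    obtain ⟨h, rfl⟩ := ih
    obtain ⟨g, hg⟩ := swap_mem_range' (n := n) (a := a + 1) (b := b + 1) (by omega) (by omega)
    exact ⟨g * h, by rw [map_mul, sgF_eq_swap hg]⟩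

theorem Good.sgF_surjective (h : Good Φ) : Function.Surjective ((sgF n).comp Φ) := by
  intro p
  obtain ⟨g, rfl⟩ := ArtinB.sgF_surjective p
  obtain ⟨k, j, hk⟩ := h.exists_map_eq g
  refine ⟨k, sgF_eq_of_sg_eq ?_⟩
  rw [hk, map_mul, map_zpow, sg_of_central commute_artinBTwist, one_zpow, mul_one]

theorem isBraid_gen : IsBraid (n - 1) fun i => gen n (i + 1) :=
  ⟨fun i hi => gen_braid (by omega) (by omega), fun i j hij hj => gen_comm (by omega)⟩

/-- The images of the generators in the permutation group. -/
def pgen (Φ : ArtinB n →* ArtinB n) (i : ℕ) : Perm (Fin n) := sgF n (Φ (gen n (i + 1)))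

theorem isBraid_pgen : IsBraid (n - 1) (pgen Φ) := isBraid_gen.map ((sgF n).comp Φ)

/-- The image of the special generator in the permutation group. -/
def pspec (Φ : ArtinB n →* ArtinB n) : Perm (Fin n) := sgF n (Φ (gen n 0))

theorem commute_pspec {i : ℕ} (hi : 1 ≤ i) : Commute (pspec Φ) (pgen Φ i) :=
  ((gen_comm (by omega)).map Φ).map (sgF n)

/-- A subgroup containing the images of all the generators is everything. -/
theorem Good.mem_of_mem (h : Good Φ) (K : Subgroup (Perm (Fin n))) (h0 : pspec Φ ∈ K)
    (hK : ∀ i, i + 1 < n → pgen Φ i ∈ K) (p : Perm (Fin n)) : p ∈ K := by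
  obtain ⟨g, rfl⟩ := h.sgF_surjective p
  refine mem_of_gen_mem (K.comap ((sgF n).comp Φ)) (fun i hi => ?_) g
  rcases i with - | i
  · exact h0
  · exact hK i hi

theorem Good.pgen_ne (h : Good Φ) (hn : 3 ≤ n) : pgen Φ 0 ≠ pgen Φ 1 := by
  intro e
  have hall := isBraid_pgen.eq_of_eq (i := 0) (by omega) e
  have hc : ∀ i, i + 1 < n → Commute (pgen Φ 0) (pgen Φ i) := fun i hi => by
    rw [hall i (by omega)]
  have h0 : Commute (pspec Φ) (pgen Φ 0) := e ▸ commute_pspec le_rfl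
  have hcen : ∀ p, Commute (pgen Φ 0) p := fun p =>
    mem_cent.mp (h.mem_of_mem (Cent (pgen Φ 0)) (mem_cent.mpr h0.symm)
      (fun i hi => mem_cent.mpr (hc i hi)) p)
  have hcen0 : ∀ p, Commute (pspec Φ) p := fun p =>
    mem_cent.mp (h.mem_of_mem (Cent (pspec Φ)) (mem_cent.mpr (Commute.refl _))
      (fun i hi => mem_cent.mpr (by rw [hall i (by omega)]; exact h0)) p)
  have hab : ∀ p q : Perm (Fin n), Commute p q := fun p q =>
    mem_cent.mp (h.mem_of_mem (Cent p) (mem_cent.mpr (hcen0 p).symm)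
      (fun i hi => mem_cent.mpr (by rw [hall i (by omega)]; exact (hcen p).symm)) q)
  have := DFunLike.congr_fun (hab (swap ⟨0, by omega⟩ ⟨1, by omega⟩)
    (swap ⟨1, by omega⟩ ⟨2, by omega⟩)) ⟨0, by omega⟩
  simp [swap_apply_def] at this

end ArtinB

namespace ArtinB

open Equiv

variable {n : ℕ} {Φ : ArtinB n →* ArtinB n}

theorem apply_eq_or_of_commute_swap {α : Type} [DecidableEq α] {t : Perm α} {a b : α}
    (hab : a ≠ b) (h : Commute t (swap a b)) : t a = a ∨ t a = b := by
  by_contra! hc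
  have := DFunLike.congr_fun h.eq a
  rw [Perm.mul_apply, Perm.mul_apply, swap_apply_left, swap_apply_of_ne_of_ne hc.1 hc.2] at this
  exact hab (t.injective this).symm

theorem sg_eq_one_of_commute {g : ArtinB n} (hn : 3 ≤ n)
    (h : ∀ i, 2 ≤ i → i < n → Commute (sg n g) (swap i (i + 1)))
    (h4 : (sg n g * swap 1 2) ^ 2 = (swap 1 2 * sg n g) ^ 2) :
    sg n g = 1 := by
  set t := sg n g with ht
  have hl : ∀ i, 2 ≤ i → i < n → t i = i ∨ t i = i + 1 := fun i h1 h2 =>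
    apply_eq_or_of_commute_swap (by omega) (h i h1 h2)
  have hr : ∀ i, 2 ≤ i → i < n → t (i + 1) = i + 1 ∨ t (i + 1) = i := fun i h1 h2 =>
    apply_eq_or_of_commute_swap (by omega) (swap_comm i (i + 1) ▸ h i h1 h2)
  have fin : (∀ i, 2 ≤ i → i ≤ n → t i = i) → t = 1 := by
    intro hfix
    ext j
    by_cases hj : 2 ≤ j ∧ j ≤ n
    · exact hfix j hj.1 hj.2
    obtain rfl | rfl | hj' : j = 0 ∨ j = 1 ∨ n < j := by omega
    · exact sg_zero g
    · have h1 := sg_mem g (j := 1) (by omega)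
      rw [← ht] at h1
      by_contra hne
      have h2 : t 1 ≠ 1 := hne
      exact h2 (t.injective (hfix (t 1) (by omega) h1.2))
    · exact sg_of_lt g hj'
  have mid : ∀ j, 3 ≤ j → j < n → t j = j := by
    intro j h1 h2
    obtain ⟨k, rfl⟩ : ∃ k, j = k + 1 := ⟨j - 1, by omega⟩
    have := hl (k + 1) (by omega) h2
    have := hr k (by omega) (by omega)
    omega
  refine fin fun i h2 hin => ?_
  rcases hn.eq_or_lt with rfl | h4n
  · by_contra hne
    have h1 := sg_mem g (j := 1) (by omega)
    rw [← ht] at h1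
    have hl2 : t 2 = 2 ∨ t 2 = 3 := hl 2 le_rfl (by omega)
    have hr2 : t 3 = 3 ∨ t 3 = 2 := hr 2 le_rfl (by omega)
    have i12 : t 1 ≠ t 2 := t.injective.ne (by omega)
    have i13 : t 1 ≠ t 3 := t.injective.ne (by omega)
    have i23 : t 2 ≠ t 3 := t.injective.ne (by omega)
    obtain rfl | rfl : i = 2 ∨ i = 3 := by omega
    all_goals
      obtain ⟨t1, t2, t3⟩ : t 1 = 1 ∧ t 2 = 3 ∧ t 3 = 2 := by omega
      have := DFunLike.congr_fun h4 1
      simp [pow_two, swap_apply_def, t1, t2, t3] at this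
  · by_cases hi2 : i = 2
    · subst hi2
      have := mid 3 le_rfl (by omega)
      have := t.injective.ne (show 2 ≠ 3 by omega)
      have := hl 2 le_rfl (by omega)
      omega
    by_cases hi : i = n
    · subst hi
      obtain ⟨k, rfl⟩ : ∃ k, i = k + 1 := ⟨i - 1, by omega⟩
      have := mid k (by omega) (by omega)
      have := t.injective.ne (show k + 1 ≠ k by omega)
      have := hr k (by omega) (by omega)
      omega
    · exact mid i (by omega) (by omega)

theorem sgF_gen {i : ℕ} (hi : i + 1 < n) :
    sgF n (gen n (i + 1)) = swap ⟨i, by omega⟩ ⟨i + 1, hi⟩ :=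
  sgF_eq_swap (sg_gen (by omega) hi)

/-- The arithmetic constraints when the generators act as transpositions. -/
theorem Good.arith_of_isSwap (h : Good Φ) (hn : 3 ≤ n) (hs : ∀ i < n - 1, (pgen Φ i).IsSwap)
    (hne : ∀ i j, i < j → j < n - 1 → pgen Φ i ≠ pgen Φ j) :
    (n : ℤ) ∣ delta (Φ (gen n 1)) ∧ ((n : ℤ) ∣ cexp Φ - 1 ∨ (n : ℤ) ∣ cexp Φ + 1) := by
  obtain ⟨e, he, hy⟩ := isBraid_pgen.exists_chain (by omega) hs hne
  have hinj : Function.Injective fun i : Fin n => e i := by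
    intro i j hij
    rcases lt_trichotomy i j with hlt | hlt | hlt
    · exact absurd hij (he i j hlt (by omega))
    · exact hlt
    · exact absurd hij.symm (he j i hlt (by omega))
  obtain ⟨c, hc⟩ := ArtinB.sgF_surjective (Equiv.ofBijective _ (Finite.injective_iff_bijective.mp hinj))⁻¹
  have hce : ∀ i (hi : i < n), sgF n c (e i) = ⟨i, hi⟩ := by
    intro i hi
    rw [hc]
    exact Equiv.ofBijective_symm_apply_apply (fun i : Fin n => e i) _ ⟨i, hi⟩
  have hgen : ∀ i, 1 ≤ i → i < n →
      sg n ((MulAut.conj c).toMonoidHom.comp Φ (gen n i)) = sg n (gen n i) := by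
    intro i h1 hi
    obtain ⟨k, rfl⟩ : ∃ k, i = k + 1 := ⟨i - 1, by omega⟩
    refine sg_eq_of_sgF_eq ?_
    show sgF n (c * Φ (gen n (k + 1)) * c⁻¹) = _
    rw [map_mul, map_mul, map_inv, show sgF n (Φ (gen n (k + 1))) = _ from hy k (by omega),
      ← Equiv.swap_apply_apply, hce k (by omega), hce (k + 1) hi, sgF_gen hi]
  have hsg : ∀ g, sg n ((MulAut.conj c).toMonoidHom.comp Φ g) = sg n g := by
    refine fun g => DFunLike.congr_fun (hom_ext (f := (sg n).comp _) (g := sg n) fun i hi => ?_) g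
    rcases Nat.eq_zero_or_pos i with rfl | h1
    · rw [sg_gen_zero]
      refine sg_eq_one_of_commute hn (fun i h2 hi => ?_) ?_
      · rw [← sg_gen (by omega) hi, ← hgen i (by omega) hi]
        exact ((gen_comm (by omega)).map _).map _
      · rw [← sg_gen (n := n) le_rfl (by omega), ← hgen 1 le_rfl (by omega)]
        simp only [← map_mul, ← map_pow, gen_four]
    · exact hgen i h1 hi
  have hd : ∀ g, delta ((MulAut.conj c).toMonoidHom.comp Φ g) = delta (Φ g) := by
    intro g
    show delta (c * Φ g * c⁻¹) = _
    rw [delta_mul, delta_mul, delta_inv]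
    ring
  have := (h.conj c).arith_of_sg hsg hn
  rwa [cexp, hd, hd] at this

end ArtinB

namespace ArtinB

open Equiv

variable {n : ℕ} {Φ : ArtinB n →* ArtinB n}

theorem IsBraid.reverse {G : Type*} [Group G] {N : ℕ} {y : ℕ → G} (h : IsBraid N y) :
    IsBraid N fun i => y (N - 1 - i) where
  braid i hi := by
    have := h.braid (N - 1 - (i + 1)) (by omega)
    rw [show N - 1 - (i + 1) + 1 = N - 1 - i by omega] at this
    exact this.symm
  comm i j hij hj := (h.comm (N - 1 - j) (N - 1 - i) (by omega) (by omega)).symm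

theorem cv_zero_sgF {g h : ArtinB n} (hg : sgF n g = 1) (hc : Commute h g) (a : Fin n) :
    cv g 0 (sgF n h a + 1) = cv g 0 (a + 1) := by
  have hg' : sg n g = 1 := (sg_eq_of_sgF_eq (hg.trans (map_one _).symm)).trans (map_one _)
  have := cv_of_commute hg' hc 0 (a + 1)
  rwa [sg_zero, ← sgF_apply] at this

/-- An element commuting with sufficiently many others has exponent divisible by `n`. -/
theorem dvd_delta_of_transitive {g : ArtinB n}
    (hf : ∀ a b : Fin n, cv g 0 (a + 1) = cv g 0 (b + 1)) : (n : ℤ) ∣ delta g := by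
  rcases Nat.eq_zero_or_pos n with rfl | hn
  · simp [delta_eq_sum]
  refine ⟨cv g 0 1, ?_⟩
  rw [delta_eq_sum, Finset.sum_congr rfl (g := fun _ => cv g 0 1)]
  · simp
  · intro j hj
    rw [Finset.mem_Icc] at hj
    simpa [Nat.sub_add_cancel hj.1] using hf ⟨j - 1, by omega⟩ ⟨0, hn⟩

theorem delta_map_gen_succ {i : ℕ} (hi : i + 1 < n) :
    delta (Φ (gen n (i + 1))) = delta (Φ (gen n 1)) := by
  rw [delta_map, delta_gen (by omega), beta_gen (by omega) hi]
  ring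

theorem commute_map_gen (Φ : ArtinB n →* ArtinB n) {i j : ℕ} (h : i + 2 ≤ j ∨ i = j ∨ j + 2 ≤ i) :
    Commute (Φ (gen n i)) (Φ (gen n j)) := by
  refine Commute.map ?_ Φ
  rcases h with h | rfl | h
  exacts [gen_comm h, Commute.refl _, (gen_comm h).symm]

theorem Good.isSwap_of_six {Φ : ArtinB 6 →* ArtinB 6} (h : Good Φ) : (pgen Φ 0).IsSwap := by
  have hne := h.pgen_ne (by omega)
  have hb : IsBraid 5 (pgen Φ) := isBraid_pgen (Φ := Φ)
  rcases hb.isSwap_or (by omega) (by simp) hne with hs | ⟨-, hinv, htr⟩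
  · exact hs
  rcases hb.reverse.isSwap_or (by omega) (by simp)
      (hb.ne_of_ne (by omega) hne (i := 3) (j := 4) (by omega) (by omega)).symm with
    hs | ⟨-, -, htr'⟩
  · exact hb.reverse.isSwap hs 4 (by omega)
  exfalso
  have ht : pspec Φ = 1 := by
    by_contra hx
    obtain ⟨w, hw, hwy⟩ := (hb.shift 1).exists_lift (Cent (pspec Φ)) fun i hi =>
      mem_cent.mpr (commute_pspec (by omega))
    have h1 := hw.card_fix (by omega) braidConst_four (by simp) fun e => by
      have := congrArg Subtype.val e
      rw [hwy 0 (by omega), hwy 1 (by omega)] at this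
      exact hb.ne_of_ne (by omega) hne (by omega) (by omega) this
    have h2 := card_move_add_card_fix (pspec Φ)
    have h3 := two_le_card_move hx
    rw [Nat.card_fin] at h2
    omega
  have hg : sgF 6 (Φ (gen 6 1 * gen 6 1)) = 1 := by
    ext a
    rw [map_mul, map_mul]
    exact congrArg Fin.val (hinv a)
  have h1 : (6 : ℤ) ∣ delta (Φ (gen 6 1 * gen 6 1)) := dvd_delta_of_transitive
    (htr (fun a => cv (Φ (gen 6 1 * gen 6 1)) 0 (a + 1))
      (cv_zero_sgF hg (by rw [map_mul]; exact (Commute.refl _).mul_right (Commute.refl _)))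
      (cv_zero_sgF hg (by
        rw [map_mul]
        exact (commute_map_gen Φ (by omega)).mul_right (commute_map_gen Φ (by omega))))
      (cv_zero_sgF hg (by
        rw [map_mul]
        exact (commute_map_gen Φ (by omega)).mul_right (commute_map_gen Φ (by omega)))))
  have h2 : (6 : ℤ) ∣ delta (Φ (gen 6 0)) := dvd_delta_of_transitive
    (htr' (fun a => cv (Φ (gen 6 0)) 0 (a + 1))
      (cv_zero_sgF ht (commute_map_gen Φ (by omega)))
      (cv_zero_sgF ht (commute_map_gen Φ (by omega)))
      (cv_zero_sgF ht (commute_map_gen Φ (by omega))))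
  have hcop := h.isCoprime (by omega)
  rw [map_mul, delta_mul] at h1
  have h3 : (3 : ℤ) ∣ cexp Φ := by
    rw [cexp]
    push_cast
    omega
  have := (hcop.of_isCoprime_of_dvd_left h3).of_isCoprime_of_dvd_right
    (show (3 : ℤ) ∣ ((6 : ℕ) : ℤ) by norm_num)
  exact absurd (Int.isUnit_iff.mp (isCoprime_self.mp this)) (by omega)

theorem Good.arith_of_five_le (h : Good Φ) (hn : 5 ≤ n) :
    (n : ℤ) ∣ delta (Φ (gen n 1)) ∧ ((n : ℤ) ∣ cexp Φ - 1 ∨ (n : ℤ) ∣ cexp Φ + 1) := by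
  have hne := h.pgen_ne (by omega)
  have hs : (pgen Φ 0).IsSwap := by
    by_cases h6 : n = 6
    · subst h6
      exact h.isSwap_of_six
    · exact (isBraid_pgen.isSwap_or (by omega) (by simp; omega) hne).resolve_right (by omega)
  exact h.arith_of_isSwap (by omega) (isBraid_pgen.isSwap hs) fun i j hij hj =>
    isBraid_pgen.ne_of_ne (by omega) hne hij hj

theorem isSwap_of_braid_fin_three : ∀ a b : Perm (Fin 3), a * b * a = b * a * b → a ≠ b →
    ∃ x z, x ≠ z ∧ a = swap x z := by
  decide

theorem Good.arith_of_three {Φ : ArtinB 3 →* ArtinB 3} (h : Good Φ) :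
    ((3 : ℕ) : ℤ) ∣ delta (Φ (gen 3 1)) ∧
      (((3 : ℕ) : ℤ) ∣ cexp Φ - 1 ∨ ((3 : ℕ) : ℤ) ∣ cexp Φ + 1) := by
  have hne := h.pgen_ne (by omega)
  refine h.arith_of_isSwap le_rfl (isBraid_pgen.isSwap ?_) fun i j hij hj => ?_
  · exact isSwap_of_braid_fin_three _ _ (isBraid_pgen.braid 0 (by omega)) hne
  · obtain ⟨rfl, rfl⟩ : i = 0 ∧ j = 1 := by omega
    exact hne

end ArtinB

namespace ArtinB

open Equiv

theorem odd_fin_four : ∀ a : Perm (Fin 4), Perm.sign a = -1 →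
    (a * a = 1 → ∃ x z, x ≠ z ∧ a = swap x z) ∧
    (a * a ≠ 1 → (∀ x z, x = z ∨ a x = z ∨ a (a x) = z ∨ a (a (a x)) = z) ∧
      ∀ c, a * c = c * a → Perm.sign c = -1 → c = a ∨ c = a⁻¹) := by
  decide +kernel

theorem braid_fin_four : ∀ a b : Perm (Fin 4), a * b * a = b * a * b → a ≠ b →
    (∀ t, a * t = t * a → b * t = t * b → t = 1) ∧
    (a * a = 1 → ∃ x, a x = x ∧ b x = x) ∧ (Perm.sign a = -1 → (a * b) ^ 3 = 1) := by
  decide +kernel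

theorem exists_apply_ne_fin_four (x : Fin 4) : ∃ p : Perm (Fin 4), p x ≠ x :=
  ⟨swap x (x + 1), by rw [swap_apply_left]; revert x; decide⟩

theorem const_of_transitive_fin_four {a : Perm (Fin 4)}
    (h : ∀ x z, x = z ∨ a x = z ∨ a (a x) = z ∨ a (a (a x)) = z) {f : Fin 4 → ℤ}
    (hf : ∀ x, f (a x) = f x) (x z : Fin 4) : f x = f z := by
  rcases h x z with rfl | rfl | rfl | rfl <;> simp only [hf]

variable {Φ : ArtinB 4 →* ArtinB 4}

theorem IsBraid.sign_eq {N : ℕ} {y : ℕ → Perm (Fin 4)} (h : IsBraid N y) :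
    ∀ i < N, Perm.sign (y i) = Perm.sign (y 0) := by
  intro i
  induction i with
  | zero => exact fun _ => rfl
  | succ i ih =>
    intro hi
    rw [h.conj_succ hi, map_mul, map_mul, map_inv, mul_inv_cancel_comm, ih (by omega)]

theorem Good.not_two_dvd_cexp (h : Good Φ) : ¬ (2 : ℤ) ∣ cexp Φ := fun h2 => by
  have := ((h.isCoprime (by omega)).of_isCoprime_of_dvd_left h2).of_isCoprime_of_dvd_right
    (show (2 : ℤ) ∣ ((4 : ℕ) : ℤ) by norm_num)
  exact absurd (Int.isUnit_iff.mp (isCoprime_self.mp this)) (by omega)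

/-- The generators do not act with `s₁` and `s₃` equal. -/
theorem Good.pgen_ne_of_sign (h : Good Φ) (ht : pspec Φ = 1)
    (hc : (pgen Φ 0 * pgen Φ 1) ^ 3 = 1) : pgen Φ 2 ≠ pgen Φ 0 := by
  intro he
  have hb := (isBraid_pgen (Φ := Φ)).braid 0 (by omega)
  simp only [zero_add] at hb
  have hr : sgF 4 (Φ (pr 4 4)) = pgen Φ 0 * pgen Φ 1 * pgen Φ 0 := by
    have : pr 4 4 = 1 * gen 4 0 * gen 4 1 * gen 4 2 * gen 4 3 := rfl
    rw [this, one_mul]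
    simp only [map_mul]
    show pspec Φ * pgen Φ 0 * pgen Φ 1 * pgen Φ 2 = _
    rw [ht, he, one_mul]
  have hg : sgF 4 (Φ (pr 4 4 ^ 2)) = 1 := by
    rw [map_pow, map_pow, hr, ← hc, pow_two]
    nth_rw 2 [hb]
    simp only [pow_succ, pow_zero, one_mul, mul_assoc]
  have hg' : sg 4 (Φ (pr 4 4 ^ 2)) = 1 :=
    (sg_eq_of_sgF_eq (hg.trans (map_one _).symm)).trans (map_one _)
  have hz : Φ (pr 4 4 ^ 2) * Φ (pr 4 4 ^ 2) = artinBTwist 4 ^ cexp Φ := by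
    rw [← h.map_artinBTwist (by omega), artinBTwist_eq, ← map_mul, ← pow_add]
  have hcv : ∀ a : Fin 4, 2 * cv (Φ (pr 4 4 ^ 2)) 0 (a + 1) = cv (artinBTwist 4 ^ cexp Φ) 0 1 := by
    intro a
    rw [two_mul, ← cv_mul_of_pure hg', hz]
    exact cv_of_central (fun k => (commute_artinBTwist k).zpow_left _) (by omega) (by omega)
      (by omega)
  have hd := dvd_delta_of_transitive (g := Φ (pr 4 4 ^ 2)) fun a b => by
    have := hcv a
    have := hcv b
    omega
  have hdz := congrArg delta hz
  rw [delta_mul, delta_zpow, delta_artinBTwist] at hdz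
  refine h.not_two_dvd_cexp ?_
  push_cast at hd hdz
  omega

theorem Good.pgen_ne_inv (h : Good Φ) (ht : pspec Φ = 1)
    (htr : ∀ x z, x = z ∨ pgen Φ 0 x = z ∨ pgen Φ 0 (pgen Φ 0 x) = z ∨
      pgen Φ 0 (pgen Φ 0 (pgen Φ 0 x)) = z) : pgen Φ 2 ≠ (pgen Φ 0)⁻¹ := by
  intro he
  have hg : sgF 4 (Φ (gen 4 1 * gen 4 3)) = 1 := by
    rw [map_mul, map_mul]
    show pgen Φ 0 * pgen Φ 2 = 1
    rw [he, mul_inv_cancel]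
  have h1 := dvd_delta_of_transitive (g := Φ (gen 4 1 * gen 4 3)) <|
    const_of_transitive_fin_four htr (f := fun a => cv (Φ (gen 4 1 * gen 4 3)) 0 (a + 1))
      (cv_zero_sgF hg (by
        rw [map_mul]
        exact (commute_map_gen Φ (by omega)).mul_right (commute_map_gen Φ (by omega))))
  have h2 := dvd_delta_of_transitive (g := Φ (gen 4 0)) <|
    const_of_transitive_fin_four htr (f := fun a => cv (Φ (gen 4 0)) 0 (a + 1)) fun x => by
      have := cv_zero_sgF ht (commute_map_gen Φ (i := 3) (by omega)) (pgen Φ 0 x)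
      rw [show sgF 4 (Φ (gen 4 3)) = (pgen Φ 0)⁻¹ from he, perm_inv_apply_self] at this
      exact this.symm
  rw [map_mul, delta_mul, delta_map_gen_succ (i := 2) (by omega)] at h1
  refine h.not_two_dvd_cexp ?_
  rw [cexp]
  push_cast at h1 h2 ⊢
  omega

theorem Good.arith_of_four (h : Good Φ) :
    ((4 : ℕ) : ℤ) ∣ delta (Φ (gen 4 1)) ∧
      (((4 : ℕ) : ℤ) ∣ cexp Φ - 1 ∨ ((4 : ℕ) : ℤ) ∣ cexp Φ + 1) := by
  have hne := h.pgen_ne (by omega)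
  have hb : IsBraid 3 (pgen Φ) := isBraid_pgen (Φ := Φ)
  have hne' : pgen Φ 1 ≠ pgen Φ 2 := fun e => hne (hb.eq_of_eq (i := 1) (by omega) e 0 (by omega))
  have h01 := braid_fin_four _ _ (hb.braid 0 (by omega)) hne
  have ht : pspec Φ = 1 := (braid_fin_four _ _ (hb.braid 1 (by omega)) hne').1 _
    (commute_pspec le_rfl).symm (commute_pspec (by omega)).symm
  have hsign : Perm.sign (pgen Φ 0) = -1 := by
    refine (Int.units_eq_one_or _).resolve_left fun h1 => ?_
    have := h.mem_of_mem Perm.sign.ker (by rw [ht]; exact one_mem _)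
      (fun i hi => by rw [MonoidHom.mem_ker, hb.sign_eq i (by omega), h1]) (swap 0 1)
    rw [MonoidHom.mem_ker, Perm.sign_swap (by decide)] at this
    exact absurd this (by decide)
  have hodd := odd_fin_four _ hsign
  by_cases hsq : pgen Φ 0 * pgen Φ 0 = 1
  · refine h.arith_of_isSwap (by omega) (hb.isSwap (hodd.1 hsq)) ?_
    have h02 : pgen Φ 0 ≠ pgen Φ 2 := by
      intro e
      obtain ⟨x, hx0, hx1⟩ := h01.2.1 hsq
      obtain ⟨p, hp⟩ := exists_apply_ne_fin_four x
      refine hp (h.mem_of_mem (MulAction.stabilizer (Perm (Fin 4)) x) (by rw [ht]; exact one_mem _)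
        (fun i hi => ?_) p)
      obtain rfl | rfl | rfl : i = 0 ∨ i = 1 ∨ i = 2 := by omega
      exacts [hx0, hx1, e ▸ hx0]
    intro i j hij hj
    obtain ⟨rfl, rfl⟩ | ⟨rfl, rfl⟩ | ⟨rfl, rfl⟩ :
      i = 0 ∧ j = 1 ∨ i = 0 ∧ j = 2 ∨ i = 1 ∧ j = 2 := by omega
    exacts [hne, h02, hne']
  · rcases (hodd.2 hsq).2 _ (hb.comm 0 2 le_rfl (by omega))
      ((hb.sign_eq 2 (by omega)).trans hsign) with h2 | h2
    · exact absurd h2 (h.pgen_ne_of_sign ht (h01.2.2 hsign))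
    · exact absurd h2 (h.pgen_ne_inv ht (hodd.2 hsq).1)

/-- The arithmetic constraints on a lift of an automorphism of the central quotient. -/
theorem Good.arith {n : ℕ} {Φ : ArtinB n →* ArtinB n} (hn : 3 ≤ n) (h : Good Φ) :
    (n : ℤ) ∣ delta (Φ (gen n 1)) ∧ ((n : ℤ) ∣ cexp Φ - 1 ∨ (n : ℤ) ∣ cexp Φ + 1) := by
  obtain rfl | rfl | h5 : n = 3 ∨ n = 4 ∨ 5 ≤ n := by omega
  exacts [h.arith_of_three, h.arith_of_four, h.arith_of_five_le h5]

end ArtinB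

namespace ArtinB

variable {n : ℕ}

/-! ### The section -/

/-- A lift which is normalised on the exponent of the special generator. -/
def IsNormLift (φ : MulAut (ArtinB n ⧸ Subgroup.center (ArtinB n))) (Φ : ArtinB n →* ArtinB n) :
    Prop :=
  IsLift φ Φ ∧ ∃ ε : ℤ, (ε = 1 ∨ ε = -1) ∧ ∀ g, delta (Φ g) = ε * delta g

theorem exists_isNormLift (hn : 3 ≤ n) (φ : MulAut (ArtinB n ⧸ Subgroup.center (ArtinB n))) :
    ∃ Φ, IsNormLift φ Φ := by
  obtain ⟨Φ, hΦ⟩ := exists_isLift φ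
  obtain ⟨⟨y, hy⟩, hk⟩ := Good.arith hn ⟨φ, hΦ⟩
  obtain ⟨ε, hε, x, hx⟩ : ∃ ε : ℤ, (ε = 1 ∨ ε = -1) ∧ (n : ℤ) ∣ cexp Φ - ε :=
    hk.elim (fun h => ⟨1, Or.inl rfl, h⟩) fun h => ⟨-1, Or.inr rfl, by simpa using h⟩
  refine ⟨twist Φ (-x + (n - 1) * y) (-y), hΦ.twist _ _, ε, hε, fun g => ?_⟩
  rw [cexp] at hx
  rw [twist_apply, delta_mul, delta_zpow, delta_artinBTwist, delta_map]
  linear_combination delta g * hx + (beta g - (n - 1) * delta g) * hy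

theorem IsNormLift.unique (hn : 3 ≤ n) {φ : MulAut (ArtinB n ⧸ Subgroup.center (ArtinB n))}
    {Φ Ψ : ArtinB n →* ArtinB n} (hΦ : IsNormLift φ Φ) (hΨ : IsNormLift φ Ψ) : Φ = Ψ := by
  obtain ⟨hΦ, ε, hε, h1⟩ := hΦ
  obtain ⟨hΨ, ε', hε', h2⟩ := hΨ
  have key : ∀ g, ∃ j : ℤ, Ψ g = Φ g * artinBTwist n ^ j ∧ ε' * delta g = ε * delta g + j * n := by
    intro g
    obtain ⟨j, hj⟩ := mk_eq_mk.mp ((hΦ g).trans (hΨ g).symm)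
    exact ⟨j, hj, by rw [← h1, ← h2, hj, delta_mul, delta_zpow, delta_artinBTwist]⟩
  have hee : ε' = ε := by
    obtain ⟨j, -, hj⟩ := key (gen n 0)
    rw [delta_gen_zero (by omega), mul_one, mul_one] at hj
    have hj0 : j = 0 := by
      by_contra hne
      have h3 : (n : ℤ) ≤ |j * n| := by
        rw [abs_mul, Nat.abs_cast]
        exact le_mul_of_one_le_left (by positivity) (Int.one_le_abs hne)
      have h4 : |j * n| ≤ 2 := by
        rw [abs_le]; constructor <;> omega
      omega
    rw [hj, hj0]; ring
  refine MonoidHom.ext fun g => ?_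
  obtain ⟨j, hj, h3⟩ := key g
  have h4 : j * n = 0 := by rw [hee] at h3; linarith
  rw [hj, (mul_eq_zero.mp h4).resolve_right (by positivity), zpow_zero, mul_one]

theorem IsNormLift.comp {φ ψ : MulAut (ArtinB n ⧸ Subgroup.center (ArtinB n))}
    {Φ Ψ : ArtinB n →* ArtinB n} (hΦ : IsNormLift φ Φ) (hΨ : IsNormLift ψ Ψ) :
    IsNormLift (φ * ψ) (Φ.comp Ψ) := by
  obtain ⟨hΦ, ε, hε, h1⟩ := hΦ
  obtain ⟨hΨ, ε', hε', h2⟩ := hΨ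
  refine ⟨hΦ.comp hΨ, ε * ε', ?_, fun g => by rw [MonoidHom.comp_apply, h1, h2, mul_assoc]⟩
  rcases hε with rfl | rfl <;> rcases hε' with rfl | rfl <;> simp

theorem isNormLift_one :
    IsNormLift (1 : MulAut (ArtinB n ⧸ Subgroup.center (ArtinB n))) (MonoidHom.id _) :=
  ⟨fun _ => rfl, 1, Or.inl rfl, fun g => by rw [one_mul]; rfl⟩

theorem exists_section (hn : 3 ≤ n) :
    ∃ s : MulAut (ArtinB n ⧸ Subgroup.center (ArtinB n)) →* MulAut (ArtinB n),
      (centerQuotAut (ArtinB n)).comp s = MonoidHom.id _ := by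
  choose F hF using exists_isNormLift hn
  have hmul : ∀ φ ψ, F (φ * ψ) = (F φ).comp (F ψ) := fun φ ψ =>
    (hF _).unique hn ((hF φ).comp (hF ψ))
  have hone : F 1 = MonoidHom.id _ := (hF 1).unique hn isNormLift_one
  refine ⟨⟨⟨fun φ => MonoidHom.toMulEquiv (F φ) (F φ⁻¹)
    (by rw [← hmul, inv_mul_cancel, hone]) (by rw [← hmul, mul_inv_cancel, hone]), ?_⟩, ?_⟩, ?_⟩
  · ext g
    exact DFunLike.congr_fun hone g
  · intro φ ψ
    ext g
    exact DFunLike.congr_fun (hmul φ ψ) g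
  · ext φ x
    induction x using QuotientGroup.induction_on with
    | _ g => exact (hF φ).1 g

end ArtinB

/-- For `n ≥ 3`, the natural homomorphism
`Aut(C(B_n)) → Aut(C(B_n)/Z)` is a split surjection: it is surjective and admits a
group-homomorphism section. -/
theorem artinB_aut_to_aut_central_quotient_split_surjective
    (n : ℕ) (hn : 3 ≤ n) :
    Function.Surjective (centerQuotAut (ArtinB n)) ∧
    ∃ s : MulAut (ArtinB n ⧸ Subgroup.center (ArtinB n)) →* MulAut (ArtinB n),
      (centerQuotAut (ArtinB n)).comp s = MonoidHom.id _ := by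
  obtain ⟨s, hs⟩ := ArtinB.exists_section hn
  exact ⟨fun φ => ⟨s φ, DFunLike.congr_fun hs φ⟩, s, hs⟩
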